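/- arXiv:1901.06915 — 8 statements merged into one kernel-verified Lean document; each statement's English description precedes it below -/
import Mathlib

section
/- There exists an absolute constant C2 > 0 such that for all sufficiently large n and every prime power q with q > C2 · n^5 / log n, there exists a maximally recoverable code that instantiates the grid-like topology T_{3×n}(1,3,0) over the field F_q. -/
/-- A set of `m × n` matrices over `F` is a code instantiating the grid-like topology
`T_{m×n}(a,b,0)`: it is the tensor product code of a column code cut out by `a`
parity-check equations and a row code cut out by `b` parity-check equations. -/
def IsTensorTopologyCode (F : Type) [Field F] (m n a b : ℕ)
    (C : Set (Matrix (Fin m) (Fin n) F)) : Prop :=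
  ∃ (Hcol : Matrix (Fin a) (Fin m) F) (Hrow : Matrix (Fin b) (Fin n) F),
    C = {c | (∀ j, Hcol.mulVec (fun i => c i j) = 0) ∧ ∀ i, Hrow.mulVec (c i) = 0}

/-- A code `C` corrects the erasure pattern `E` if every codeword is uniquely
determined by its entries outside `E`. -/
def CorrectsPattern {F : Type} [Field F] {m n : ℕ} (C : Set (Matrix (Fin m) (Fin n) F))
    (E : Finset (Fin m × Fin n)) : Prop :=
  ∀ c₁ ∈ C, ∀ c₂ ∈ C, (∀ p : Fin m × Fin n, p ∉ E → c₁ p.1 p.2 = c₂ p.1 p.2) → c₁ = c₂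

/-- An erasure pattern `E` is correctable for the topology `T_{m×n}(a,b,0)` if over some
finite field there is a code instantiating the topology which corrects `E`. -/
def CorrectableForTopology (m n a b : ℕ) (E : Finset (Fin m × Fin n)) : Prop :=
  ∃ (F : Type) (_fi : Field F) (_ft : Fintype F),
    haveI := _fi
    ∃ C : Set (Matrix (Fin m) (Fin n) F), IsTensorTopologyCode F m n a b C ∧ CorrectsPattern C E

/-- A code is maximally recoverable for `T_{m×n}(a,b,0)` if it instantiates the topology
and corrects every erasure pattern that is correctable for the topology. -/
def IsMaximallyRecoverable (F : Type) [Field F] (m n a b : ℕ)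
    (C : Set (Matrix (Fin m) (Fin n) F)) : Prop :=
  IsTensorTopologyCode F m n a b C ∧
    ∀ E : Finset (Fin m × Fin n), CorrectableForTopology m n a b E → CorrectsPattern C E

namespace MRproof
open Finset
open scoped Classical

lemma card_not_superset {α : Type*} [DecidableEq α] (A e : Finset α) (he : e ⊆ A)
    (h5 : e.card = 5) :
    ((A.powerset.filter (fun S => e ⊆ S)).card : ℝ) = 2 ^ A.card / 32 := by
  have h1 : A.powerset.filter (fun S => e ⊆ S) = (A \ e).powerset.image (fun S => e ∪ S) := by
    ext S
    simp only [mem_filter, mem_powerset, mem_image]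
    constructor
    · rintro ⟨h, h'⟩
      exact ⟨S \ e, sdiff_subset_sdiff h (subset_refl _), union_sdiff_of_subset h'⟩
    · rintro ⟨T, hT, rfl⟩
      exact ⟨union_subset he (hT.trans sdiff_subset), subset_union_left⟩
  rw [h1, card_image_of_injOn, card_powerset, card_sdiff_of_subset he, h5]
  · have : 5 ≤ A.card := h5 ▸ card_le_card he
    obtain ⟨k, hk⟩ := Nat.exists_eq_add_of_le this
    rw [hk]; simp [pow_add]; ring
  · intro S hS T hT h
    simp only [coe_powerset, Set.mem_preimage, Set.mem_powerset_iff, coe_subset] at hS hT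
    have hd : ∀ S ⊆ A \ e, (e ∪ S) \ e = S := by
      intro S hS
      ext x
      simp only [mem_sdiff, mem_union]
      constructor
      · tauto
      · intro hx; have := mem_sdiff.1 (hS hx); tauto
    rw [← hd S hS, ← hd T hT]
    simp only at h
    rw [h]

lemma kleitman_count {α : Type*} [DecidableEq α] (A : Finset α) (G : Finset (Finset α))
    (hG : ∀ e ∈ G, e ⊆ A ∧ e.card = 5) :
    (2:ℝ) ^ A.card * (31/32) ^ G.card ≤
      ((A.powerset.filter (fun S => ∀ e ∈ G, ¬ e ⊆ S)).card : ℝ) := by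
  induction G using Finset.induction_on with
  | empty => simp
  | insert e G he ih =>
    have ih' := ih (fun f hf => hG f (mem_insert_of_mem hf))
    obtain ⟨heA, he5⟩ := hG e (mem_insert_self _ _)
    set X := A.powerset.filter (fun S => ∀ e ∈ G, ¬ e ⊆ S) with hX
    set Z := A.powerset.filter (fun S => ¬ e ⊆ S) with hZ
    have hXl : IsLowerSet (X : Set (Finset α)) := by
      intro S T hTS hS
      simp only [hX, coe_filter, mem_powerset, Set.mem_ofPred_eq] at hS ⊢
      exact ⟨(show T ⊆ S from hTS).trans hS.1, fun f hf h => hS.2 f hf (h.trans hTS)⟩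
    have hZl : IsLowerSet (Z : Set (Finset α)) := by
      intro S T hTS hS
      simp only [hZ, coe_filter, mem_powerset, Set.mem_ofPred_eq] at hS ⊢
      exact ⟨(show T ⊆ S from hTS).trans hS.1, fun h => hS.2 (h.trans hTS)⟩
    have key := hXl.le_card_inter_finset' hZl (s := A)
      (fun t ht => mem_powerset.1 (mem_filter.1 ht).1)
      (fun t ht => mem_powerset.1 (mem_filter.1 ht).1)
    have hXZ : X ∩ Z = A.powerset.filter (fun S => ∀ f ∈ insert e G, ¬ f ⊆ S) := by
      ext S
      simp only [hX, hZ, mem_inter, mem_filter, mem_insert, forall_eq_or_imp]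
      tauto
    have hZc : (Z.card : ℝ) = 2 ^ A.card * (31/32) := by
      have h1 := card_not_superset A e heA he5
      have h2 := card_filter_add_card_filter_not (s := A.powerset) (fun S => e ⊆ S)
      rw [card_powerset] at h2
      have h3 : ((A.powerset.filter (fun S => e ⊆ S)).card : ℝ) + Z.card = 2 ^ A.card := by
        exact_mod_cast h2
      linarith
    rw [← hXZ, card_insert_of_notMem he]
    have key' : (X.card : ℝ) * Z.card ≤ 2 ^ A.card * (X ∩ Z).card := by exact_mod_cast key
    rw [hZc] at key'
    have hp : (0:ℝ) < 2 ^ A.card := by positivity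
    have : (X.card : ℝ) * (31/32) ≤ (X ∩ Z).card := by
      by_contra hcon
      push Not at hcon
      nlinarith
    calc (2:ℝ) ^ A.card * (31/32) ^ (G.card + 1) = (2 ^ A.card * (31/32) ^ G.card) * (31/32) := by
          ring
      _ ≤ X.card * (31/32) := by gcongr
      _ ≤ _ := this

lemma exp_tangent (K : ℕ) (l : ℝ) :
    Real.exp (-l) * (1 + l - K / 16) ≤ (31/32 : ℝ) ^ K := by
  have h1 : Real.exp (-(1/16)) ≤ (31/32 : ℝ) := by
    have : (32/31 : ℝ) ≤ Real.exp (1/16) := by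
      have := Real.add_one_le_exp (1/16 : ℝ)
      linarith
    rw [Real.exp_neg]
    rw [inv_le_comm₀ (Real.exp_pos _) (by norm_num)]
    linarith
  have h2 : Real.exp (-(K/16)) ≤ (31/32 : ℝ) ^ K := by
    calc Real.exp (-(K/16)) = Real.exp (-(1/16)) ^ K := by
          rw [← Real.exp_nat_mul]; congr 1; ring
      _ ≤ _ := by gcongr
  refine le_trans ?_ h2
  have h3 : Real.exp (-(K/16 : ℝ)) = Real.exp (-l) * Real.exp (l - K/16) := by
    rw [← Real.exp_add]; congr 1; ring
  rw [h3]
  have := Real.add_one_le_exp (l - K/16 : ℝ)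
  have hp := Real.exp_pos (-l)
  apply mul_le_mul_of_nonneg_left _ hp.le
  linarith

/-- local estimate -/
lemma core {ι : Type*} [Fintype ι] [DecidableEq ι] (G : Finset (Finset ι))
    (h6 : ∀ e ∈ G, e.card = 6) (i : ι)
    (nice : ∀ e₁ ∈ G, ∀ e₂ ∈ G, ∀ f ∈ G, i ∈ e₁ → i ∈ e₂ → i ∉ f → (f ∩ (e₁ ∪ e₂)).card ≤ 1)
    (l : ℝ) (A B : Finset (Finset ι)) (Y : ℝ)
    (hA : A = univ.filter (fun I => i ∉ I ∧ ∀ e ∈ G, ¬ e ⊆ I))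
    (hB : B = A.filter (fun I => ∀ e ∈ G, ¬ e ⊆ insert i I))
    (hY : Y = ∑ I ∈ A, ((G.filter (fun e => i ∈ e ∧ e.erase i ⊆ I)).card : ℝ)) :
    Real.exp (-l) * ((1 + l) * A.card - 2 * Y) ≤ B.card := by
  set N : Finset ι := (G.filter (fun e => i ∈ e)).biUnion (fun e => e.erase i) with hN
  have hNmem : ∀ x, x ∈ N ↔ ∃ e ∈ G, i ∈ e ∧ x ≠ i ∧ x ∈ e := by
    intro x; simp only [hN, mem_biUnion, mem_filter, mem_erase];
    constructor
    · rintro ⟨e, ⟨h1, h2⟩, h3⟩; exact ⟨e, h1, h2, h3⟩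
    · rintro ⟨e, h1, h2, h3⟩; exact ⟨e, ⟨h1, h2⟩, h3⟩
  have hfN : ∀ f ∈ G, i ∉ f → ∀ x ∈ f, ∀ y ∈ f, x ∈ N → y ∈ N → x = y := by
    intro f hf hif x hx y hy hxN hyN
    obtain ⟨e₁, he₁, hi₁, _, hx₁⟩ := (hNmem x).1 hxN
    obtain ⟨e₂, he₂, hi₂, _, hy₂⟩ := (hNmem y).1 hyN
    have := nice e₁ he₁ e₂ he₂ f hf hi₁ hi₂ hif
    rw [card_le_one] at this
    exact this x (by simp [hx, hx₁]) y (by simp [hy, hy₂])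
  -- fibers
  have hmaps : ∀ I ∈ A, I \ N ∈ (univ : Finset (Finset ι)) := fun _ _ => mem_univ _
  have hmapsB : ∀ I ∈ B, I \ N ∈ (univ : Finset (Finset ι)) := fun _ _ => mem_univ _
  rw [card_eq_sum_card_fiberwise hmaps, card_eq_sum_card_fiberwise hmapsB, hY,
    ← sum_fiberwise_of_maps_to hmaps]
  push_cast
  rw [mul_sum, mul_sum, ← sum_sub_distrib, mul_sum]
  apply sum_le_sum
  intro J _
  by_cases hJe : (A.filter (fun I => I \ N = J)) = ∅
  · rw [hJe]; simp
  obtain ⟨I₀, hI₀⟩ := nonempty_iff_ne_empty.2 hJe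
  obtain ⟨hI₀A, hI₀J⟩ := mem_filter.1 hI₀
  rw [hA, mem_filter] at hI₀A
  obtain ⟨-, hiI₀, hindI₀⟩ := hI₀A
  have hJI₀ : J ⊆ I₀ := hI₀J ▸ sdiff_subset
  have hJN : Disjoint J N := hI₀J ▸ sdiff_disjoint
  have hiJ : i ∉ J := fun h => hiI₀ (hJI₀ h)
  have hJind : ∀ e ∈ G, ¬ e ⊆ J := fun e he h => hindI₀ e he (h.trans hJI₀)
  have hiN : i ∉ N := by
    intro h; obtain ⟨e, _, _, h, _⟩ := (hNmem i).1 h; exact h rfl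
  set Av : Finset ι := N.filter (fun x => ∀ e ∈ G, ¬ e ⊆ insert x J) with hAv
  have hAvN : Av ⊆ N := filter_subset _ _
  have hAfib : A.filter (fun I => I \ N = J) = Av.powerset.image (fun S => J ∪ S) := by
    ext I
    simp only [hA, mem_filter, mem_univ, true_and, mem_image, mem_powerset]
    constructor
    · rintro ⟨⟨hiI, hind⟩, hIJ⟩
      refine ⟨I ∩ N, ?_, ?_⟩
      · intro x hx
        rw [mem_inter] at hx
        refine mem_filter.2 ⟨hx.2, fun e he h => hind e he (h.trans ?_)⟩
        exact insert_subset hx.1 (hIJ ▸ sdiff_subset)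
      · rw [← hIJ]; exact sdiff_union_inter I N
    · rintro ⟨S, hS, rfl⟩
      have hSN := hS.trans hAvN
      refine ⟨⟨?_, ?_⟩, ?_⟩
      · rw [mem_union]; rintro (h | h)
        · exact hiJ h
        · exact hiN (hSN h)
      · intro e he hsub
        have hie : i ∉ e := by
          intro h
          rcases mem_union.1 (hsub h) with h | h
          · exact hiJ h
          · exact hiN (hSN h)
        by_cases hx : ∃ x ∈ e, x ∈ N
        · obtain ⟨x, hxe, hxN⟩ := hx
          have hxJ : x ∉ J := fun h => (disjoint_left.1 hJN h) hxN
          have hxS : x ∈ S := by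
            rcases mem_union.1 (hsub hxe) with h | h
            · exact absurd h hxJ
            · exact h
          refine (mem_filter.1 (hS hxS)).2 e he ?_
          intro y hy
          rcases mem_union.1 (hsub hy) with h | h
          · exact mem_insert_of_mem h
          · rw [hfN e he hie y hy x hxe (hSN h) hxN]; exact mem_insert_self _ _
        · push Not at hx
          refine hJind e he ?_
          intro y hy
          rcases mem_union.1 (hsub hy) with h | h
          · exact h
          · exact absurd (hSN h) (hx y hy)
      · ext x
        simp only [mem_sdiff, mem_union]
        constructor
        · rintro ⟨h | h, h'⟩
          · exact h
          · exact absurd (hSN h) h'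
        · intro h; exact ⟨Or.inl h, disjoint_left.1 hJN h⟩
  have hinj : Set.InjOn (fun S => J ∪ S) (Av.powerset : Set (Finset ι)) := by
    intro S hS T hT h
    simp only [coe_powerset, Set.mem_preimage, Set.mem_powerset_iff, coe_subset] at hS hT
    have hd : ∀ S ⊆ Av, (J ∪ S) ∩ N = S := by
      intro S hS
      ext x
      simp only [mem_inter, mem_union]
      constructor
      · rintro ⟨h | h, h'⟩
        · exact absurd h' (disjoint_left.1 hJN h)
        · exact h
      · intro h; exact ⟨Or.inr h, hAvN (hS h)⟩
    rw [← hd S hS, ← hd T hT]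
    simp only at h
    rw [h]
  have hsubiff : ∀ S ⊆ Av, ∀ e ∈ G, i ∈ e → (e.erase i ⊆ J ∪ S ↔ e.erase i ⊆ S) := by
    intro S hS e he hie
    have heN : e.erase i ⊆ N := by
      intro x hx; exact (hNmem x).2 ⟨e, he, hie, (mem_erase.1 hx).1, (mem_erase.1 hx).2⟩
    constructor
    · intro h x hx
      rcases mem_union.1 (h hx) with h' | h'
      · exact absurd (heN hx) (disjoint_left.1 hJN h')
      · exact h'
    · intro h; exact h.trans subset_union_right
  set G' : Finset (Finset ι) := (G.filter (fun e => i ∈ e ∧ e.erase i ⊆ Av)).image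
    (fun e => e.erase i) with hG'
  have hG'inj : Set.InjOn (fun e : Finset ι => e.erase i)
      (G.filter (fun e => i ∈ e ∧ e.erase i ⊆ Av) : Set (Finset ι)) := by
    intro e he f hf h
    simp only [coe_filter, Set.mem_ofPred_eq] at he hf h
    rw [← insert_erase he.2.1, ← insert_erase hf.2.1, h]
  have hG'5 : ∀ e ∈ G', e ⊆ Av ∧ e.card = 5 := by
    intro e he
    obtain ⟨g, hg, rfl⟩ := mem_image.1 he
    obtain ⟨hgG, hig, hgA⟩ := mem_filter.1 hg
    exact ⟨hgA, by rw [card_erase_of_mem hig, h6 g hgG]⟩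
  have haJ : ((A.filter (fun I => I \ N = J)).card : ℝ) = 2 ^ Av.card := by
    rw [hAfib, card_image_of_injOn hinj, card_powerset]; push_cast; rfl
  have hYJ : ∑ I ∈ A.filter (fun I => I \ N = J),
      ((G.filter (fun e => i ∈ e ∧ e.erase i ⊆ I)).card : ℝ) = G'.card * (2 ^ Av.card / 32) := by
    rw [hAfib, sum_image hinj]
    have : ∀ S ∈ Av.powerset, ((G.filter (fun e => i ∈ e ∧ e.erase i ⊆ J ∪ S)).card : ℝ) =
        ∑ g ∈ G', if g ⊆ S then (1:ℝ) else 0 := by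
      intro S hS
      rw [mem_powerset] at hS
      rw [hG', sum_image hG'inj, ← sum_filter, filter_filter, sum_const, nsmul_eq_mul, mul_one]
      congr 2
      ext e
      simp only [mem_filter]
      constructor
      · rintro ⟨h1, h2, h3⟩
        have := (hsubiff S hS e h1 h2).1 h3
        exact ⟨h1, ⟨h2, this.trans hS⟩, this⟩
      · rintro ⟨h1, ⟨h2, _⟩, h3⟩
        exact ⟨h1, h2, (hsubiff S hS e h1 h2).2 h3⟩
    rw [sum_congr rfl this, sum_comm]
    rw [← nsmul_eq_mul, ← sum_const]
    apply sum_congr rfl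
    intro g hg
    rw [← sum_filter, sum_const, nsmul_eq_mul, mul_one]
    exact card_not_superset Av g (hG'5 g hg).1 (hG'5 g hg).2
  have hbJ : ((Av.powerset.filter (fun S => ∀ e ∈ G', ¬ e ⊆ S)).card : ℝ) ≤
      ((B.filter (fun I => I \ N = J)).card : ℝ) := by
    rw [← card_image_of_injOn (hinj.mono (coe_subset.2 (filter_subset _ _)))]
    norm_cast
    apply card_le_card
    intro I hI
    obtain ⟨S, hS, rfl⟩ := mem_image.1 hI
    obtain ⟨hSA, hSG⟩ := mem_filter.1 hS
    have hmem : J ∪ S ∈ A.filter (fun I => I \ N = J) := by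
      rw [hAfib]; exact mem_image_of_mem _ hSA
    rw [mem_powerset] at hSA
    obtain ⟨hmA, hmJ⟩ := mem_filter.1 hmem
    refine mem_filter.2 ⟨?_, hmJ⟩
    rw [hB]
    refine mem_filter.2 ⟨hmA, ?_⟩
    intro e he hsub
    rw [hA, mem_filter] at hmA
    by_cases hie : i ∈ e
    · have h1 : e.erase i ⊆ J ∪ S := by
        intro x hx
        rw [mem_erase] at hx
        exact mem_of_mem_insert_of_ne (hsub hx.2) hx.1
      have h2 := (hsubiff S hSA e he hie).1 h1
      exact hSG _ (mem_image_of_mem _ (mem_filter.2 ⟨he, hie, h2.trans hSA⟩)) h2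
    · refine hmA.2.2 e he ?_
      intro x hx
      exact mem_of_mem_insert_of_ne (hsub hx) (fun h => hie (h ▸ hx))
  refine le_trans ?_ hbJ
  refine le_trans ?_ (le_of_le_of_eq (kleitman_count Av G' hG'5) (by congr!))
  rw [haJ, hYJ]
  have h1 := exp_tangent G'.card l
  have hp : (0:ℝ) < 2 ^ Av.card := by positivity
  calc _ = 2 ^ Av.card * (Real.exp (-l) * (1 + l - G'.card / 16)) := by ring
    _ ≤ _ := by gcongr

end MRproof

namespace MRproof
open Finset
open scoped Classical

/-- index sets mapped by `w` onto a hyperedge -/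
noncomputable def edges {ι V : Type*} [Fintype ι] [DecidableEq V]
    (H : Finset (Finset V)) (w : ι → V) : Finset (Finset ι) :=
  univ.filter (fun e => e.card = 6 ∧ e.image w ∈ H)

section
set_option linter.unusedSectionVars false
variable {ι V : Type*} [Fintype ι] [DecidableEq ι] [Fintype V] [DecidableEq V]
  (H : Finset (Finset V))

lemma mem_edges (w : ι → V) (e : Finset ι) :
    e ∈ edges H w ↔ e.card = 6 ∧ e.image w ∈ H := by simp [edges]

lemma sum_update (i : ι) (g : (ι → V) → ℝ) :
    ∑ w, ∑ x, g (Function.update w i x) = Fintype.card V * ∑ w, g w := by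
  have h1 : ∑ w, ∑ x, g (Function.update w i x) =
      ∑ p : (ι → V) × V, g (Function.update p.1 i p.2) := by
    rw [Fintype.sum_prod_type]
  have h2 : ∑ p : (ι → V) × V, g (Function.update p.1 i p.2) = ∑ p : (ι → V) × V, g p.1 := by
    refine Fintype.sum_bijective (fun p : (ι → V) × V => (Function.update p.1 i p.2, p.1 i)) ?_ _ _
      (fun p => rfl)
    apply Function.Involutive.bijective
    rintro ⟨w, x⟩
    simp
  rw [h1, h2, Fintype.sum_prod_type]
  simp [mul_sum]

lemma image_update_of_notMem (w : ι → V) (i : ι) (x : V) (e : Finset ι) (h : i ∉ e) :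
    e.image (Function.update w i x) = e.image w := by
  apply image_congr
  intro j hj
  exact Function.update_of_ne (fun h' => h (by rw [← h']; exact hj)) _ _

lemma edges_update (w : ι → V) (i : ι) (x : V) (e : Finset ι) (h : i ∉ e) :
    e ∈ edges H (Function.update w i x) ↔ e ∈ edges H w := by
  rw [mem_edges, mem_edges, image_update_of_notMem w i x e h]


lemma fiber_le (d : ℕ) (h6 : ∀ h ∈ H, h.card = 6)
    (hd : ∀ T : Finset V, T.card = 5 → (univ.filter (fun x => x ∉ T ∧ insert x T ∈ H)).card ≤ d)
    (w : ι → V) (f : Finset ι) (i : ι) (hi : i ∈ f) :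
    (univ.filter (fun x => f ∈ edges H (Function.update w i x))).card ≤ d := by
  set T := (f.erase i).image w with hT
  have him : ∀ x, f.image (Function.update w i x) = insert x T := by
    intro x
    conv_lhs => rw [← insert_erase hi]
    rw [image_insert, Function.update_self, image_update_of_notMem _ _ _ _ (notMem_erase i f)]
  by_cases hne : (univ.filter (fun x => f ∈ edges H (Function.update w i x))) = ∅
  · rw [hne]; simp
  obtain ⟨x₀, hx₀⟩ := nonempty_iff_ne_empty.2 hne
  simp only [mem_filter, mem_univ, true_and, mem_edges, him] at hx₀
  have hT5' : T.card ≤ 5 := by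
    refine card_image_le.trans ?_
    rw [card_erase_of_mem hi, hx₀.1]
  have hT5 : T.card = 5 := by
    have h1 := h6 _ hx₀.2
    have := card_insert_le x₀ T
    omega
  refine le_trans (card_le_card ?_) (hd T hT5)
  intro x hx
  simp only [mem_filter, mem_univ, true_and, mem_edges, him] at hx ⊢
  refine ⟨?_, hx.2⟩
  intro hxT
  have h1 := h6 _ hx.2
  rw [insert_eq_of_mem hxT] at h1
  omega

lemma fresh (d : ℕ) (h6 : ∀ h ∈ H, h.card = 6)
    (hd : ∀ T : Finset V, T.card = 5 → (univ.filter (fun x => x ∉ T ∧ insert x T ∈ H)).card ≤ d)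
    (P : (ι → V) → Prop) (f : Finset ι) (i : ι) (hi : i ∈ f)
    (hP : ∀ w x, P (Function.update w i x) ↔ P w) :
    (Fintype.card V : ℝ) * (univ.filter (fun w : ι → V => P w ∧ f ∈ edges H w)).card ≤
      d * (univ.filter (fun w : ι → V => P w)).card := by
  have h1 : ((univ.filter (fun w : ι → V => P w ∧ f ∈ edges H w)).card : ℝ) =
      ∑ w : ι → V, if P w ∧ f ∈ edges H w then (1:ℝ) else 0 := by
    rw [← sum_filter]; simp
  rw [h1, ← sum_update i]
  have h2 : ((univ.filter (fun w : ι → V => P w)).card : ℝ) =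
      ∑ w : ι → V, if P w then (1:ℝ) else 0 := by
    rw [← sum_filter]; simp
  rw [h2, mul_sum]
  apply sum_le_sum
  intro w _
  by_cases hw : P w
  · simp only [hP, hw, true_and, if_true, mul_one]
    rw [← sum_filter]
    simp only [sum_const, nsmul_eq_mul, mul_one]
    exact_mod_cast fiber_le H d h6 hd w f i hi
  · simp [hP, hw]

lemma one_edge (d : ℕ) (h6 : ∀ h ∈ H, h.card = 6)
    (hd : ∀ T : Finset V, T.card = 5 → (univ.filter (fun x => x ∉ T ∧ insert x T ∈ H)).card ≤ d)
    (e : Finset ι) (i : ι) (hi : i ∈ e) :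
    (Fintype.card V : ℝ) * (univ.filter (fun w : ι → V => e ∈ edges H w)).card ≤
      d * (Fintype.card (ι → V)) := by
  have := fresh H d h6 hd (fun _ : ι → V => True) e i hi (fun _ _ => Iff.rfl)
  simpa using this

lemma two_edge (d : ℕ) (h6 : ∀ h ∈ H, h.card = 6)
    (hd : ∀ T : Finset V, T.card = 5 → (univ.filter (fun x => x ∉ T ∧ insert x T ∈ H)).card ≤ d)
    (e f : Finset ι) (i j : ι) (hi : i ∈ e) (hj : j ∈ f) (hje : j ∉ e) :
    (Fintype.card V : ℝ) ^ 2 * (univ.filter (fun w : ι → V => e ∈ edges H w ∧ f ∈ edges H w)).card ≤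
      d ^ 2 * (Fintype.card (ι → V)) := by
  have h1 := fresh H d h6 hd (fun w : ι → V => e ∈ edges H w) f j hj
    (fun w x => edges_update H w j x e hje)
  have h2 := one_edge H d h6 hd e i hi
  calc _ = (Fintype.card V : ℝ) * ((Fintype.card V : ℝ) *
      (univ.filter (fun w : ι → V => e ∈ edges H w ∧ f ∈ edges H w)).card) := by ring
    _ ≤ (Fintype.card V : ℝ) * (d * (univ.filter (fun w : ι → V => e ∈ edges H w)).card) :=
        mul_le_mul_of_nonneg_left (by convert h1 <;> rfl) (by positivity)
    _ = d * ((Fintype.card V : ℝ) * (univ.filter (fun w : ι → V => e ∈ edges H w)).card) := by ring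
    _ ≤ d * (d * (Fintype.card (ι → V))) := by gcongr
    _ = _ := by ring

lemma three_edge (d : ℕ) (h6 : ∀ h ∈ H, h.card = 6)
    (hd : ∀ T : Finset V, T.card = 5 → (univ.filter (fun x => x ∉ T ∧ insert x T ∈ H)).card ≤ d)
    (e f g : Finset ι) (i j k : ι) (hi : i ∈ e) (hj : j ∈ f) (hje : j ∉ e)
    (hk : k ∈ g) (hke : k ∉ e) (hkf : k ∉ f) :
    (Fintype.card V : ℝ) ^ 3 * (univ.filter
      (fun w : ι → V => (e ∈ edges H w ∧ f ∈ edges H w) ∧ g ∈ edges H w)).card ≤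
      d ^ 3 * (Fintype.card (ι → V)) := by
  have h1 := fresh H d h6 hd (fun w : ι → V => e ∈ edges H w ∧ f ∈ edges H w) g k hk
    (fun w x => and_congr (edges_update H w k x e hke) (edges_update H w k x f hkf))
  have h2 := two_edge H d h6 hd e f i j hi hj hje
  calc _ = (Fintype.card V : ℝ)^2 * ((Fintype.card V : ℝ) * (univ.filter
      (fun w : ι → V => (e ∈ edges H w ∧ f ∈ edges H w) ∧ g ∈ edges H w)).card) := by ring
    _ ≤ (Fintype.card V : ℝ)^2 * (d * (univ.filter
      (fun w : ι → V => e ∈ edges H w ∧ f ∈ edges H w)).card) :=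
        mul_le_mul_of_nonneg_left (by convert h1 <;> rfl) (by positivity)
    _ = d * ((Fintype.card V : ℝ)^2 * (univ.filter
      (fun w : ι → V => e ∈ edges H w ∧ f ∈ edges H w)).card) := by ring
    _ ≤ d * (d ^ 2 * (Fintype.card (ι → V))) := by gcongr
    _ = _ := by ring

lemma coincide (i j : ι) (hij : i ≠ j) :
    (Fintype.card V : ℝ) * (univ.filter (fun w : ι → V => w i = w j)).card ≤
      Fintype.card (ι → V) := by
  have h1 : ((univ.filter (fun w : ι → V => w i = w j)).card : ℝ) =
      ∑ w : ι → V, if w i = w j then (1:ℝ) else 0 := by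
    rw [← sum_filter]; simp
  rw [h1, ← sum_update i]
  have : ∀ w : ι → V, (∑ x, if (Function.update w i x) i = (Function.update w i x) j
      then (1:ℝ) else 0) = 1 := by
    intro w
    simp [Function.update_of_ne hij.symm]
  rw [sum_congr rfl (fun w _ => this w)]
  simp

lemma count_e (i : ι) :
    ((univ.filter (fun e : Finset ι => e.card = 6 ∧ i ∈ e)).card : ℝ) ≤ (Fintype.card ι) ^ 5 := by
  have h : (univ.filter (fun e : Finset ι => e.card = 6 ∧ i ∈ e)).card ≤
      (powersetCard 5 (univ : Finset ι)).card := by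
    apply card_le_card_of_injOn (fun e => e.erase i)
    · intro e he
      simp only [coe_filter, mem_univ, true_and, Set.mem_ofPred_eq] at he
      simp [mem_powersetCard, card_erase_of_mem he.2, he.1]
    · intro e he f hf h
      simp only [coe_filter, mem_univ, true_and, Set.mem_ofPred_eq] at he hf h
      rw [← insert_erase he.2, ← insert_erase hf.2, h]
  rw [card_powersetCard, card_univ] at h
  exact_mod_cast h.trans (Nat.choose_le_pow _ _)

lemma count_f (U : Finset ι) :
    ((univ.filter (fun f : Finset ι => f.card = 6 ∧ 2 ≤ (f ∩ U).card)).card : ℝ) ≤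
      U.card ^ 2 * (Fintype.card ι) ^ 4 := by
  have h : (univ.filter (fun f : Finset ι => f.card = 6 ∧ 2 ≤ (f ∩ U).card)).card ≤
      (powersetCard 2 U ×ˢ powersetCard 4 (univ : Finset ι)).card := by
    refine le_trans (card_le_card ?_) (card_image_le (f := fun p : Finset ι × Finset ι => p.1 ∪ p.2))
    intro f hf
    simp only [mem_filter, mem_univ, true_and] at hf
    obtain ⟨T, hT, hT2⟩ := exists_subset_card_eq hf.2
    have hTf : T ⊆ f := hT.trans inter_subset_left
    refine mem_image.2 ⟨(T, f \ T), ?_, union_sdiff_of_subset hTf⟩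
    simp only [mem_product, mem_powersetCard, subset_univ, true_and]
    exact ⟨⟨hT.trans inter_subset_right, hT2⟩, by rw [card_sdiff_of_subset hTf]; omega⟩
  rw [card_product, card_powersetCard, card_powersetCard, card_univ] at h
  exact_mod_cast h.trans (Nat.mul_le_mul (Nat.choose_le_pow _ _) (Nat.choose_le_pow _ _))

end

/-- niceness of index i with respect to w -/
def Nice {ι V : Type*} [Fintype ι] [DecidableEq ι] [DecidableEq V]
    (H : Finset (Finset V)) (w : ι → V) (i : ι) : Prop :=
  Function.Injective w ∧ ∀ e₁ ∈ edges H w, ∀ e₂ ∈ edges H w, ∀ f ∈ edges H w,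
    i ∈ e₁ → i ∈ e₂ → i ∉ f → (f ∩ (e₁ ∪ e₂)).card ≤ 1

section
set_option linter.unusedSectionVars false
variable {ι V : Type*} [Fintype ι] [DecidableEq ι] [Fintype V] [DecidableEq V]
  (H : Finset (Finset V))

lemma not_nice_cases (w : ι → V) (i : ι) (h : ¬ Nice H w i) :
    (∃ p ∈ univ.filter (fun p : ι × ι => p.1 ≠ p.2), w p.1 = w p.2) ∨
    (∃ e ∈ univ.filter (fun e : Finset ι => e.card = 6 ∧ i ∈ e),
      ∃ f ∈ univ.filter (fun f : Finset ι => f.card = 6 ∧ 2 ≤ (f ∩ e).card),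
        ¬ f ⊆ e ∧ e ∈ edges H w ∧ f ∈ edges H w) ∨
    (∃ e₁ ∈ univ.filter (fun e : Finset ι => e.card = 6 ∧ i ∈ e),
      ∃ e₂ ∈ univ.filter (fun e : Finset ι => e.card = 6 ∧ i ∈ e),
      ∃ f ∈ univ.filter (fun f : Finset ι => f.card = 6 ∧ 2 ≤ (f ∩ (e₁ ∪ e₂)).card),
        (¬ e₂ ⊆ e₁ ∧ ¬ f ⊆ e₁ ∪ e₂) ∧ (e₁ ∈ edges H w ∧ e₂ ∈ edges H w) ∧ f ∈ edges H w) := by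
  by_contra hcon
  push Not at hcon
  obtain ⟨c1, c2, c3⟩ := hcon
  simp only [mem_filter, mem_univ, true_and] at c1 c2 c3
  apply h
  refine ⟨?_, ?_⟩
  · intro a b hab
    by_contra hne
    exact c1 (a, b) hne hab
  intro e₁ he₁ e₂ he₂ f hf hi₁ hi₂ hif
  by_contra hgt
  have h16 := ((mem_edges H w e₁).1 he₁).1
  have h26 := ((mem_edges H w e₂).1 he₂).1
  have hf6 := ((mem_edges H w f).1 hf).1
  have hnsub : ∀ e ∈ edges H w, i ∈ e → ¬ f ⊆ e := by
    intro e he hie hsub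
    have he6 := ((mem_edges H w e).1 he).1
    have := eq_of_subset_of_card_le hsub (by omega)
    exact hif (this ▸ hie)
  have small : ∀ e ∈ edges H w, i ∈ e → (f ∩ e).card ≤ 1 := by
    intro e he hie
    by_contra hgt
    exact c2 e ⟨((mem_edges H w e).1 he).1, hie⟩ f ⟨hf6, by omega⟩ (hnsub e he hie) he hf
  have s1 := small e₁ he₁ hi₁
  have s2 := small e₂ he₂ hi₂
  refine c3 e₁ ⟨h16, hi₁⟩ e₂ ⟨h26, hi₂⟩ f ⟨hf6, by omega⟩ ?_ ⟨he₁, he₂⟩ hf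
  refine ⟨?_, ?_⟩
  · intro hsub
    rw [union_eq_left.2 hsub] at hgt
    exact hgt s1
  · intro hsub
    have : f ∩ (e₁ ∪ e₂) = (f ∩ e₁) ∪ (f ∩ e₂) := inter_union_distrib_left _ _ _
    have h3 := card_union_le (f ∩ e₁) (f ∩ e₂)
    rw [← this, inter_eq_left.2 hsub] at h3
    omega


lemma count_not_nice (d : ℕ) (h6 : ∀ h ∈ H, h.card = 6)
    (hd : ∀ T : Finset V, T.card = 5 → (univ.filter (fun x => x ∉ T ∧ insert x T ∈ H)).card ≤ d)
    (hV : 0 < Fintype.card V) (i : ι) :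
    ((univ.filter (fun w : ι → V => ¬ Nice H w i)).card : ℝ) ≤
      Fintype.card (ι → V) * ((Fintype.card ι : ℝ) ^ 2 / Fintype.card V +
        36 * (Fintype.card ι : ℝ) ^ 9 * (d / Fintype.card V) ^ 2 +
        144 * (Fintype.card ι : ℝ) ^ 14 * (d / Fintype.card V) ^ 3) := by
  set M : ℝ := (Fintype.card ι : ℝ) with hM
  set q : ℝ := (Fintype.card V : ℝ) with hq
  set Q : ℝ := (Fintype.card (ι → V) : ℝ) with hQ
  have hq0 : 0 < q := by rw [hq]; exact_mod_cast hV
  have hQ0 : 0 ≤ Q := by positivity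
  have hM0 : 0 ≤ M := by positivity
  set E := univ.filter (fun e : Finset ι => e.card = 6 ∧ i ∈ e) with hE
  have hEc : (E.card : ℝ) ≤ M ^ 5 := count_e i
  set Fs : Finset ι → Finset (Finset ι) := fun U =>
    univ.filter (fun f : Finset ι => f.card = 6 ∧ 2 ≤ (f ∩ U).card) with hFs
  set PP := univ.filter (fun p : ι × ι => p.1 ≠ p.2) with hPP
  set W1 := PP.biUnion (fun p => univ.filter (fun w : ι → V => w p.1 = w p.2)) with hW1
  set W2 := E.biUnion (fun e => (Fs e).biUnion (fun f => univ.filter (fun w : ι → V =>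
    ¬ f ⊆ e ∧ e ∈ edges H w ∧ f ∈ edges H w))) with hW2
  set W3 := E.biUnion (fun e₁ => E.biUnion (fun e₂ => (Fs (e₁ ∪ e₂)).biUnion (fun f =>
    univ.filter (fun w : ι → V => (¬ e₂ ⊆ e₁ ∧ ¬ f ⊆ e₁ ∪ e₂) ∧
      (e₁ ∈ edges H w ∧ e₂ ∈ edges H w) ∧ f ∈ edges H w)))) with hW3
  have hsub : univ.filter (fun w : ι → V => ¬ Nice H w i) ⊆ W1 ∪ (W2 ∪ W3) := by
    intro w hw
    have := not_nice_cases H w i (mem_filter.1 hw).2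
    simp only [mem_union, hW1, hW2, hW3, mem_biUnion]
    rcases this with ⟨p, hp, h⟩ | ⟨e, he, f, hf, h⟩ | ⟨e₁, he₁, e₂, he₂, f, hf, h⟩
    · exact Or.inl ⟨p, hp, mem_filter.2 ⟨mem_univ _, h⟩⟩
    · exact Or.inr (Or.inl ⟨e, he, f, hf, mem_filter.2 ⟨mem_univ _, h⟩⟩)
    · exact Or.inr (Or.inr ⟨e₁, he₁, e₂, he₂, f, hf, mem_filter.2 ⟨mem_univ _, h⟩⟩)
  have b1 : (W1.card : ℝ) ≤ M ^ 2 * (Q / q) := by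
    have hb : (W1.card : ℝ) ≤ ∑ p ∈ PP, ((univ.filter (fun w : ι → V => w p.1 = w p.2)).card : ℝ) := by
      exact_mod_cast card_biUnion_le
    refine hb.trans ?_
    have hp : ∀ p ∈ PP, ((univ.filter (fun w : ι → V => w p.1 = w p.2)).card : ℝ) ≤ Q / q := by
      intro p hp
      rw [le_div_iff₀ hq0, mul_comm]
      exact coincide p.1 p.2 (mem_filter.1 hp).2
    refine (sum_le_card_nsmul _ _ _ hp).trans ?_
    rw [nsmul_eq_mul]
    have : (PP.card : ℝ) ≤ M ^ 2 := by
      have := card_le_univ PP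
      rw [Fintype.card_prod] at this
      rw [hM, sq]; exact_mod_cast this
    gcongr
  have b2 : (W2.card : ℝ) ≤ M ^ 5 * (36 * M ^ 4 * (d ^ 2 * Q / q ^ 2)) := by
    have hb : (W2.card : ℝ) ≤ ∑ e ∈ E, (((Fs e).biUnion (fun f => univ.filter (fun w : ι → V =>
        ¬ f ⊆ e ∧ e ∈ edges H w ∧ f ∈ edges H w))).card : ℝ) := by
      exact_mod_cast card_biUnion_le
    refine hb.trans ?_
    refine (sum_le_card_nsmul _ _ (36 * M ^ 4 * (d ^ 2 * Q / q ^ 2)) ?_).trans ?_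
    · intro e he
      obtain ⟨he6, hie⟩ := (mem_filter.1 he).2
      have hb : ((((Fs e).biUnion (fun f => univ.filter (fun w : ι → V =>
        ¬ f ⊆ e ∧ e ∈ edges H w ∧ f ∈ edges H w)))).card : ℝ) ≤ ∑ f ∈ Fs e,
          ((univ.filter (fun w : ι → V => ¬ f ⊆ e ∧ e ∈ edges H w ∧ f ∈ edges H w)).card : ℝ) := by
        exact_mod_cast card_biUnion_le
      refine hb.trans ?_
      refine (sum_le_card_nsmul _ _ (d ^ 2 * Q / q ^ 2) ?_).trans ?_
      · intro f hf
        by_cases hfe : f ⊆ e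
        · simp only [hfe, not_true, false_and, filter_false, card_empty, Nat.cast_zero]
          positivity
        · obtain ⟨j, hj, hje⟩ := not_subset.1 hfe
          simp only [hfe, not_false_iff, true_and]
          rw [le_div_iff₀ (by positivity), mul_comm]
          exact two_edge H d h6 hd e f i j hie hj hje
      · rw [nsmul_eq_mul]
        have := count_f e
        rw [he6] at this
        have h36 : ((Fs e).card : ℝ) ≤ 36 * M ^ 4 := by
          refine this.trans (le_of_eq ?_); norm_num [hM]
        gcongr
    · rw [nsmul_eq_mul]
      gcongr
  have b3 : (W3.card : ℝ) ≤ M ^ 5 * (M ^ 5 * (144 * M ^ 4 * (d ^ 3 * Q / q ^ 3))) := by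
    refine (show (W3.card : ℝ) ≤ ∑ e₁ ∈ E, ((E.biUnion (fun e₂ => (Fs (e₁ ∪ e₂)).biUnion (fun f =>
      univ.filter (fun w : ι → V => (¬ e₂ ⊆ e₁ ∧ ¬ f ⊆ e₁ ∪ e₂) ∧
      (e₁ ∈ edges H w ∧ e₂ ∈ edges H w) ∧ f ∈ edges H w)))).card : ℝ) by
        exact_mod_cast card_biUnion_le).trans ?_
    refine (sum_le_card_nsmul _ _ (M ^ 5 * (144 * M ^ 4 * (d ^ 3 * Q / q ^ 3))) ?_).trans ?_
    · intro e₁ he₁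
      obtain ⟨h16, hi1⟩ := (mem_filter.1 he₁).2
      refine (show _ ≤ ∑ e₂ ∈ E, (((Fs (e₁ ∪ e₂)).biUnion (fun f =>
        univ.filter (fun w : ι → V => (¬ e₂ ⊆ e₁ ∧ ¬ f ⊆ e₁ ∪ e₂) ∧
        (e₁ ∈ edges H w ∧ e₂ ∈ edges H w) ∧ f ∈ edges H w))).card : ℝ) by
          exact_mod_cast card_biUnion_le).trans ?_
      refine (sum_le_card_nsmul _ _ (144 * M ^ 4 * (d ^ 3 * Q / q ^ 3)) ?_).trans ?_
      · intro e₂ he₂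
        obtain ⟨h26, hi2⟩ := (mem_filter.1 he₂).2
        refine (show _ ≤ ∑ f ∈ Fs (e₁ ∪ e₂), ((
          univ.filter (fun w : ι → V => (¬ e₂ ⊆ e₁ ∧ ¬ f ⊆ e₁ ∪ e₂) ∧
          (e₁ ∈ edges H w ∧ e₂ ∈ edges H w) ∧ f ∈ edges H w)).card : ℝ) by
            exact_mod_cast card_biUnion_le).trans ?_
        refine (sum_le_card_nsmul _ _ (d ^ 3 * Q / q ^ 3) ?_).trans ?_
        · intro f hf
          by_cases hc : ¬ e₂ ⊆ e₁ ∧ ¬ f ⊆ e₁ ∪ e₂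
          · obtain ⟨j, hj, hje⟩ := not_subset.1 hc.1
            obtain ⟨k, hk, hke⟩ := not_subset.1 hc.2
            rw [mem_union, not_or] at hke
            rw [le_div_iff₀ (by positivity), mul_comm]
            refine le_trans ?_ (three_edge H d h6 hd e₁ e₂ f i j k hi1 hj hje hk hke.1 hke.2)
            refine mul_le_mul_of_nonneg_left ?_ (by positivity)
            norm_cast
            refine card_le_card ?_
            intro w hw
            exact mem_filter.2 ⟨mem_univ _, (mem_filter.1 hw).2.2⟩
          · simp only [hc, false_and, filter_false, card_empty, Nat.cast_zero]
            positivity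
        · rw [nsmul_eq_mul]
          have := count_f (e₁ ∪ e₂)
          have hU : ((e₁ ∪ e₂).card : ℝ) ≤ 12 := by
            have := card_union_le e₁ e₂
            rw [h16, h26] at this
            exact_mod_cast this
          have h144 : ((Fs (e₁ ∪ e₂)).card : ℝ) ≤ 144 * M ^ 4 := by
            refine this.trans ?_
            have : ((e₁ ∪ e₂).card : ℝ) ^ 2 ≤ 12 ^ 2 := by gcongr
            have h12 : (12:ℝ)^2 = 144 := by norm_num
            rw [h12] at this
            gcongr
          gcongr
      · rw [nsmul_eq_mul]
        gcongr
    · rw [nsmul_eq_mul]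
      gcongr
  have hcard : ((univ.filter (fun w : ι → V => ¬ Nice H w i)).card : ℝ) ≤
      W1.card + (W2.card + W3.card) := by
    have h1 := card_le_card hsub
    have h2 := card_union_le W1 (W2 ∪ W3)
    have h3 := card_union_le W2 W3
    exact_mod_cast (h1.trans h2).trans (by omega)
  calc _ ≤ _ := hcard
    _ ≤ M ^ 2 * (Q / q) + (M ^ 5 * (36 * M ^ 4 * (d ^ 2 * Q / q ^ 2)) +
        M ^ 5 * (M ^ 5 * (144 * M ^ 4 * (d ^ 3 * Q / q ^ 3)))) := by gcongr
    _ = _ := by field_simp; ring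

end
end MRproof

namespace MRproof
open Finset
open scoped Classical

/-- independent index sets -/
noncomputable def Ind {ι V : Type*} [Fintype ι] [DecidableEq V]
    (H : Finset (Finset V)) (w : ι → V) : Finset (Finset ι) :=
  univ.filter (fun I => Set.InjOn w I ∧ ∀ e ∈ edges H w, ¬ e ⊆ I)

/-- average number of closing sets -/
noncomputable def Ybar {ι V : Type*} [Fintype ι] [DecidableEq ι] [DecidableEq V]
    (H : Finset (Finset V)) (i : ι) (w : ι → V) : ℝ :=
  (∑ I ∈ (Ind H w).filter (fun I => i ∉ I),
    (((edges H w).filter (fun e => i ∈ e ∧ e.erase i ⊆ I)).card : ℝ)) /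
    ((Ind H w).filter (fun I => i ∉ I)).card

section
set_option linter.unusedSectionVars false
variable {ι V : Type*} [Fintype ι] [DecidableEq ι] [Fintype V] [DecidableEq V]
  (H : Finset (Finset V))

lemma mem_Ind (w : ι → V) (I : Finset ι) :
    I ∈ Ind H w ↔ Set.InjOn w I ∧ ∀ e ∈ edges H w, ¬ e ⊆ I := by simp [Ind]

lemma Ind_mono (w : ι → V) (I J : Finset ι) (h : J ⊆ I) (hI : I ∈ Ind H w) : J ∈ Ind H w := by
  rw [mem_Ind] at hI ⊢
  exact ⟨hI.1.mono (coe_subset.2 h), fun e he h' => hI.2 e he (h'.trans h)⟩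

lemma Ybar_nonneg (i : ι) (w : ι → V) : 0 ≤ Ybar H i w := by
  unfold Ybar; positivity

lemma Ind_size (h6 : ∀ h ∈ H, h.card = 6) (n : ℕ)
    (hno : ∀ S : Finset V, S.card = n → ∃ h ∈ H, h ⊆ S) (w : ι → V) (I : Finset ι)
    (hI : I ∈ Ind H w) : I.card ≤ n := by
  by_contra hlt
  push Not at hlt
  obtain ⟨J, hJI, hJ⟩ := exists_subset_card_eq hlt.le
  have hJ' := Ind_mono H w I J hJI hI
  rw [mem_Ind] at hJ'
  obtain ⟨hinj, hind⟩ := hJ'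
  obtain ⟨h, hh, hsub⟩ := hno (J.image w) (by rw [card_image_of_injOn hinj, hJ])
  have him : (J.filter (fun j => w j ∈ h)).image w = h := by
    ext x
    simp only [mem_image, mem_filter]
    constructor
    · rintro ⟨j, ⟨_, h1⟩, rfl⟩; exact h1
    · intro hx
      obtain ⟨j, hj, rfl⟩ := mem_image.1 (hsub hx)
      exact ⟨j, ⟨hj, hx⟩, rfl⟩
  refine hind (J.filter (fun j => w j ∈ h)) ?_ (filter_subset _ _)
  rw [mem_edges, him]
  refine ⟨?_, hh⟩
  rw [← h6 h hh, ← him, card_image_of_injOn (hinj.mono (coe_subset.2 (filter_subset _ _)))]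
  rw [him]

lemma sum_B (w : ι → V) (n : ℕ) (hs : ∀ I ∈ Ind H w, I.card ≤ n) :
    ∑ i : ι, (((Ind H w).filter (fun I => i ∈ I)).card : ℝ) / (Ind H w).card ≤ n := by
  have hpos : (0:ℝ) < (Ind H w).card := by
    have : ∅ ∈ Ind H w := by
      rw [mem_Ind]
      refine ⟨by simp, ?_⟩
      intro e he h
      rw [subset_empty.1 h, mem_edges] at he
      simp at he
    exact_mod_cast card_pos.2 ⟨_, this⟩
  rw [← sum_div, div_le_iff₀ hpos]
  have h1 : ∑ i : ι, ((Ind H w).filter (fun I => i ∈ I)).card = ∑ I ∈ Ind H w, I.card := by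
    simp_rw [card_filter]
    rw [sum_comm]
    apply sum_congr rfl
    intro I _
    simp
  have h2 : ∑ I ∈ Ind H w, I.card ≤ (Ind H w).card * n := by
    have := sum_le_card_nsmul (Ind H w) (fun I => I.card) n hs
    simpa using this
  rw [← h1] at h2
  rw [mul_comm]
  exact_mod_cast h2

lemma p_lower (w : ι → V) (i : ι) (hn : Nice H w i) (l : ℝ) :
    Real.exp (-l) / 2 * ((1 + l) - 2 * Ybar H i w) ≤
      (((Ind H w).filter (fun I => i ∈ I)).card : ℝ) / (Ind H w).card := by
  obtain ⟨hinj, hnice⟩ := hn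
  set A := (Ind H w).filter (fun I => i ∉ I) with hAdef
  set Bi := (Ind H w).filter (fun I => i ∈ I) with hBi
  have hA : A = univ.filter (fun I => i ∉ I ∧ ∀ e ∈ edges H w, ¬ e ⊆ I) := by
    ext I
    simp only [hAdef, mem_filter, mem_Ind, mem_univ, true_and]
    constructor
    · rintro ⟨⟨_, h⟩, h'⟩; exact ⟨h', h⟩
    · rintro ⟨h', h⟩; exact ⟨⟨hinj.injOn, h⟩, h'⟩
  have hcore := core (edges H w) (fun e he => ((mem_edges H w e).1 he).1) i hnice l A
    (A.filter (fun I => ∀ e ∈ edges H w, ¬ e ⊆ insert i I)) _ hA rfl rfl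
  set Y := ∑ I ∈ A, (((edges H w).filter (fun e => i ∈ e ∧ e.erase i ⊆ I)).card : ℝ) with hY
  have hYb : Ybar H i w = Y / A.card := rfl
  have hBB : (A.filter (fun I => ∀ e ∈ edges H w, ¬ e ⊆ insert i I)).card ≤ Bi.card := by
    apply card_le_card_of_injOn (fun I => insert i I)
    · intro I hI
      have hI := mem_coe.1 hI
      simp only [mem_filter] at hI
      refine mem_coe.2 (mem_filter.2 ⟨?_, mem_insert_self _ _⟩)
      rw [mem_Ind]
      exact ⟨hinj.injOn, hI.2⟩
    · intro I hI J hJ h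
      have hI := mem_coe.1 hI
      have hJ := mem_coe.1 hJ
      simp only [mem_filter, hAdef] at hI hJ
      simp only at h
      rw [← erase_insert hI.1.2, ← erase_insert hJ.1.2, h]
  have hBA : Bi.card ≤ A.card := by
    apply card_le_card_of_injOn (fun I => I.erase i)
    · intro I hI
      have hI := mem_coe.1 hI
      simp only [hBi, mem_filter] at hI
      exact mem_coe.2 (mem_filter.2 ⟨Ind_mono H w _ _ (erase_subset _ _) hI.1, notMem_erase _ _⟩)
    · intro I hI J hJ h
      have hI := mem_coe.1 hI
      have hJ := mem_coe.1 hJ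
      simp only [mem_filter, hBi] at hI hJ
      simp only at h
      rw [← insert_erase hI.2, ← insert_erase hJ.2, h]
  have hz : (Ind H w).card = Bi.card + A.card :=
    (card_filter_add_card_filter_not (s := Ind H w) (fun I => i ∈ I)).symm
  have hApos : (0:ℝ) < A.card := by
    have : ∅ ∈ A := by
      rw [hA]
      refine mem_filter.2 ⟨mem_univ _, by simp, ?_⟩
      intro e he h
      rw [subset_empty.1 h, mem_edges] at he
      simp at he
    exact_mod_cast card_pos.2 ⟨_, this⟩
  have hz2 : ((Ind H w).card : ℝ) ≤ 2 * A.card := by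
    rw [hz]; push_cast
    have : (Bi.card : ℝ) ≤ A.card := by exact_mod_cast hBA
    linarith
  have hzpos : (0:ℝ) < (Ind H w).card := by
    rw [hz]; push_cast
    have : (0:ℝ) ≤ Bi.card := by positivity
    linarith
  have hc : Real.exp (-l) * ((1 + l) * A.card - 2 * Y) ≤ Bi.card :=
    hcore.trans (by exact_mod_cast hBB)
  have e1 : Real.exp (-l) / 2 * ((1 + l) - 2 * Ybar H i w) =
      (Real.exp (-l) * ((1 + l) * A.card - 2 * Y)) / (2 * A.card) := by
    rw [hYb]; field_simp
  rw [e1]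
  calc _ ≤ (Bi.card : ℝ) / (2 * A.card) := by gcongr
    _ ≤ _ := by gcongr


lemma sum_Ybar (d : ℕ) (h6 : ∀ h ∈ H, h.card = 6)
    (hd : ∀ T : Finset V, T.card = 5 → (univ.filter (fun x => x ∉ T ∧ insert x T ∈ H)).card ≤ d)
    (hV : 0 < Fintype.card V) (n : ℕ)
    (hno : ∀ S : Finset V, S.card = n → ∃ h ∈ H, h ⊆ S) (i : ι) :
    ∑ w : ι → V, Ybar H i w ≤ Fintype.card (ι → V) * (d * (n:ℝ) ^ 5 / Fintype.card V) := by
  have hq : (0:ℝ) < Fintype.card V := by exact_mod_cast hV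
  rw [mul_div_assoc', le_div_iff₀ hq, mul_comm, ← sum_update i]
  have key : ∀ w : ι → V, ∑ x, Ybar H i (Function.update w i x) ≤ d * (n:ℝ) ^ 5 := by
    intro w
    have hAeq : ∀ x, (Ind H (Function.update w i x)).filter (fun I => i ∉ I) =
        (Ind H w).filter (fun I => i ∉ I) := by
      intro x
      ext I
      simp only [mem_filter, mem_Ind]
      refine and_congr_left ?_
      intro hiI
      refine and_congr ?_ ?_
      · apply Set.EqOn.injOn_iff
        intro j hj
        exact Function.update_of_ne (fun h => hiI (by rw [← h]; exact hj)) _ _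
      · refine forall_congr' fun e => ?_
        by_cases hie : i ∈ e
        · exact ⟨fun _ _ h => hiI (h hie), fun _ _ h => hiI (h hie)⟩
        · rw [edges_update H w i x e hie]
    unfold Ybar
    simp_rw [hAeq]
    set A := (Ind H w).filter (fun I => i ∉ I) with hA
    rw [← sum_div, sum_comm]
    have hone : ∀ I ∈ A, ∑ x, (((edges H (Function.update w i x)).filter
        (fun e => i ∈ e ∧ e.erase i ⊆ I)).card : ℝ) ≤ d * (n:ℝ) ^ 5 := by
      intro I hI
      have hIn : I.card ≤ n := Ind_size H h6 n hno w I (mem_filter.1 hI).1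
      set EE := univ.filter (fun e : Finset ι => e.card = 6 ∧ i ∈ e ∧ e.erase i ⊆ I) with hEE
      have hEEc : EE.card ≤ n ^ 5 := by
        have : EE.card ≤ (powersetCard 5 I).card := by
          apply card_le_card_of_injOn (fun e => e.erase i)
          · intro e he
            have he := mem_coe.1 he
            simp only [hEE, mem_filter, mem_univ, true_and] at he
            refine mem_coe.2 (mem_powersetCard.2 ⟨he.2.2, ?_⟩)
            rw [card_erase_of_mem he.2.1, he.1]
          · intro e he f hf h
            have he := mem_coe.1 he
            have hf := mem_coe.1 hf
            simp only [hEE, mem_filter, mem_univ, true_and] at he hf h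
            rw [← insert_erase he.2.1, ← insert_erase hf.2.1, h]
        rw [card_powersetCard] at this
        exact (this.trans (Nat.choose_le_pow _ _)).trans (Nat.pow_le_pow_left hIn 5)
      have hx : ∀ x, ((edges H (Function.update w i x)).filter
          (fun e => i ∈ e ∧ e.erase i ⊆ I)).card =
          ∑ e ∈ EE, if e ∈ edges H (Function.update w i x) then 1 else 0 := by
        intro x
        rw [← card_filter]
        congr 1
        ext e
        simp only [hEE, mem_filter, mem_univ, true_and]
        constructor
        · rintro ⟨h1, h2⟩; exact ⟨⟨((mem_edges _ _ _).1 h1).1, h2⟩, h1⟩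
        · rintro ⟨⟨_, h2⟩, h1⟩; exact ⟨h1, h2⟩
      have : ∑ x, ((edges H (Function.update w i x)).filter
          (fun e => i ∈ e ∧ e.erase i ⊆ I)).card ≤ d * n ^ 5 := by
        rw [sum_congr rfl (fun x _ => hx x), sum_comm]
        calc _ ≤ ∑ e ∈ EE, d := by
              apply sum_le_sum
              intro e he
              rw [← card_filter]
              exact fiber_le H d h6 hd w e i (mem_filter.1 he).2.2.1
          _ = EE.card * d := by simp
          _ ≤ n ^ 5 * d := by gcongr
          _ = _ := by ring
      exact_mod_cast this
    have hsum := sum_le_card_nsmul A _ _ hone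
    rw [nsmul_eq_mul] at hsum
    apply div_le_of_le_mul₀ (by positivity) (by positivity)
    linarith
  calc _ ≤ ∑ w : ι → V, d * (n:ℝ) ^ 5 := sum_le_sum (fun w _ => key w)
    _ = _ := by simp

theorem main_ineq (d : ℕ) (h6 : ∀ h ∈ H, h.card = 6)
    (hd : ∀ T : Finset V, T.card = 5 → (univ.filter (fun x => x ∉ T ∧ insert x T ∈ H)).card ≤ d)
    (hV : 0 < Fintype.card V) (n : ℕ)
    (hno : ∀ S : Finset V, S.card = n → ∃ h ∈ H, h ⊆ S) (l : ℝ)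
    (hl : l = 4 * (d * (n:ℝ) ^ 5 / Fintype.card V))
    (hbad : (Fintype.card ι : ℝ) ^ 2 / Fintype.card V +
        36 * (Fintype.card ι : ℝ) ^ 9 * (d / Fintype.card V) ^ 2 +
        144 * (Fintype.card ι : ℝ) ^ 14 * (d / Fintype.card V) ^ 3 ≤ 1/2) :
    (Fintype.card ι : ℝ) * Real.exp (-l) ≤ 4 * n := by
  set Q : ℝ := (Fintype.card (ι → V) : ℝ) with hQ
  have hQpos : 0 < Q := by
    have : Nonempty V := Fintype.card_pos_iff.1 hV
    rw [hQ]; exact_mod_cast Fintype.card_pos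
  have hl0 : 0 ≤ l := by rw [hl]; positivity
  have up : ∑ w : ι → V, ∑ i : ι, (((Ind H w).filter (fun I => i ∈ I)).card : ℝ) / (Ind H w).card
      ≤ Q * n := by
    calc _ ≤ ∑ w : ι → V, (n:ℝ) := sum_le_sum (fun w _ =>
            sum_B H w n (fun I hI => Ind_size H h6 n hno w I hI))
      _ = _ := by simp [hQ]
  rw [sum_comm] at up
  have low : ∀ i : ι, Q * (Real.exp (-l) / 4) ≤
      ∑ w : ι → V, (((Ind H w).filter (fun I => i ∈ I)).card : ℝ) / (Ind H w).card := by
    intro i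
    have h1 : ∀ w : ι → V, Real.exp (-l) / 2 * ((1 + l) * (if Nice H w i then 1 else 0) -
        2 * Ybar H i w) ≤ (((Ind H w).filter (fun I => i ∈ I)).card : ℝ) / (Ind H w).card := by
      intro w
      by_cases hw : Nice H w i
      · simpa [hw] using p_lower H w i hw l
      · have := Ybar_nonneg H i w
        have h2 : Real.exp (-l) / 2 * ((1 + l) * (if Nice H w i then 1 else 0) -
          2 * Ybar H i w) ≤ 0 := by
          simp only [hw, if_false, mul_zero, zero_sub]
          have := Real.exp_pos (-l)
          apply mul_nonpos_of_nonneg_of_nonpos (by positivity)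
          linarith
        exact h2.trans (by positivity)
    refine le_trans ?_ (sum_le_sum (fun w _ => h1 w))
    rw [← mul_sum, sum_sub_distrib, ← mul_sum, ← mul_sum]
    have hnice : Q / 2 ≤ ∑ w : ι → V, (if Nice H w i then (1:ℝ) else 0) := by
      rw [← sum_filter]
      simp only [sum_const, nsmul_eq_mul, mul_one]
      have h2 := card_filter_add_card_filter_not (s := (univ : Finset (ι → V)))
        (fun w => Nice H w i)
      have h3 : ((univ.filter (fun w : ι → V => Nice H w i)).card : ℝ) +
        (univ.filter (fun w : ι → V => ¬ Nice H w i)).card = Q := by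
        rw [hQ, ← card_univ]; exact_mod_cast h2
      have h4 := count_not_nice H d h6 hd hV i (ι := ι)
      have h5 := mul_le_mul_of_nonneg_left hbad hQpos.le
      linarith
    have hY := sum_Ybar H d h6 hd hV n hno i (ι := ι)
    have h7 : (1 + l) * (Q / 2) ≤ (1 + l) * ∑ w : ι → V, (if Nice H w i then (1:ℝ) else 0) := by
      gcongr
    have h8 : Q / 2 ≤ (1 + l) * ∑ w : ι → V, (if Nice H w i then (1:ℝ) else 0) -
        2 * ∑ w : ι → V, Ybar H i w := by
      have : d * (n:ℝ) ^ 5 / Fintype.card V = l / 4 := by rw [hl]; ring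
      rw [this] at hY
      nlinarith
    calc Q * (Real.exp (-l) / 4) = Real.exp (-l) / 2 * (Q / 2) := by ring
      _ ≤ _ := by
        apply mul_le_mul_of_nonneg_left h8
        positivity
  have hs := sum_le_sum (fun i (_ : i ∈ (univ : Finset ι)) => low i)
  rw [sum_const, nsmul_eq_mul, card_univ] at hs
  have := hs.trans up
  have h9 : Q * ((Fintype.card ι : ℝ) * Real.exp (-l) / 4) ≤ Q * n := by
    calc _ = (Fintype.card ι : ℝ) * (Q * (Real.exp (-l) / 4)) := by ring
      _ ≤ _ := this
  have := le_of_mul_le_mul_left h9 hQpos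
  linarith

end
end MRproof

namespace MRproof
open Finset
open scoped Classical

theorem asym (d : ℕ) (hd1 : 1 ≤ d) : ∃ N : ℕ, ∀ n : ℕ, N ≤ n →
    ∀ (V : Type) [Fintype V] (H : Finset (Finset V)), (∀ h ∈ H, h.card = 6) →
    (∀ T : Finset V, T.card = 5 → (univ.filter (fun x => x ∉ T ∧ insert x T ∈ H)).card ≤ d) →
    (200 * d : ℝ) * (n:ℝ) ^ 5 / Real.log n < Fintype.card V →
    ∃ S : Finset V, S.card = n ∧ ∀ h ∈ H, ¬ h ⊆ S := by
  have hlog : ∀ᶠ x : ℝ in Filter.atTop, Real.log x ≤ x ^ (1/100 : ℝ) := by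
    have := (isLittleO_log_rpow_atTop (r := 1/100) (by norm_num)).bound (c := 1) (by norm_num)
    filter_upwards [this, Filter.eventually_ge_atTop 1] with x hx h1
    rw [one_mul, Real.norm_of_nonneg (Real.log_nonneg h1), Real.norm_of_nonneg (by positivity)] at hx
    exact hx
  have hlarge : ∀ᶠ x : ℝ in Filter.atTop, (10:ℝ)^8 * (d:ℝ) ≤ x ^ (1/100 : ℝ) :=
    (tendsto_rpow_atTop (by norm_num)).eventually_ge_atTop _
  have hcast := tendsto_natCast_atTop_atTop (R := ℝ)
  obtain ⟨N, hN⟩ := Filter.eventually_atTop.1 (((hcast.eventually hlog).and (hcast.eventually hlarge)).and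
    (Filter.eventually_ge_atTop 2))
  refine ⟨N, fun n hn V _ H h6 hdeg hq => ?_⟩
  obtain ⟨⟨h1, h2⟩, h3⟩ := hN n hn
  by_contra hcon
  push Not at hcon
  set y : ℝ := (n:ℝ) ^ (1/100 : ℝ) with hy
  have hd1' : (1:ℝ) ≤ d := by exact_mod_cast hd1
  have hy8 : (10:ℝ)^8 ≤ y := by nlinarith
  have hy0 : 0 < y := by linarith [hy8]
  have hy1 : 1 ≤ y := by linarith [hy8]
  have hn3 : (2:ℝ) ≤ n := by exact_mod_cast h3
  have hny : (n:ℝ) = y ^ 100 := by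
    rw [hy, ← Real.rpow_natCast, ← Real.rpow_mul (by positivity)]; norm_num
  have hlogpos : 0 < Real.log n := Real.log_pos (by linarith)
  set q : ℝ := (Fintype.card V : ℝ) with hqdef
  rw [div_lt_iff₀ hlogpos] at hq
  have hq0 : 0 < q := by
    by_contra h
    push Not at h
    have : 0 < (200 * d : ℝ) * (n:ℝ)^5 := by positivity
    nlinarith
  -- q ≥ 200 d y^499
  have hq1 : d * y ^ 499 ≤ q := by
    have : (200 * d : ℝ) * (n:ℝ)^5 ≤ q * y := hq.le.trans (by gcongr)
    rw [hny] at this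
    have h' : (200 * d * y ^ 499) * y ≤ q * y := by
      calc _ = (200 * d : ℝ) * (y^100)^5 := by ring
        _ ≤ _ := this
    have := le_of_mul_le_mul_right h' hy0
    have h0 : 0 ≤ d * y ^ 499 := by positivity
    linarith
  have hdq : d / q ≤ 1 / y ^ 499 := by
    rw [div_le_div_iff₀ hq0 (by positivity)]; linarith
  have hq2 : 1 / q ≤ 1 / y ^ 499 := by
    refine le_trans ?_ hdq
    gcongr
  set t : ℕ := ⌈y ^ 5⌉₊ with ht
  have ht1 : y ^ 5 ≤ t := Nat.le_ceil _
  have ht2 : (t:ℝ) ≤ 2 * y ^ 5 := by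
    have := Nat.ceil_lt_add_one (show 0 ≤ y ^ 5 by positivity)
    have h5 : 1 ≤ y ^ 5 := one_le_pow₀ hy1
    linarith
  have hM : ((n * t : ℕ) : ℝ) ≤ 2 * y ^ 105 := by
    push_cast
    rw [hny]
    calc _ ≤ y ^ 100 * (2 * y ^ 5) := by gcongr
      _ = _ := by ring
  have hm := main_ineq (ι := Fin (n * t)) H d h6 (by intro T hT; convert hdeg T hT) (by rw [hqdef] at hq0; exact_mod_cast hq0) n
    (by intro S hS; exact hcon S hS) _ rfl
  rw [Fintype.card_fin, ← hqdef] at hm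
  set M : ℝ := ((n * t : ℕ) : ℝ) with hMdef
  have hM0 : 0 ≤ M := by positivity
  have hyinv : 1 / y ≤ 1 / 10 ^ 8 := by gcongr
  have b1 : M ^ 2 / q ≤ 4 * (1 / y) := by
    calc M ^ 2 / q = M ^ 2 * (1 / q) := by ring
      _ ≤ (2 * y ^ 105) ^ 2 * (1 / y ^ 499) := by gcongr
      _ = 4 * (1 / y ^ 289) := by field_simp <;> norm_num
      _ ≤ 4 * (1 / y) := by
        gcongr
        exact le_self_pow₀ hy1 (by norm_num)
  have b2 : 36 * M ^ 9 * (d / q) ^ 2 ≤ 36 * 512 * (1 / y) := by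
    calc 36 * M ^ 9 * (d / q) ^ 2 ≤ 36 * (2 * y ^ 105) ^ 9 * (1 / y ^ 499) ^ 2 := by gcongr
      _ = 36 * 512 * (1 / y ^ 53) := by field_simp <;> norm_num
      _ ≤ _ := by
        gcongr
        exact le_self_pow₀ hy1 (by norm_num)
  have b3 : 144 * M ^ 14 * (d / q) ^ 3 ≤ 144 * 2 ^ 14 * (1 / y) := by
    calc 144 * M ^ 14 * (d / q) ^ 3 ≤ 144 * (2 * y ^ 105) ^ 14 * (1 / y ^ 499) ^ 3 := by gcongr
      _ = 144 * 2 ^ 14 * (1 / y ^ 27) := by field_simp <;> norm_num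
      _ ≤ _ := by
        gcongr
        exact le_self_pow₀ hy1 (by norm_num)
  have hm2 := hm (by nlinarith)
  have hl : 4 * (d * (n:ℝ) ^ 5 / q) ≤ 2 * Real.log y := by
    have e : Real.log n = 100 * Real.log y := by rw [hny, Real.log_pow]; norm_num
    rw [e] at hq
    have : d * (n:ℝ) ^ 5 / q ≤ Real.log y / 2 := by
      rw [div_le_iff₀ hq0]; nlinarith
    linarith
  have hexp : 1 / y ^ 2 ≤ Real.exp (-(4 * (d * (n:ℝ) ^ 5 / q))) := by
    have : Real.exp (-(2 * Real.log y)) = 1 / y ^ 2 := by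
      rw [Real.exp_neg, two_mul, Real.exp_add, Real.exp_log hy0]; field_simp
    rw [← this]
    exact Real.exp_le_exp.2 (by linarith)
  have : n * y ^ 3 ≤ 4 * (n:ℝ) := by
    refine le_trans ?_ hm2
    calc n * y ^ 3 = (n * y ^ 5) * (1 / y ^ 2) := by field_simp
      _ ≤ M * _ := by
        rw [hMdef]; push_cast; gcongr
  have hy3 : y ≤ y ^ 3 := le_self_pow₀ hy1 (by norm_num)
  nlinarith

end MRproof

namespace MRproof
open Finset
open scoped Classical

/-- The determinant attached to three pairs. -/
def DD {F : Type*} [Field F] (g : Fin 6 → F) : F :=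
  (g 0 - g 3) * (g 2 - g 5) * (g 4 - g 1) + (g 1 - g 2) * (g 3 - g 4) * (g 5 - g 0)

/-- For every slot there is a symmetry of `DD` (up to sign) moving it to slot 5. -/
theorem DD_symm {F : Type*} [Field F] (k : Fin 6) : ∃ σ : Equiv.Perm (Fin 6), σ 5 = k ∧
    ∀ g : Fin 6 → F, DD g = 0 → DD (g ∘ σ) = 0 := by
  have key : ∀ s : Fin 6 → Fin 6, Function.Injective s →
      (∀ g : Fin 6 → F, DD g = 0 → DD (g ∘ s) = 0) →
      ∃ σ : Equiv.Perm (Fin 6), σ 5 = s 5 ∧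
    ∀ g : Fin 6 → F, DD g = 0 → DD (g ∘ σ) = 0 := by
    intro s hs h
    exact ⟨Equiv.ofBijective s (Finite.injective_iff_bijective.1 hs), rfl, h⟩
  fin_cases k
  · refine key ![4,5,2,3,1,0] (by decide) fun g h => ?_
    simp only [DD, Function.comp, Matrix.cons_val] at h ⊢
    first | linear_combination h | linear_combination -h
  · refine key ![4,5,2,3,0,1] (by decide) fun g h => ?_
    simp only [DD, Function.comp, Matrix.cons_val] at h ⊢
    first | linear_combination h | linear_combination -h
  · refine key ![0,1,4,5,3,2] (by decide) fun g h => ?_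
    simp only [DD, Function.comp, Matrix.cons_val] at h ⊢
    first | linear_combination h | linear_combination -h
  · refine key ![0,1,4,5,2,3] (by decide) fun g h => ?_
    simp only [DD, Function.comp, Matrix.cons_val] at h ⊢
    first | linear_combination h | linear_combination -h
  · refine key ![0,1,2,3,5,4] (by decide) fun g h => ?_
    simp only [DD, Function.comp, Matrix.cons_val] at h ⊢
    first | linear_combination h | linear_combination -h
  · refine key ![0,1,2,3,4,5] (by decide) fun g h => ?_
    simp only [DD, Function.comp, Matrix.cons_val] at h ⊢
    first | linear_combination h | linear_combination -h

/-- The hypergraph of bad 6-sets. -/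
noncomputable def HH (F : Type*) [Field F] [Fintype F] : Finset (Finset F) :=
  univ.filter (fun h => ∃ g : Fin 6 → F, Function.Injective g ∧ univ.image g = h ∧ DD g = 0)

theorem HH_card {F : Type*} [Field F] [Fintype F] (h : Finset F) (hh : h ∈ HH F) : h.card = 6 := by
  obtain ⟨g, hg, rfl, -⟩ := (mem_filter.1 hh).2
  rw [card_image_of_injective _ hg]; simp

theorem DD_unique {F : Type*} [Field F] (g g' : Fin 6 → F) (hg : Function.Injective g)
    (heq : ∀ i : Fin 6, i ≠ 5 → g i = g' i) (h : DD g = 0) (h' : DD g' = 0) : g 5 = g' 5 := by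
  have e0 := heq 0 (by decide)
  have e1 := heq 1 (by decide)
  have e2 := heq 2 (by decide)
  have e3 := heq 3 (by decide)
  have e4 := heq 4 (by decide)
  simp only [DD, ← e0, ← e1, ← e2, ← e3, ← e4] at h h'
  by_contra hne
  have hc : (-(g 0 - g 3) * (g 4 - g 1) + (g 1 - g 2) * (g 3 - g 4)) * (g 5 - g' 5) = 0 := by
    linear_combination h - h'
  have hc' := (mul_eq_zero.1 hc).resolve_right (sub_ne_zero.2 hne)
  have : (g 0 - g 3) * (g 4 - g 1) * (g 2 - g 0) = 0 := by
    linear_combination h - (g 5 - g 0) * hc'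
  have n1 : g 0 - g 3 ≠ 0 := sub_ne_zero.2 (hg.ne (by decide))
  have n2 : g 4 - g 1 ≠ 0 := sub_ne_zero.2 (hg.ne (by decide))
  have n3 : g 2 - g 0 ≠ 0 := sub_ne_zero.2 (hg.ne (by decide))
  exact mul_ne_zero (mul_ne_zero n1 n2) n3 this

theorem HH_codeg {F : Type*} [Field F] [Fintype F] (T : Finset F) (hT : T.card = 5) :
    (univ.filter (fun x => x ∉ T ∧ insert x T ∈ HH F)).card ≤ 3125 := by
  have hex : ∀ x : F, x ∉ T ∧ insert x T ∈ HH F → ∃ g : Fin 6 → F, Function.Injective g ∧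
      g 5 = x ∧ DD g = 0 ∧ ∀ i : Fin 6, i ≠ 5 → g i ∈ T := by
    rintro x ⟨hx, hh⟩
    obtain ⟨g, hg, him, hD⟩ := (mem_filter.1 hh).2
    have : x ∈ univ.image g := by rw [him]; simp
    obtain ⟨k, -, hk⟩ := mem_image.1 this
    obtain ⟨σ, hσ, hs⟩ := DD_symm (F := F) k
    refine ⟨g ∘ σ, hg.comp σ.injective, by simp [hσ, hk], hs g hD, fun i hi => ?_⟩
    have h1 : g (σ i) ∈ univ.image g := mem_image_of_mem _ (mem_univ _)
    rw [him, mem_insert] at h1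
    refine h1.resolve_left fun h2 => hi ?_
    rw [← hk, ← hσ] at h2
    exact σ.injective (hg h2)
  choose! G hG1 hG2 hG3 hG4 using hex
  have : (univ.filter (fun x => x ∉ T ∧ insert x T ∈ HH F)).card ≤
      (Fintype.piFinset (fun _ : Fin 5 => T)).card := by
    apply card_le_card_of_injOn (fun x i => G x i.castSucc)
    · intro x hx
      have hx := (mem_filter.1 hx).2
      rw [mem_coe, Fintype.mem_piFinset]
      intro i
      exact hG4 x hx _ (by
        intro h; have := congrArg Fin.val h; simp at this; omega)
    · intro x hx x' hx' he
      have hx := (mem_filter.1 hx).2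
      have hx' := (mem_filter.1 hx').2
      rw [← hG2 x hx, ← hG2 x' hx']
      refine DD_unique _ _ (hG1 x hx) ?_ (hG3 x hx) (hG3 x' hx')
      intro i hi
      have := congrFun he (i.castPred (by simpa using hi))
      simpa using this
  refine this.trans ?_
  rw [Fintype.card_piFinset]
  simp [hT]

end MRproof

namespace MRproof
open Finset
open scoped Classical

theorem corr_i {F : Type} [Field F] {n : ℕ} (Hcol : Matrix (Fin 1) (Fin 3) F)
    (Hrow : Matrix (Fin 3) (Fin n) F) (E : Finset (Fin 3 × Fin n))
    (hE : CorrectsPattern {c : Matrix (Fin 3) (Fin n) F |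
      (∀ j, Hcol.mulVec (fun i => c i j) = 0) ∧ ∀ i, Hrow.mulVec (c i) = 0} E)
    (r r' : Fin 3) (hr : r ≠ r') :
    (univ.filter (fun j : Fin n => (r, j) ∈ E ∧ (r', j) ∈ E)).card ≤ 3 := by
  by_contra hcon
  push Not at hcon
  set T := univ.filter (fun j : Fin n => (r, j) ∈ E ∧ (r', j) ∈ E) with hT
  have hker := LinearMap.ker_ne_bot_of_finrank_lt
    (f := Matrix.mulVecLin (Hrow.submatrix id (Subtype.val : T → Fin n)))
    (by simpa using hcon)
  obtain ⟨z, hz, hz0⟩ := (Submodule.ne_bot_iff _).1 hker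
  set x : Fin n → F := fun j => if h : j ∈ T then z ⟨j, h⟩ else 0 with hx
  have hxker : Hrow.mulVec x = 0 := by
    have h1 : (Hrow.submatrix id (Subtype.val : T → Fin n)).mulVec z = 0 := by simpa using hz
    rw [← h1]
    ext l
    simp only [Matrix.mulVec, dotProduct, Matrix.submatrix_apply, id]
    rw [← Finset.sum_subset (subset_univ T)]
    · rw [← Finset.sum_coe_sort T]
      refine sum_congr rfl fun j _ => ?_
      simp [hx]
    · intro j _ hj; simp [hx, hj]
  obtain ⟨j0, hj0⟩ : ∃ j, z j ≠ 0 := by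
    by_contra h; push Not at h; exact hz0 (funext h)
  obtain ⟨α, β, hαβ, hab⟩ : ∃ α β : F, (α ≠ 0 ∨ β ≠ 0) ∧ Hcol 0 r * α + Hcol 0 r' * β = 0 := by
    by_cases h : Hcol 0 r' = 0
    · exact ⟨0, 1, Or.inr one_ne_zero, by simp [h]⟩
    · exact ⟨Hcol 0 r', -Hcol 0 r, Or.inl h, by ring⟩
  set w : Fin 3 → F := fun i => if i = r then α else if i = r' then β else 0 with hw
  have hwc : ∑ i, Hcol 0 i * w i = 0 := by
    rw [← hab]
    rw [← Finset.sum_subset (subset_univ {r, r'})]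
    · rw [sum_pair hr]; simp [hw, hr.symm]
    · intro i _ hi
      simp only [mem_insert, mem_singleton, not_or] at hi
      simp [hw, hi.1, hi.2]
  have h0 := hE (fun i j => w i * x j) ⟨?_, ?_⟩ 0 ⟨?_, ?_⟩ ?_
  · have e : ∀ i, w i * x j0.1 = 0 := fun i => congrFun (congrFun h0 i) j0.1
    have hxj : x j0.1 ≠ 0 := by simpa [hx] using hj0
    rcases hαβ with h | h
    · have := e r
      simp [hw, h, hxj] at this
    · have := e r'
      simp [hw, h, hxj, hr.symm] at this
  · intro j
    ext k
    rw [Subsingleton.elim k 0]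
    simp only [Matrix.mulVec, dotProduct, Pi.zero_apply]
    simp_rw [← mul_assoc]
    rw [← sum_mul, hwc, zero_mul]
  · intro i
    have : (fun j => w i * x j) = w i • x := by ext; simp
    show Hrow.mulVec (fun j => w i * x j) = 0
    rw [this, Matrix.mulVec_smul, hxker, smul_zero]
  · intro j; exact Matrix.mulVec_zero _
  · intro j; exact Matrix.mulVec_zero _
  · rintro ⟨i, j⟩ hp
    by_cases hj : j ∈ T
    · have h2 := (mem_filter.1 hj).2
      have : w i = 0 := by
        have hi1 : i ≠ r := fun h => hp (h ▸ h2.1)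
        have hi2 : i ≠ r' := fun h => hp (h ▸ h2.2)
        simp [hw, hi1, hi2]
      simp [this]
    · simp [hx, hj]

theorem corr_ii {F : Type} [Field F] {n : ℕ} (Hcol : Matrix (Fin 1) (Fin 3) F)
    (Hrow : Matrix (Fin 3) (Fin n) F) (E : Finset (Fin 3 × Fin n))
    (hE : CorrectsPattern {c : Matrix (Fin 3) (Fin n) F |
      (∀ j, Hcol.mulVec (fun i => c i j) = 0) ∧ ∀ i, Hrow.mulVec (c i) = 0} E) :
    E.card ≤ (univ.filter (fun j : Fin n => ∃ i, (i, j) ∈ E)).card + 6 := by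
  have hE0 : ∀ c : Matrix (Fin 3) (Fin n) F, (∀ j, ∑ i, Hcol 0 i * c i j = 0) →
      (∀ i l, ∑ j, Hrow l j * c i j = 0) → (∀ p : Fin 3 × Fin n, p ∉ E → c p.1 p.2 = 0) → c = 0 := by
    intro c h1 h2 h3
    refine hE c ⟨?_, ?_⟩ 0 ⟨?_, ?_⟩ (by simpa using h3)
    · intro j; ext k; rw [Subsingleton.elim k 0]; exact h1 j
    · intro i; ext l; exact h2 i l
    · intro j; exact Matrix.mulVec_zero _
    · intro j; exact Matrix.mulVec_zero _
  have hcompl : Fintype.card {p : Fin 3 × Fin n // p ∉ E} = 3 * n - E.card := by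
    rw [Fintype.card_subtype_compl]; simp
  have hEle : E.card ≤ 3 * n := by simpa using E.card_le_univ
  by_cases ha : ∃ k, Hcol 0 k ≠ 0
  · obtain ⟨k, hk⟩ := ha
    let φ : Matrix (Fin 3) (Fin n) F →ₗ[F] ({p : Fin 3 × Fin n // p ∉ E} → F) ×
        ({j : Fin n // ∃ i, (i, j) ∈ E} → F) × ({r : Fin 3 // r ≠ k} × Fin 3 → F) :=
      { toFun := fun c => (fun p => c p.1.1 p.1.2, fun j => ∑ i, Hcol 0 i * c i j.1,
          fun rl => ∑ j, Hrow rl.2 j * c rl.1.1 j)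
        map_add' := by
          intro c c'
          ext <;> simp [mul_add, sum_add_distrib]
        map_smul' := by
          intro a c
          ext <;> simp [mul_sum, mul_left_comm] }
    have hinj : Function.Injective φ := by
      rw [injective_iff_map_eq_zero]
      intro c hc
      have c1 : ∀ p : Fin 3 × Fin n, p ∉ E → c p.1 p.2 = 0 := fun p hp =>
        congrFun (congrArg Prod.fst hc) ⟨p, hp⟩
      have c2 : ∀ j, ∑ i, Hcol 0 i * c i j = 0 := by
        intro j
        by_cases hj : ∃ i, (i, j) ∈ E
        · exact congrFun (congrArg (fun t => t.2.1) hc) ⟨j, hj⟩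
        · push Not at hj
          exact sum_eq_zero fun i _ => by rw [c1 (i, j) (hj i), mul_zero]
      have c3 : ∀ r, r ≠ k → ∀ l, ∑ j, Hrow l j * c r j = 0 := fun r hr l =>
        congrFun (congrArg (fun t => t.2.2) hc) (⟨r, hr⟩, l)
      refine hE0 c c2 ?_ c1
      intro i l
      by_cases hi : i = k
      · subst hi
        have : ∑ r, Hcol 0 r * ∑ j, Hrow l j * c r j = 0 := by
          simp_rw [mul_sum]
          rw [sum_comm]
          refine sum_eq_zero fun j _ => ?_
          have := congrArg (fun t => Hrow l j * t) (c2 j)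
          simp only [mul_sum, mul_zero] at this
          rw [← this]
          exact sum_congr rfl fun r _ => by ring
        rw [sum_eq_single i] at this
        · exact (mul_eq_zero.1 this).resolve_left hk
        · intro r _ hr; rw [c3 r hr l, mul_zero]
        · simp
      · exact c3 i hi l
    have hfin := LinearMap.finrank_le_finrank_of_injective hinj
    rw [Module.finrank_prod, Module.finrank_prod, Module.finrank_matrix] at hfin
    simp only [Module.finrank_fintype_fun_eq_card, Fintype.card_prod, hcompl, Fintype.card_fin,
      Module.finrank_self, Fintype.card_subtype_compl, Fintype.card_unique] at hfin
    rw [Fintype.card_subtype] at hfin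
    omega
  · push Not at ha
    let φ : Matrix (Fin 3) (Fin n) F →ₗ[F] ({p : Fin 3 × Fin n // p ∉ E} → F) ×
        (Fin 3 × Fin 3 → F) :=
      { toFun := fun c => (fun p => c p.1.1 p.1.2,
          fun rl => ∑ j, Hrow rl.2 j * c rl.1 j)
        map_add' := by
          intro c c'
          ext <;> simp [mul_add, sum_add_distrib]
        map_smul' := by
          intro a c
          ext <;> simp [mul_sum, mul_left_comm] }
    have hinj : Function.Injective φ := by
      rw [injective_iff_map_eq_zero]
      intro c hc
      have c1 : ∀ p : Fin 3 × Fin n, p ∉ E → c p.1 p.2 = 0 := fun p hp =>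
        congrFun (congrArg Prod.fst hc) ⟨p, hp⟩
      have c3 : ∀ r, ∀ l, ∑ j, Hrow l j * c r j = 0 := fun r l =>
        congrFun (congrArg (fun t => t.2) hc) (r, l)
      exact hE0 c (fun j => by simp [ha]) c3 c1
    have hfin := LinearMap.finrank_le_finrank_of_injective hinj
    rw [Module.finrank_prod, Module.finrank_matrix] at hfin
    simp only [Module.finrank_fintype_fun_eq_card, Fintype.card_prod, hcompl, Fintype.card_fin,
      Module.finrank_self] at hfin
    have h3 : E.card ≤ 3 * (univ.filter (fun j : Fin n => ∃ i, (i, j) ∈ E)).card := by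
      have : E ⊆ (univ : Finset (Fin 3)) ×ˢ (univ.filter (fun j : Fin n => ∃ i, (i, j) ∈ E)) := by
        rintro ⟨i, j⟩ hp
        simp only [mem_product, mem_univ, true_and, mem_filter]
        exact ⟨i, hp⟩
      have := card_le_card this
      rwa [card_product, card_univ, Fintype.card_fin] at this
    omega

/-- Column-wise form of the second condition. -/
theorem col_sum {n : ℕ} (E : Finset (Fin 3 × Fin n))
    (h : E.card ≤ (univ.filter (fun j : Fin n => ∃ i, (i, j) ∈ E)).card + 6) :
    ∑ j : Fin n, ((univ.filter (fun i : Fin 3 => (i, j) ∈ E)).card - 1) ≤ 6 := by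
  have h1 : E.card = ∑ j : Fin n, (univ.filter (fun i : Fin 3 => (i, j) ∈ E)).card := by
    simp_rw [card_filter]
    rw [sum_comm, ← Finset.sum_product', univ_product_univ, ← card_filter]
    congr 1
    ext p; simp
  have h2 : ∑ j : Fin n, ((univ.filter (fun i : Fin 3 => (i, j) ∈ E)).card - 1) +
      (univ.filter (fun j : Fin n => ∃ i, (i, j) ∈ E)).card = E.card := by
    rw [h1, card_filter, ← sum_add_distrib]
    refine sum_congr rfl fun j _ => ?_
    split_ifs with hj
    · have : 0 < (univ.filter (fun i : Fin 3 => (i, j) ∈ E)).card := by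
        obtain ⟨i, hi⟩ := hj
        exact card_pos.2 ⟨i, by simpa using hi⟩
      omega
    · push Not at hj
      simp [hj]
  omega

theorem weight {F : Type} [Field F] {n : ℕ} (t : Fin n → F) (ht : Function.Injective t)
    (x : Fin n → F) (hx : ∀ l : Fin 3, ∑ j, t j ^ (l : ℕ) * x j = 0)
    (hc : (univ.filter (fun j => x j ≠ 0)).card ≤ 3) : (univ.filter (fun j => x j ≠ 0)).card = 0 := by
  rw [card_eq_zero]
  by_contra hne
  obtain ⟨j0, hj0⟩ := nonempty_iff_ne_empty.2 hne
  set S := univ.filter (fun j => x j ≠ 0) with hS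
  let P : Polynomial F := ∏ k ∈ S.erase j0, (Polynomial.X - Polynomial.C (t k))
  have hdeg : P.natDegree < 3 := by
    have : P.natDegree = (S.erase j0).card := Polynomial.natDegree_finsetProd_X_sub_C_eq_card _ _
    rw [this, card_erase_of_mem hj0]; omega
  have hsum : ∑ j, P.eval (t j) * x j = 0 := by
    simp_rw [Polynomial.eval_eq_sum_range' hdeg, sum_mul]
    rw [sum_comm]
    refine sum_eq_zero fun l hl => ?_
    have := hx ⟨l, mem_range.1 hl⟩
    simp only at this
    simp_rw [mul_assoc]
    rw [← mul_sum, this, mul_zero]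
  rw [sum_eq_single j0] at hsum
  · have h1 : P.eval (t j0) ≠ 0 := by
      simp only [P, Polynomial.eval_prod, Polynomial.eval_sub, Polynomial.eval_X, Polynomial.eval_C]
      refine prod_ne_zero_iff.2 fun k hk => sub_ne_zero.2 fun h => ?_
      exact (mem_erase.1 hk).1 (ht h).symm
    exact mul_ne_zero h1 (mem_filter.1 hj0).2 hsum
  · intro j _ hj
    by_cases hjS : j ∈ S
    · have : P.eval (t j) = 0 := by
        simp only [P, Polynomial.eval_prod, Polynomial.eval_sub, Polynomial.eval_X, Polynomial.eval_C]
        exact prod_eq_zero (mem_erase.2 ⟨hj, hjS⟩) (sub_self _)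
      rw [this, zero_mul]
    · have : x j = 0 := by simpa [hS] using hjS
      rw [this, mul_zero]
  · simp

end MRproof

namespace MRproof
open Finset
open scoped Classical

theorem core6 {F : Type} [Field F] (g : Fin 6 → F) (hD : DD g ≠ 0) (hg : g 0 ≠ g 1)
    (xa xb xc xd ye yf : F)
    (h1 : ∀ l : Fin 3, g 0 ^ (l:ℕ) * xa + g 1 ^ (l:ℕ) * xb + (g 2 ^ (l:ℕ) * xc + g 3 ^ (l:ℕ) * xd) = 0)
    (h2 : ∀ l : Fin 3, g 0 ^ (l:ℕ) * (-xa) + g 1 ^ (l:ℕ) * (-xb) + (g 4 ^ (l:ℕ) * ye + g 5 ^ (l:ℕ) * yf) = 0) :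
    xa = 0 := by
  have p0 := h1 0
  have p1 := h1 1
  have p2 := h1 2
  have q0 := h2 0
  have q1 := h2 1
  have q2 := h2 2
  simp only [Fin.val_zero, Fin.val_one, Fin.val_two, pow_zero, pow_one] at p0 p1 p2 q0 q1 q2
  unfold DD at hD
  generalize g 0 = a at *
  generalize g 1 = b at *
  generalize g 2 = c at *
  generalize g 3 = d at *
  generalize g 4 = e at *
  generalize g 5 = f at *
  obtain ⟨u0, hu0⟩ : ∃ u, u = xa + xb := ⟨_, rfl⟩
  obtain ⟨u1, hu1⟩ : ∃ u, u = a * xa + b * xb := ⟨_, rfl⟩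
  obtain ⟨u2, hu2⟩ : ∃ u, u = a ^ 2 * xa + b ^ 2 * xb := ⟨_, rfl⟩
  have r1 : a * b * u0 - (a + b) * u1 + u2 = 0 := by rw [hu0, hu1, hu2]; ring
  have r2 : c * d * u0 - (c + d) * u1 + u2 = 0 := by
    rw [hu0, hu1, hu2]; linear_combination c * d * p0 - (c + d) * p1 + p2
  have r3 : e * f * u0 - (e + f) * u1 + u2 = 0 := by
    rw [hu0, hu1, hu2]; linear_combination -(e * f * q0 - (e + f) * q1 + q2)
  have k0 : ((a - d) * (c - f) * (e - b) + (b - c) * (d - e) * (f - a)) * u0 = 0 := by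
    first
    | linear_combination ((a + b) - (e + f)) * (r1 - r2) - ((a + b) - (c + d)) * (r1 - r3)
    | linear_combination -((a + b) - (e + f)) * (r1 - r2) + ((a + b) - (c + d)) * (r1 - r3)
  have k1 : ((a - d) * (c - f) * (e - b) + (b - c) * (d - e) * (f - a)) * u1 = 0 := by
    first
    | linear_combination (a * b - e * f) * (r1 - r2) - (a * b - c * d) * (r1 - r3)
    | linear_combination -(a * b - e * f) * (r1 - r2) + (a * b - c * d) * (r1 - r3)
  have z0 := (mul_eq_zero.1 k0).resolve_left hD
  have z1 := (mul_eq_zero.1 k1).resolve_left hD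
  have : (a - b) * xa = 0 := by linear_combination z1 - b * z0 - hu1 + b * hu0
  exact (mul_eq_zero.1 this).resolve_left (sub_ne_zero.2 hg)

set_option maxHeartbeats 1000000 in
theorem decode {F : Type} [Field F] {n : ℕ} (t : Fin n → F) (ht : Function.Injective t)
    (hgood : ∀ s : Fin 6 → Fin n, Function.Injective s → DD (t ∘ s) ≠ 0)
    (E : Finset (Fin 3 × Fin n))
    (hi : ∀ r r' : Fin 3, r ≠ r' →
      (univ.filter (fun j : Fin n => (r, j) ∈ E ∧ (r', j) ∈ E)).card ≤ 3)
    (hii : ∑ j : Fin n, ((univ.filter (fun i : Fin 3 => (i, j) ∈ E)).card - 1) ≤ 6)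
    (c : Matrix (Fin 3) (Fin n) F) (hcol : ∀ j, c 0 j + c 1 j + c 2 j = 0)
    (hrow : ∀ i (l : Fin 3), ∑ j, t j ^ (l:ℕ) * c i j = 0)
    (hsupp : ∀ i j, c i j ≠ 0 → (i, j) ∈ E) : c = 0 := by
  obtain ⟨P, hP⟩ : ∃ P, P = univ.filter (fun j => c 0 j ≠ 0 ∧ c 1 j ≠ 0 ∧ c 2 j = 0) := ⟨_, rfl⟩
  obtain ⟨Q, hQ⟩ : ∃ P, P = univ.filter (fun j => c 0 j ≠ 0 ∧ c 1 j = 0 ∧ c 2 j ≠ 0) := ⟨_, rfl⟩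
  obtain ⟨R, hR⟩ : ∃ P, P = univ.filter (fun j => c 0 j = 0 ∧ c 1 j ≠ 0 ∧ c 2 j ≠ 0) := ⟨_, rfl⟩
  obtain ⟨T, hT⟩ : ∃ P, P = univ.filter (fun j => c 0 j ≠ 0 ∧ c 1 j ≠ 0 ∧ c 2 j ≠ 0) := ⟨_, rfl⟩
  have pt : ∀ j, (c 0 j = 0 ∧ c 1 j = 0 ∧ c 2 j = 0) ∨ (c 0 j ≠ 0 ∧ c 1 j ≠ 0 ∧ c 2 j = 0) ∨
      (c 0 j ≠ 0 ∧ c 1 j = 0 ∧ c 2 j ≠ 0) ∨ (c 0 j = 0 ∧ c 1 j ≠ 0 ∧ c 2 j ≠ 0) ∨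
      (c 0 j ≠ 0 ∧ c 1 j ≠ 0 ∧ c 2 j ≠ 0) := by
    intro j
    have := hcol j
    by_cases h0 : c 0 j = 0 <;> by_cases h1 : c 1 j = 0 <;> by_cases h2 : c 2 j = 0 <;> simp_all
  have w0 : (univ.filter (fun j => c 0 j ≠ 0)).card = P.card + Q.card + T.card := by
    rw [hP, hQ, hT]
    simp only [card_filter]
    rw [← sum_add_distrib, ← sum_add_distrib]
    refine sum_congr rfl fun j _ => ?_
    rcases pt j with h | h | h | h | h <;> simp [h]
  have w1 : (univ.filter (fun j => c 1 j ≠ 0)).card = P.card + R.card + T.card := by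
    rw [hP, hR, hT]
    simp only [card_filter]
    rw [← sum_add_distrib, ← sum_add_distrib]
    refine sum_congr rfl fun j _ => ?_
    rcases pt j with h | h | h | h | h <;> simp [h]
  have w2 : (univ.filter (fun j => c 2 j ≠ 0)).card = Q.card + R.card + T.card := by
    rw [hQ, hR, hT]
    simp only [card_filter]
    rw [← sum_add_distrib, ← sum_add_distrib]
    refine sum_congr rfl fun j _ => ?_
    rcases pt j with h | h | h | h | h <;> simp [h]
  have v0 := weight t ht (c 0) (hrow 0)
  have v1 := weight t ht (c 1) (hrow 1)
  have v2 := weight t ht (c 2) (hrow 2)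
  have i01 : P.card + T.card ≤ 3 := by
    refine le_trans ?_ (hi 0 1 (by decide))
    rw [hP, hT]
    simp only [card_filter]
    rw [← sum_add_distrib]
    refine sum_le_sum fun j _ => ?_
    have e0 := hsupp 0 j
    have e1 := hsupp 1 j
    rcases pt j with h | h | h | h | h
    · simp [h]
    · simp [h, e0 h.1, e1 h.2.1]
    · simp [h]
    · simp [h]
    · simp [h, e0 h.1, e1 h.2.1]
  have i02 : Q.card + T.card ≤ 3 := by
    refine le_trans ?_ (hi 0 2 (by decide))
    rw [hQ, hT]
    simp only [card_filter]
    rw [← sum_add_distrib]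
    refine sum_le_sum fun j _ => ?_
    have e0 := hsupp 0 j
    have e1 := hsupp 2 j
    rcases pt j with h | h | h | h | h
    · simp [h]
    · simp [h]
    · simp [h, e0 h.1, e1 h.2.2]
    · simp [h]
    · simp [h, e0 h.1, e1 h.2.2]
  have i12 : R.card + T.card ≤ 3 := by
    refine le_trans ?_ (hi 1 2 (by decide))
    rw [hR, hT]
    simp only [card_filter]
    rw [← sum_add_distrib]
    refine sum_le_sum fun j _ => ?_
    have e0 := hsupp 1 j
    have e1 := hsupp 2 j
    rcases pt j with h | h | h | h | h
    · simp [h]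
    · simp [h]
    · simp [h]
    · simp [h, e0 h.2.1, e1 h.2.2]
    · simp [h, e0 h.2.1, e1 h.2.2]
  have itot : P.card + Q.card + R.card + (T.card + T.card) ≤ 6 := by
    refine le_trans ?_ hii
    rw [hP, hQ, hR, hT]
    simp only [card_filter]
    rw [← sum_add_distrib, ← sum_add_distrib, ← sum_add_distrib, ← sum_add_distrib]
    refine sum_le_sum fun j _ => ?_
    rw [Fin.sum_univ_three]
    have e0 := hsupp 0 j
    have e1 := hsupp 1 j
    have e2 := hsupp 2 j
    rcases pt j with h | h | h | h | h
    · simp [h]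
    · rw [if_pos (e0 h.1), if_pos (e1 h.2.1)]; simp [h]
    · rw [if_pos (e0 h.1), if_pos (e2 h.2.2)]; simp [h]
    · rw [if_pos (e1 h.2.1), if_pos (e2 h.2.2)]; simp [h]
    · rw [if_pos (e0 h.1), if_pos (e1 h.2.1), if_pos (e2 h.2.2)]; simp [h]
  rw [w0] at v0
  rw [w1] at v1
  rw [w2] at v2
  have dich : (P.card + Q.card + T.card = 0 ∧ P.card + R.card + T.card = 0 ∧
      Q.card + R.card + T.card = 0) ∨ (T.card = 0 ∧ P.card = 2 ∧ Q.card = 2 ∧ R.card = 2) := by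
    omega
  rcases dich with ⟨d0, d1, d2⟩ | ⟨hT0, hP2, hQ2, hR2⟩
  · rw [← w0, card_eq_zero, filter_eq_empty_iff] at d0
    rw [← w1, card_eq_zero, filter_eq_empty_iff] at d1
    rw [← w2, card_eq_zero, filter_eq_empty_iff] at d2
    ext i j
    have e0 : c 0 j = 0 := not_not.1 (d0 (mem_univ j))
    have e1 : c 1 j = 0 := not_not.1 (d1 (mem_univ j))
    have e2 : c 2 j = 0 := not_not.1 (d2 (mem_univ j))
    fin_cases i
    · exact e0
    · exact e1
    · exact e2
  · exfalso
    have hTe : ∀ j, ¬ (c 0 j ≠ 0 ∧ c 1 j ≠ 0 ∧ c 2 j ≠ 0) := by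
      rw [card_eq_zero, hT, filter_eq_empty_iff] at hT0
      exact fun j => hT0 (mem_univ j)
    obtain ⟨a, b, hab, hPe⟩ := card_eq_two.1 hP2
    obtain ⟨cc, d, hcd, hQe⟩ := card_eq_two.1 hQ2
    obtain ⟨e, f, hef, hRe⟩ := card_eq_two.1 hR2
    have mP : ∀ j, j = a ∨ j = b ↔ (c 0 j ≠ 0 ∧ c 1 j ≠ 0 ∧ c 2 j = 0) := by
      intro j
      have : j ∈ P ↔ j ∈ ({a, b} : Finset (Fin n)) := by rw [hPe]
      rw [hP] at this; simpa using this.symm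
    have mQ : ∀ j, j = cc ∨ j = d ↔ (c 0 j ≠ 0 ∧ c 1 j = 0 ∧ c 2 j ≠ 0) := by
      intro j
      have : j ∈ Q ↔ j ∈ ({cc, d} : Finset (Fin n)) := by rw [hQe]
      rw [hQ] at this; simpa using this.symm
    have mR : ∀ j, j = e ∨ j = f ↔ (c 0 j = 0 ∧ c 1 j ≠ 0 ∧ c 2 j ≠ 0) := by
      intro j
      have : j ∈ R ↔ j ∈ ({e, f} : Finset (Fin n)) := by rw [hRe]
      rw [hR] at this; simpa using this.symm
    have ma := (mP a).1 (Or.inl rfl)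
    have mb := (mP b).1 (Or.inr rfl)
    have mc := (mQ cc).1 (Or.inl rfl)
    have md := (mQ d).1 (Or.inr rfl)
    have me := (mR e).1 (Or.inl rfl)
    have mf := (mR f).1 (Or.inr rfl)
    have split0 : ∀ φ : Fin n → F, ∑ j, φ j * c 0 j =
        φ a * c 0 a + φ b * c 0 b + (φ cc * c 0 cc + φ d * c 0 d) := by
      intro φ
      have s1 := sum_pair (f := fun j => φ j * c 0 j) hab
      have s2 := sum_pair (f := fun j => φ j * c 0 j) hcd
      rw [← s1, ← s2, ← hPe, ← hQe, hP, hQ, sum_filter, sum_filter, ← sum_add_distrib]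
      refine sum_congr rfl fun j _ => ?_
      have := hTe j
      rcases pt j with h | h | h | h | h
      · simp [h]
      · simp [h]
      · simp [h]
      · simp [h]
      · exact absurd h this
    have split1 : ∀ φ : Fin n → F, ∑ j, φ j * c 1 j =
        φ a * c 1 a + φ b * c 1 b + (φ e * c 1 e + φ f * c 1 f) := by
      intro φ
      have s1 := sum_pair (f := fun j => φ j * c 1 j) hab
      have s2 := sum_pair (f := fun j => φ j * c 1 j) hef
      rw [← s1, ← s2, ← hPe, ← hRe, hP, hR, sum_filter, sum_filter, ← sum_add_distrib]
      refine sum_congr rfl fun j _ => ?_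
      have := hTe j
      rcases pt j with h | h | h | h | h
      · simp [h]
      · simp [h]
      · simp [h]
      · simp [h]
      · exact absurd h this
    have ya : c 1 a = - c 0 a := by
      have := hcol a; rw [ma.2.2] at this; linear_combination this
    have yb : c 1 b = - c 0 b := by
      have := hcol b; rw [mb.2.2] at this; linear_combination this
    have hs : Function.Injective (![a, b, cc, d, e, f] : Fin 6 → Fin n) := by
      have nac : a ≠ cc := fun h => ma.2.1 (h ▸ mc.2.1)
      have nad : a ≠ d := fun h => ma.2.1 (h ▸ md.2.1)
      have nae : a ≠ e := fun h => ma.1 (h ▸ me.1)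
      have naf : a ≠ f := fun h => ma.1 (h ▸ mf.1)
      have nbc : b ≠ cc := fun h => mb.2.1 (h ▸ mc.2.1)
      have nbd : b ≠ d := fun h => mb.2.1 (h ▸ md.2.1)
      have nbe : b ≠ e := fun h => mb.1 (h ▸ me.1)
      have nbf : b ≠ f := fun h => mb.1 (h ▸ mf.1)
      have nce : cc ≠ e := fun h => mc.1 (h ▸ me.1)
      have ncf : cc ≠ f := fun h => mc.1 (h ▸ mf.1)
      have nde : d ≠ e := fun h => md.1 (h ▸ me.1)
      have ndf : d ≠ f := fun h => md.1 (h ▸ mf.1)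
      rw [← List.nodup_ofFn]
      simp [hab, hcd, hef, nac, nad, nae, naf, nbc, nbd, nbe, nbf, nce, ncf, nde, ndf]
    refine ma.1 (core6 (t ∘ ![a, b, cc, d, e, f]) (hgood _ hs) (fun h => hab (ht h))
      (c 0 a) (c 0 b) (c 0 cc) (c 0 d) (c 1 e) (c 1 f) ?_ ?_)
    · intro l
      have := hrow 0 l
      rw [split0 (fun j => t j ^ (l:ℕ))] at this
      exact this
    · intro l
      have := hrow 1 l
      rw [split1 (fun j => t j ^ (l:ℕ)), ya, yb] at this
      exact this

theorem code_MR {F : Type} [Field F] {n : ℕ} (t : Fin n → F) (ht : Function.Injective t)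
    (hgood : ∀ s : Fin 6 → Fin n, Function.Injective s → DD (t ∘ s) ≠ 0) :
    ∃ C : Set (Matrix (Fin 3) (Fin n) F), IsMaximallyRecoverable F 3 n 1 3 C := by
  refine ⟨_, ⟨fun _ _ => 1, fun l j => t j ^ (l:ℕ), rfl⟩, ?_⟩
  rintro E ⟨F', _, _, _, ⟨Hcol, Hrow, rfl⟩, hE⟩
  have hi := corr_i Hcol Hrow E hE
  have hii := col_sum E (corr_ii Hcol Hrow E hE)
  rintro c₁ ⟨h11, h12⟩ c₂ ⟨h21, h22⟩ hag
  rw [← sub_eq_zero]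
  refine decode t ht hgood E hi hii _ ?_ ?_ ?_
  · intro j
    have e1 := congrFun (h11 j) 0
    have e2 := congrFun (h21 j) 0
    simp only [Matrix.mulVec, dotProduct, Fin.sum_univ_three, one_mul, Pi.zero_apply] at e1 e2
    simp only [Matrix.sub_apply]
    linear_combination e1 - e2
  · intro i l
    have e1 := congrFun (h12 i) l
    have e2 := congrFun (h22 i) l
    simp only [Matrix.mulVec, dotProduct, Pi.zero_apply] at e1 e2
    simp only [Matrix.sub_apply, mul_sub, sum_sub_distrib, e1, e2, sub_self]
  · intro i j hne
    by_contra h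
    exact hne (by simpa [sub_eq_zero] using hag (i, j) h)

theorem final : ∃ C₂ : ℝ, 0 < C₂ ∧ ∃ N : ℕ, ∀ n : ℕ, N ≤ n → ∀ q : ℕ, IsPrimePow q →
      C₂ * (n : ℝ) ^ 5 / Real.log n < (q : ℝ) →
      ∀ (F : Type) [Field F] [Fintype F], Fintype.card F = q →
        ∃ C : Set (Matrix (Fin 3) (Fin n) F), IsMaximallyRecoverable F 3 n 1 3 C := by
  obtain ⟨N, hN⟩ := asym 3125 (by norm_num)
  refine ⟨200 * (3125 : ℕ), by norm_num, N, fun n hn q _ hq F _ _ hF => ?_⟩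
  obtain ⟨S, hS, hgood⟩ := hN n hn F (HH F) (fun h hh => HH_card h hh)
    (fun T hT => HH_codeg T hT) (by rw [hF]; exact hq)
  let eqv := (S.equivFinOfCardEq hS).symm
  refine code_MR (fun j => (eqv j : F)) (Subtype.val_injective.comp eqv.injective) ?_
  intro s hs hD
  have hinj : Function.Injective ((fun j => (eqv j : F)) ∘ s) :=
    (Subtype.val_injective.comp eqv.injective).comp hs
  refine hgood (univ.image ((fun j => (eqv j : F)) ∘ s)) (mem_filter.2 ⟨mem_univ _, _, hinj, rfl, hD⟩) ?_
  intro x hx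
  obtain ⟨i, -, rfl⟩ := mem_image.1 hx
  exact (eqv (s i)).2

end MRproof

/-- there is an absolute constant `C₂ > 0` such that for all
sufficiently large `n` and every prime power `q > C₂ · n^5 / log n`, there exists a
maximally recoverable code instantiating `T_{3×n}(1,3,0)` over the field with `q`
elements. -/
theorem exists_MR_code_T_3_n_1_3_0 :
    ∃ C₂ : ℝ, 0 < C₂ ∧ ∃ N : ℕ, ∀ n : ℕ, N ≤ n → ∀ q : ℕ, IsPrimePow q →
      C₂ * (n : ℝ) ^ 5 / Real.log n < (q : ℝ) →
      ∀ (F : Type) [Field F] [Fintype F], Fintype.card F = q →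
        ∃ C : Set (Matrix (Fin 3) (Fin n) F), IsMaximallyRecoverable F 3 n 1 3 C := by
  exact MRproof.final
end

section
/- Let m ≤ n and b ≥ 1, and let E ⊆ [m]×[n] be an erasure pattern for the topology T_{m×n}(1,b,0) that is both regular and irreducible. Let U_E = {i ∈ [m] : (i,j) ∈ E for some j} and V_E = {j ∈ [n] : (i,j) ∈ E for some i}. Then |U_E| + b ≤ |V_E| ≤ b|U_E| - b. -/
/-- An erasure pattern `E ⊆ [m] × [n]` is regular for the topology `T_{m×n}(a,b,0)` if
for all `U ⊆ [m]`, `V ⊆ [n]` we have `|E ∩ (U × V)| ≤ a|V| + b|U| - ab`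
(truncated subtraction on `ℕ`). -/
def RegularPattern (m n a b : ℕ) (E : Finset (Fin m × Fin n)) : Prop :=
  ∀ (U : Finset (Fin m)) (V : Finset (Fin n)),
    (E ∩ U ×ˢ V).card ≤ a * V.card + b * U.card - a * b

/-- An erasure pattern `E ⊆ [m] × [n]` is irreducible for the topology `T_{m×n}(a,b,0)`
if every erased position has at least `a + 1` erasures in its column and at least
`b + 1` erasures in its row. -/
def IrreduciblePattern (m n a b : ℕ) (E : Finset (Fin m × Fin n)) : Prop :=
  ∀ p ∈ E, a + 1 ≤ (E.filter fun p' => p'.2 = p.2).card ∧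
    b + 1 ≤ (E.filter fun p' => p'.1 = p.1).card

/-- a nonempty regular irreducible erasure pattern `E` for
`T_{m×n}(1,b,0)` (with `m ≤ n`, `b ≥ 1`) satisfies `|U_E| + b ≤ |V_E| ≤ b|U_E| - b`,
where `U_E` and `V_E` are the sets of rows and columns meeting `E`. -/
theorem regular_irreducible_row_col_bounds (m n b : ℕ) (hmn : m ≤ n) (hb : 1 ≤ b)
    (E : Finset (Fin m × Fin n)) (hne : E.Nonempty)
    (hreg : RegularPattern m n 1 b E) (hirr : IrreduciblePattern m n 1 b E) :
    (E.image Prod.fst).card + b ≤ (E.image Prod.snd).card ∧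
      (E.image Prod.snd).card ≤ b * (E.image Prod.fst).card - b := by
  have h1 : (b + 1) * (E.image Prod.fst).card ≤ E.card := by
    apply Finset.mul_card_image_le_card
    intro x hx
    obtain ⟨p, hp, rfl⟩ := Finset.mem_image.1 hx
    exact (hirr p hp).2
  have h2 : (1 + 1) * (E.image Prod.snd).card ≤ E.card := by
    apply Finset.mul_card_image_le_card
    intro x hx
    obtain ⟨p, hp, rfl⟩ := Finset.mem_image.1 hx
    exact (hirr p hp).1
  have h3 := hreg (E.image Prod.fst) (E.image Prod.snd)
  have h4 : E ∩ (E.image Prod.fst) ×ˢ (E.image Prod.snd) = E := by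
    apply Finset.inter_eq_left.2
    intro p hp
    exact Finset.mem_product.2
      ⟨Finset.mem_image_of_mem _ hp, Finset.mem_image_of_mem _ hp⟩
  rw [h4] at h3
  have h5 : 1 ≤ (E.image Prod.fst).card := (hne.image _).card_pos
  have h6 : b * 1 ≤ b * (E.image Prod.fst).card := Nat.mul_le_mul_left b h5
  rw [add_mul] at h1
  constructor <;> omega
end

section
/- Let m ≤ n and b ≥ 1, and let E ⊆ [m]×[n] be an erasure pattern for the topology T_{m×n}(1,b,0) that is both regular and irreducible, with U_E = {i ∈ [m] : (i,j) ∈ E for some j}. Then max{2(|U_E| + b), (b+1)|U_E|} ≤ |E| ≤ 2b(|U_E| - 1). -/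
/-- a nonempty regular irreducible erasure pattern `E` for
`T_{m×n}(1,b,0)` (with `m ≤ n`, `b ≥ 1`) satisfies
`max {2(|U_E| + b), (b+1)|U_E|} ≤ |E| ≤ 2b(|U_E| - 1)`, where `U_E` is the set of rows
meeting `E`. -/
theorem regular_irreducible_size_bounds (m n b : ℕ) (hmn : m ≤ n) (hb : 1 ≤ b)
    (E : Finset (Fin m × Fin n)) (hne : E.Nonempty)
    (hreg : RegularPattern m n 1 b E) (hirr : IrreduciblePattern m n 1 b E) :
    max (2 * ((E.image Prod.fst).card + b)) ((b + 1) * (E.image Prod.fst).card) ≤ E.card ∧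
      E.card ≤ 2 * b * ((E.image Prod.fst).card - 1) := by
  have hu : 0 < (E.image Prod.fst).card := (hne.image _).card_pos
  have h1 : (E.image Prod.snd).card * 2 ≤ E.card := by
    rw [Finset.card_eq_sum_card_image Prod.snd E, ← smul_eq_mul]
    refine Finset.card_nsmul_le_sum _ _ _ fun x hx => ?_
    obtain ⟨p, hp, rfl⟩ := Finset.mem_image.1 hx
    exact (hirr p hp).1
  have h2 : (E.image Prod.fst).card * (b + 1) ≤ E.card := by
    rw [Finset.card_eq_sum_card_image Prod.fst E, ← smul_eq_mul]
    refine Finset.card_nsmul_le_sum _ _ _ fun x hx => ?_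
    obtain ⟨p, hp, rfl⟩ := Finset.mem_image.1 hx
    exact (hirr p hp).2
  have h3 := hreg (E.image Prod.fst) (E.image Prod.snd)
  have h4 : E ∩ (E.image Prod.fst) ×ˢ (E.image Prod.snd) = E :=
    Finset.inter_eq_left.2 Finset.subset_product
  rw [h4] at h3
  obtain ⟨k, hk⟩ : ∃ k, (E.image Prod.fst).card = k + 1 := ⟨_, (Nat.succ_pred_eq_of_pos hu).symm⟩
  rw [hk] at h2 h3 ⊢
  have h5 : b * (k + 1) = b * k + b := by ring
  have h6 : (k + 1) * (b + 1) = b * k + b + k + 1 := by ring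
  have h7 : (b + 1) * (k + 1) = b * k + b + k + 1 := by ring
  have h8 : 2 * b * (k + 1 - 1) = 2 * (b * k) := by rw [Nat.add_sub_cancel]; ring
  rw [h5] at h3
  rw [h6] at h2
  rw [h7, h8]
  generalize b * k = t at *
  refine ⟨max_le ?_ ?_, ?_⟩ <;> omega
end

section
/- Let n ≥ 6 and let E ⊆ [4]×[n] be an erasure pattern for the topology T_{4×n}(1,2,0) that is both regular and irreducible. Then |U_E| = 4, |V_E| = 6 and |E| = 12, every column of V_E contains exactly 2 erasures and every row contains exactly 3 erasures, and after applying some permutation of the 4 rows and some permutation of the n columns, E equals one of the two patterns E_1 = {(1,1),(1,2),(1,3),(2,1),(2,2),(2,4),(3,3),(3,5),(3,6),(4,4),(4,5),(4,6)} and E_2 = {(1,1),(1,2),(1,3),(2,1),(2,4),(2,5),(3,2),(3,4),(3,6),(4,3),(4,5),(4,6)}. -/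
namespace Aux412

/-- The set of erased rows in column `j`. -/
def col {n : ℕ} (E : Finset (Fin 4 × Fin n)) (j : Fin n) : Finset (Fin 4) :=
  Finset.univ.filter fun i => (i, j) ∈ E

/-- Number of columns whose erased rows are exactly `A`. -/
def cnt {n : ℕ} (E : Finset (Fin 4 × Fin n)) (A : Finset (Fin 4)) : ℕ :=
  (Finset.univ.filter fun j => col E j = A).card

/-- Column sets of the first pattern. -/
def P1 : Fin 6 → Finset (Fin 4) := ![{0, 1}, {0, 1}, {0, 2}, {1, 3}, {2, 3}, {2, 3}]

/-- Column sets of the second pattern. -/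
def P2 : Fin 6 → Finset (Fin 4) := ![{0, 1}, {0, 2}, {0, 3}, {1, 2}, {1, 3}, {2, 3}]

/-- Extension by empty columns. -/
def ext6 (n : ℕ) (P : Fin 6 → Finset (Fin 4)) (j : Fin n) : Finset (Fin 4) :=
  if h : j.val < 6 then P ⟨j.val, h⟩ else ∅

lemma mem_col {n : ℕ} (E : Finset (Fin 4 × Fin n)) (i : Fin 4) (j : Fin n) :
    i ∈ col E j ↔ (i, j) ∈ E := by simp [col]

lemma sum_col {n : ℕ} (E : Finset (Fin 4 × Fin n)) (f : Finset (Fin 4) → ℕ) :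
    ∑ j, f (col E j) = ∑ A, cnt E A * f A := by
  rw [← Finset.sum_fiberwise (s := Finset.univ) (g := col E)]
  refine Finset.sum_congr rfl fun A _ => ?_
  rw [Finset.sum_congr rfl (g := fun _ => f A)]
  · simp [cnt]
  · intro j hj
    simp at hj
    rw [hj]

lemma sum16 (g : Finset (Fin 4) → ℕ) :
    ∑ A, g A = g ∅ + g {0} + g {1} + g {2} + g {3} + g {0, 1} + g {0, 2} + g {0, 3}
      + g {1, 2} + g {1, 3} + g {2, 3} + g {0, 1, 2} + g {0, 1, 3} + g {0, 2, 3}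
      + g {1, 2, 3} + g {0, 1, 2, 3} := by
  have h : (Finset.univ : Finset (Finset (Fin 4))).val =
      ([∅, {0}, {1}, {2}, {3}, {0, 1}, {0, 2}, {0, 3}, {1, 2}, {1, 3}, {2, 3}, {0, 1, 2},
        {0, 1, 3}, {0, 2, 3}, {1, 2, 3}, {0, 1, 2, 3}] : List (Finset (Fin 4))) := by
    decide
  rw [Finset.sum, h]
  simp only [Multiset.map_coe, Multiset.sum_coe, List.map, List.sum_cons, List.sum_nil]
  ring

lemma forall16 (p : Finset (Fin 4) → Prop)
    (h0 : p ∅) (h1 : p {0}) (h2 : p {1}) (h3 : p {2}) (h4 : p {3}) (h5 : p {0, 1})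
    (h6 : p {0, 2}) (h7 : p {0, 3}) (h8 : p {1, 2}) (h9 : p {1, 3}) (h10 : p {2, 3})
    (h11 : p {0, 1, 2}) (h12 : p {0, 1, 3}) (h13 : p {0, 2, 3}) (h14 : p {1, 2, 3})
    (h15 : p {0, 1, 2, 3}) (A : Finset (Fin 4)) : p A := by
  have h : ∀ A : Finset (Fin 4), A = ∅ ∨ A = {0} ∨ A = {1} ∨ A = {2} ∨ A = {3} ∨
      A = {0, 1} ∨ A = {0, 2} ∨ A = {0, 3} ∨ A = {1, 2} ∨ A = {1, 3} ∨ A = {2, 3} ∨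
      A = {0, 1, 2} ∨ A = {0, 1, 3} ∨ A = {0, 2, 3} ∨ A = {1, 2, 3} ∨
      A = {0, 1, 2, 3} := by decide
  rcases h A with h | h | h | h | h | h | h | h | h | h | h | h | h | h | h | h <;>
    (subst h; assumption)

lemma card_inter {n : ℕ} (E : Finset (Fin 4 × Fin n)) (U : Finset (Fin 4))
    (V : Finset (Fin n)) : (E ∩ U ×ˢ V).card = ∑ j ∈ V, (col E j ∩ U).card := by
  rw [Finset.card_eq_sum_card_fiberwise (f := Prod.snd) (t := V)]
  · refine Finset.sum_congr rfl fun j hj => ?_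
    refine Finset.card_bij' (fun p _ => p.1) (fun i _ => (i, j)) ?_ ?_ ?_ ?_
    · rintro ⟨i, k⟩ h
      simp only [Finset.mem_filter, Finset.mem_inter, Finset.mem_product] at h
      obtain ⟨⟨h1, h2, h3⟩, rfl⟩ := h
      simp [mem_col, h1, h2]
    · intro i h
      simp only [Finset.mem_inter, mem_col] at h
      simp [h, hj]
    · rintro ⟨i, k⟩ h
      simp only [Finset.mem_filter] at h
      simp [h.2]
    · intro i h
      rfl
  · intro p hp
    simp at hp
    simp [hp]

lemma card_row {n : ℕ} (E : Finset (Fin 4 × Fin n)) (i : Fin 4) :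
    (E.filter fun p => p.1 = i).card = ∑ A, cnt E A * (A ∩ {i}).card := by
  rw [← sum_col E (fun A => (A ∩ {i}).card), ← card_inter]
  congr 1
  ext ⟨a, b⟩
  simp [eq_comm]

lemma card_colf {n : ℕ} (E : Finset (Fin 4 × Fin n)) (j : Fin n) :
    (E.filter fun p => p.2 = j).card = (col E j).card := by
  have h := card_inter E Finset.univ {j}
  simp only [Finset.sum_singleton, Finset.inter_univ] at h
  rw [← h]
  congr 1
  ext ⟨a, b⟩
  simp [eq_comm]

lemma card_all {n : ℕ} (E : Finset (Fin 4 × Fin n)) :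
    E.card = ∑ A, cnt E A * A.card := by
  rw [← sum_col E (fun A => A.card)]
  have h := card_inter E Finset.univ Finset.univ
  simpa using h

lemma card_snd {n : ℕ} (E : Finset (Fin 4 × Fin n)) :
    (E.image Prod.snd).card = ∑ A, cnt E A * (if A = ∅ then 0 else 1) := by
  rw [← sum_col E (fun A => if A = ∅ then 0 else 1)]
  have : E.image Prod.snd = Finset.univ.filter fun j => ¬ col E j = ∅ := by
    ext j
    simp only [Finset.mem_image, Prod.exists, exists_eq_right, Finset.mem_filter,
      Finset.mem_univ, true_and, ← Finset.nonempty_iff_ne_empty, Finset.Nonempty, mem_col,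
      ← ne_eq]
  rw [this, Finset.card_filter]
  refine Finset.sum_congr rfl fun j _ => ?_
  by_cases h : col E j = ∅ <;> simp [h]

lemma reg {n : ℕ} (E : Finset (Fin 4 × Fin n)) (hreg : RegularPattern 4 n 1 2 E)
    (U : Finset (Fin 4)) (hU : 1 ≤ U.card) :
    ∑ A, cnt E A * ((A ∩ U).card - 1) ≤ 2 * U.card - 2 := by
  rw [← sum_col E (fun A => (A ∩ U).card - 1)]
  have h := hreg U (Finset.univ.filter fun j => 1 ≤ (col E j ∩ U).card)
  rw [card_inter] at h
  have h2 : ∑ j, ((col E j ∩ U).card - 1) =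
      ∑ j ∈ Finset.univ.filter (fun j => 1 ≤ (col E j ∩ U).card),
        ((col E j ∩ U).card - 1) := by
    rw [Finset.sum_filter]
    refine Finset.sum_congr rfl fun j _ => ?_
    split_ifs <;> omega
  have h3 : ∑ j ∈ Finset.univ.filter (fun j => 1 ≤ (col E j ∩ U).card),
      (col E j ∩ U).card = ∑ j ∈ Finset.univ.filter (fun j => 1 ≤ (col E j ∩ U).card),
        (((col E j ∩ U).card - 1) + 1) := by
    refine Finset.sum_congr rfl fun j hj => ?_
    simp only [Finset.mem_filter] at hj
    omega
  rw [Finset.sum_add_distrib, ← h2] at h3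
  simp only [Finset.sum_const, smul_eq_mul, mul_one] at h3
  omega

lemma cnt_ext6 (n : ℕ) (hn : 6 ≤ n) (P : Fin 6 → Finset (Fin 4)) (A : Finset (Fin 4))
    (hA : A ≠ ∅) : (Finset.univ.filter fun j => ext6 n P j = A).card =
      (Finset.univ.filter fun k => P k = A).card := by
  symm
  refine Finset.card_bij (fun k _ => Fin.castLE hn k) ?_ ?_ ?_
  · intro k hk
    rw [Finset.mem_filter] at hk ⊢
    simpa [ext6] using hk
  · intro a _ b _ h
    simpa using h
  · intro j hj
    have hj := (Finset.mem_filter.1 hj).2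
    unfold ext6 at hj
    split_ifs at hj with h
    · exact ⟨⟨j, h⟩, by simpa using hj, rfl⟩
    · exact absurd hj.symm hA

lemma exists_perm {n : ℕ} (hn : 6 ≤ n) (E : Finset (Fin 4 × Fin n))
    (P : Fin 6 → Finset (Fin 4)) (σ : Equiv.Perm (Fin 4))
    (h : ∀ A : Finset (Fin 4), A ≠ ∅ →
      cnt E (A.image σ.symm) = (Finset.univ.filter fun k => P k = A).card) :
    ∃ τ : Equiv.Perm (Fin n), ∀ i j, σ i ∈ ext6 n P (τ j) ↔ (i, j) ∈ E := by
  have hc : ∀ A : Finset (Fin 4), A ≠ ∅ →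
      (Finset.univ.filter fun j => (col E j).image σ = A).card =
        (Finset.univ.filter fun j => ext6 n P j = A).card := by
    intro A hA
    rw [cnt_ext6 n hn P A hA, ← h A hA, cnt]
    congr 1
    ext j
    simp only [Finset.mem_filter, Finset.mem_univ, true_and]
    constructor
    · rintro rfl
      ext; simp
    · intro h
      rw [h]; ext; simp
  have hc' : ∀ A : Finset (Fin 4),
      (Finset.univ.filter fun j => (col E j).image σ = A).card =
        (Finset.univ.filter fun j => ext6 n P j = A).card := by
    intro A
    by_cases hA : A = ∅
    · subst hA
      have e1 := Finset.card_eq_sum_card_fiberwise (s := (Finset.univ : Finset (Fin n)))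
        (t := Finset.univ) (f := fun j => (col E j).image σ) (by simp)
      have e2 := Finset.card_eq_sum_card_fiberwise (s := (Finset.univ : Finset (Fin n)))
        (t := Finset.univ) (f := ext6 n P) (by simp)
      rw [← Finset.add_sum_erase _ _ (Finset.mem_univ ∅)] at e1 e2
      have e3 : ∑ A ∈ Finset.univ.erase (∅ : Finset (Fin 4)),
          (Finset.univ.filter fun j => (col E j).image σ = A).card =
          ∑ A ∈ Finset.univ.erase (∅ : Finset (Fin 4)),
          (Finset.univ.filter fun j => ext6 n P j = A).card :=
        Finset.sum_congr rfl fun A hA => hc A (Finset.ne_of_mem_erase hA)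
      omega
    · exact hc A hA
  have hf : ∀ A : Finset (Fin 4),
      Nonempty ({j // (col E j).image σ = A} ≃ {j // ext6 n P j = A}) := by
    intro A
    rw [← Fintype.card_eq, Fintype.card_subtype, Fintype.card_subtype]
    exact hc' A
  refine ⟨Equiv.ofFiberEquiv (f := fun j => (col E j).image σ) (g := ext6 n P)
    fun A => (hf A).some, fun i j => ?_⟩
  have := Equiv.ofFiberEquiv_map (f := fun j => (col E j).image σ) (g := ext6 n P)
    (fun A => (hf A).some) j
  rw [this, ← mem_col]
  simp

lemma image_eq {n : ℕ} (E F : Finset (Fin 4 × Fin n)) (P : Fin 6 → Finset (Fin 4))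
    (σ : Equiv.Perm (Fin 4)) (τ : Equiv.Perm (Fin n))
    (h : ∀ i j, σ i ∈ ext6 n P (τ j) ↔ (i, j) ∈ E)
    (hF : ∀ i j, (i, j) ∈ F ↔ i ∈ ext6 n P j) :
    E.image (fun p => (σ p.1, τ p.2)) = F := by
  ext ⟨i, k⟩
  rw [hF]
  simp only [Finset.mem_image, Prod.exists, Prod.mk.injEq]
  constructor
  · rintro ⟨a, b, hab, rfl, rfl⟩
    exact (h a b).2 hab
  · intro hi
    refine ⟨σ.symm i, τ.symm k, ?_, by simp, by simp⟩
    rw [← h]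
    simpa using hi

lemma main_counts {n : ℕ} (E : Finset (Fin 4 × Fin n)) (hne : E.Nonempty)
    (hreg : RegularPattern 4 n 1 2 E) (hirr : IrreduciblePattern 4 n 1 2 E) :
    (∀ A : Finset (Fin 4), A ≠ ∅ → A.card ≠ 2 → cnt E A = 0) ∧
    cnt E {2, 3} = cnt E {0, 1} ∧ cnt E {1, 3} = cnt E {0, 2} ∧
    cnt E {1, 2} = cnt E {0, 3} ∧ cnt E {0, 1} + cnt E {0, 2} + cnt E {0, 3} = 3 ∧
    cnt E {0, 1} ≤ 2 ∧ cnt E {0, 2} ≤ 2 ∧ cnt E {0, 3} ≤ 2 := by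
  have hs : ∀ i : Fin 4, cnt E {i} = 0 := by
    intro i
    rw [cnt, Finset.card_eq_zero, Finset.filter_eq_empty_iff]
    intro j _ hj
    have hm : (i, j) ∈ E := by rw [← mem_col, hj]; simp
    have := (hirr _ hm).1
    rw [card_colf] at this
    simp [hj] at this
  have hr : ∀ i : Fin 4, (∑ A, cnt E A * (A ∩ {i}).card) = 0 ∨
      3 ≤ ∑ A, cnt E A * (A ∩ {i}).card := by
    intro i
    rw [← card_row]
    by_cases h : (E.filter fun p => p.1 = i).card = 0
    · exact Or.inl h
    · right
      obtain ⟨p, hp⟩ := Finset.card_pos.1 (Nat.pos_of_ne_zero h)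
      rw [Finset.mem_filter] at hp
      have := (hirr p hp.1).2
      rw [hp.2] at this
      exact this
  have hE := Finset.card_pos.2 hne
  rw [card_all] at hE
  have s0 := hs 0
  have s1 := hs 1
  have s2 := hs 2
  have s3 := hs 3
  have r0 := hr 0
  have r1 := hr 1
  have r2 := hr 2
  have r3 := hr 3
  have p01 := reg E hreg {0, 1} (by decide)
  have p02 := reg E hreg {0, 2} (by decide)
  have p03 := reg E hreg {0, 3} (by decide)
  have p12 := reg E hreg {1, 2} (by decide)
  have p13 := reg E hreg {1, 3} (by decide)
  have p23 := reg E hreg {2, 3} (by decide)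
  have q0 := reg E hreg {1, 2, 3} (by decide)
  have q1 := reg E hreg {0, 2, 3} (by decide)
  have q2 := reg E hreg {0, 1, 3} (by decide)
  have q3 := reg E hreg {0, 1, 2} (by decide)
  have q := reg E hreg {0, 1, 2, 3} (by decide)
  clear hs hr
  simp only [sum16, s0, s1, s2, s3] at hE r0 r1 r2 r3 p01 p02 p03 p12 p13 p23 q0 q1 q2 q3 q
  simp at hE r0 r1 r2 r3 p01 p02 p03 p12 p13 p23 q0 q1 q2 q3 q
  refine ⟨?_, ?_⟩
  · apply forall16 <;> simp [s0, s1, s2, s3] <;> omega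
  · omega

/-- The possible column count functions. -/
def gfun (a b c : ℕ) (A : Finset (Fin 4)) : ℕ :=
  if A = {0, 1} ∨ A = {2, 3} then a else if A = {0, 2} ∨ A = {1, 3} then b else
    if A = {0, 3} ∨ A = {1, 2} then c else 0

lemma exists_rows (a b c : ℕ) (h : a + b + c = 3) (ha : a ≤ 2) (hb : b ≤ 2) (hc : c ≤ 2) :
    ∃ σ : Equiv.Perm (Fin 4),
      (∀ A : Finset (Fin 4), A ≠ ∅ → gfun a b c (A.image σ.symm) =
        (Finset.univ.filter fun k => P1 k = A).card) ∨
      (∀ A : Finset (Fin 4), A ≠ ∅ → gfun a b c (A.image σ.symm) =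
        (Finset.univ.filter fun k => P2 k = A).card) := by
  have : (a = 1 ∧ b = 1 ∧ c = 1) ∨ (a = 2 ∧ b = 1 ∧ c = 0) ∨ (a = 2 ∧ b = 0 ∧ c = 1) ∨
      (a = 1 ∧ b = 2 ∧ c = 0) ∨ (a = 0 ∧ b = 1 ∧ c = 2) ∨ (a = 1 ∧ b = 0 ∧ c = 2) ∨
      (a = 0 ∧ b = 2 ∧ c = 1) := by omega
  rcases this with h | h | h | h | h | h | h <;> obtain ⟨rfl, rfl, rfl⟩ := h
  · exact ⟨1, Or.inr (by decide)⟩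
  · exact ⟨1, Or.inl (by decide)⟩
  · exact ⟨Equiv.swap 2 3, Or.inl (by decide)⟩
  · exact ⟨Equiv.swap 1 2, Or.inl (by decide)⟩
  · exact ⟨Equiv.swap 1 3, Or.inl (by decide)⟩
  · exact ⟨Equiv.swap 1 2 * Equiv.swap 2 3, Or.inl (by decide)⟩
  · exact ⟨Equiv.swap 2 3 * Equiv.swap 1 2, Or.inl (by decide)⟩

end Aux412

/-- a nonempty regular irreducible erasure pattern `E` for
`T_{4×n}(1,2,0)` (`n ≥ 6`) has `|U_E| = 4`, `|V_E| = 6`, `|E| = 12`, exactly `2`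
erasures in each column of `V_E` and exactly `3` erasures in each row, and up to row
and column permutations `E` is one of the two explicit patterns `E₁`, `E₂`. -/
theorem regular_irreducible_classification_T_4_n_1_2_0 (n : ℕ) (hn : 6 ≤ n)
    (E : Finset (Fin 4 × Fin n)) (hne : E.Nonempty)
    (hreg : RegularPattern 4 n 1 2 E) (hirr : IrreduciblePattern 4 n 1 2 E) :
    (E.image Prod.fst).card = 4 ∧ (E.image Prod.snd).card = 6 ∧ E.card = 12 ∧
    (∀ j ∈ E.image Prod.snd, (E.filter fun p => p.2 = j).card = 2) ∧
    (∀ i : Fin 4, (E.filter fun p => p.1 = i).card = 3) ∧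
    ∃ (σ : Equiv.Perm (Fin 4)) (τ : Equiv.Perm (Fin n)),
      E.image (fun p => (σ p.1, τ p.2)) =
        ({((0 : Fin 4), (⟨0, by omega⟩ : Fin n)), ((0 : Fin 4), (⟨1, by omega⟩ : Fin n)),
          ((0 : Fin 4), (⟨2, by omega⟩ : Fin n)), ((1 : Fin 4), (⟨0, by omega⟩ : Fin n)),
          ((1 : Fin 4), (⟨1, by omega⟩ : Fin n)), ((1 : Fin 4), (⟨3, by omega⟩ : Fin n)),
          ((2 : Fin 4), (⟨2, by omega⟩ : Fin n)), ((2 : Fin 4), (⟨4, by omega⟩ : Fin n)),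
          ((2 : Fin 4), (⟨5, by omega⟩ : Fin n)), ((3 : Fin 4), (⟨3, by omega⟩ : Fin n)),
          ((3 : Fin 4), (⟨4, by omega⟩ : Fin n)), ((3 : Fin 4), (⟨5, by omega⟩ : Fin n))} :
          Finset (Fin 4 × Fin n)) ∨
      E.image (fun p => (σ p.1, τ p.2)) =
        ({((0 : Fin 4), (⟨0, by omega⟩ : Fin n)), ((0 : Fin 4), (⟨1, by omega⟩ : Fin n)),
          ((0 : Fin 4), (⟨2, by omega⟩ : Fin n)), ((1 : Fin 4), (⟨0, by omega⟩ : Fin n)),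
          ((1 : Fin 4), (⟨3, by omega⟩ : Fin n)), ((1 : Fin 4), (⟨4, by omega⟩ : Fin n)),
          ((2 : Fin 4), (⟨1, by omega⟩ : Fin n)), ((2 : Fin 4), (⟨3, by omega⟩ : Fin n)),
          ((2 : Fin 4), (⟨5, by omega⟩ : Fin n)), ((3 : Fin 4), (⟨2, by omega⟩ : Fin n)),
          ((3 : Fin 4), (⟨4, by omega⟩ : Fin n)), ((3 : Fin 4), (⟨5, by omega⟩ : Fin n))} :
          Finset (Fin 4 × Fin n)) := by
  obtain ⟨hz, h23, h13, h12, h3, ha, hb, hc⟩ := Aux412.main_counts E hne hreg hirr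
  have hg : ∀ A : Finset (Fin 4), A ≠ ∅ → Aux412.cnt E A =
      Aux412.gfun (Aux412.cnt E {0, 1}) (Aux412.cnt E {0, 2}) (Aux412.cnt E {0, 3}) A := by
    intro A hA
    by_cases h2 : A.card = 2
    · have : ∀ A : Finset (Fin 4), A.card = 2 → A = {0, 1} ∨ A = {0, 2} ∨ A = {0, 3} ∨
        A = {1, 2} ∨ A = {1, 3} ∨ A = {2, 3} := by decide
      rcases this A h2 with rfl | rfl | rfl | rfl | rfl | rfl
      · exact (if_pos (by decide)).symm
      · rw [Aux412.gfun, if_neg (by decide), if_pos (by decide)]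
      · rw [Aux412.gfun, if_neg (by decide), if_neg (by decide), if_pos (by decide)]
      · rw [Aux412.gfun, if_neg (by decide), if_neg (by decide), if_pos (by decide), h12]
      · rw [Aux412.gfun, if_neg (by decide), if_pos (by decide), h13]
      · rw [Aux412.gfun, if_pos (by decide), h23]
    · rw [hz A hA h2, Aux412.gfun, if_neg, if_neg, if_neg]
      all_goals rintro (rfl | rfl) <;> exact h2 (by decide)
  have hrow : ∀ i : Fin 4, (E.filter fun p => p.1 = i).card = 3 := by
    intro i
    rw [Aux412.card_row, Aux412.sum16, hz {0} (by decide) (by decide),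
      hz {1} (by decide) (by decide), hz {2} (by decide) (by decide),
      hz {3} (by decide) (by decide), hz {0, 1, 2} (by decide) (by decide),
      hz {0, 1, 3} (by decide) (by decide), hz {0, 2, 3} (by decide) (by decide),
      hz {1, 2, 3} (by decide) (by decide), hz {0, 1, 2, 3} (by decide) (by decide),
      h23, h13, h12]
    fin_cases i <;> simp <;> omega
  refine ⟨?_, ?_, ?_, ?_, hrow, ?_⟩
  · have : E.image Prod.fst = Finset.univ := by
      rw [Finset.eq_univ_iff_forall]
      intro i
      have hp : 0 < (E.filter fun p => p.1 = i).card := by rw [hrow i]; decide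
      obtain ⟨p, hp⟩ := Finset.card_pos.1 hp
      rw [Finset.mem_filter] at hp
      exact Finset.mem_image.2 ⟨p, hp⟩
    rw [this]
    rfl
  · rw [Aux412.card_snd, Aux412.sum16, hz {0} (by decide) (by decide),
      hz {1} (by decide) (by decide), hz {2} (by decide) (by decide),
      hz {3} (by decide) (by decide), hz {0, 1, 2} (by decide) (by decide),
      hz {0, 1, 3} (by decide) (by decide), hz {0, 2, 3} (by decide) (by decide),
      hz {1, 2, 3} (by decide) (by decide), hz {0, 1, 2, 3} (by decide) (by decide),
      h23, h13, h12]
    simp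
    omega
  · rw [Finset.card_eq_sum_card_fiberwise (f := Prod.fst) (t := Finset.univ) (by simp)]
    simp [hrow]
  · intro j hj
    rw [Finset.mem_image] at hj
    obtain ⟨⟨i, j'⟩, hij, rfl⟩ := hj
    rw [Aux412.card_colf]
    by_contra h2
    have hi := (Aux412.mem_col E i j').2 hij
    have h0 := hz _ (Finset.ne_empty_of_mem hi) h2
    rw [Aux412.cnt, Finset.card_eq_zero, Finset.filter_eq_empty_iff] at h0
    exact h0 (Finset.mem_univ j') rfl
  · obtain ⟨σ, h | h⟩ := Aux412.exists_rows _ _ _ h3 ha hb hc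
    · obtain ⟨τ, hτ⟩ := Aux412.exists_perm hn E Aux412.P1 σ fun A hA => by
        rw [hg _ (by simpa using hA), h A hA]
      refine ⟨σ, τ, Or.inl (Aux412.image_eq E _ Aux412.P1 σ τ hτ ?_)⟩
      rintro i ⟨j, hj⟩
      by_cases h6 : j < 6
      · simp only [Aux412.ext6, h6, dif_pos]
        interval_cases j <;> fin_cases i <;> simp [Aux412.P1]
      · simp only [Aux412.ext6, h6, Finset.mem_insert, Finset.mem_singleton, Prod.mk.injEq,
          Fin.mk.injEq, dif_neg, not_false_eq_true, Finset.notMem_empty, iff_false]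
        omega
    · obtain ⟨τ, hτ⟩ := Aux412.exists_perm hn E Aux412.P2 σ fun A hA => by
        rw [hg _ (by simpa using hA), h A hA]
      refine ⟨σ, τ, Or.inr (Aux412.image_eq E _ Aux412.P2 σ τ hτ ?_)⟩
      rintro i ⟨j, hj⟩
      by_cases h6 : j < 6
      · simp only [Aux412.ext6, h6, dif_pos]
        interval_cases j <;> fin_cases i <;> simp [Aux412.P2]
      · simp only [Aux412.ext6, h6, Finset.mem_insert, Finset.mem_singleton, Prod.mk.injEq,
          Fin.mk.injEq, dif_neg, not_false_eq_true, Finset.notMem_empty, iff_false]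
        omega
end

section
/- Let n ≥ 6 and let E ⊆ [3]×[n] be an erasure pattern for the topology T_{3×n}(1,3,0) that is both regular and irreducible. Then |U_E| = 3, |V_E| = 6 and |E| = 12, every column of V_E contains exactly 2 erasures and every row contains exactly 4 erasures, and after applying some permutation of the 3 rows and some permutation of the n columns, E equals the pattern E_0 = {(1,1),(1,2),(1,3),(1,4),(2,1),(2,2),(2,5),(2,6),(3,3),(3,4),(3,5),(3,6)}. -/
/-- Two injective families in a finite type are related by a permutation. -/
lemma exists_perm_of_families {n : ℕ} (f g : Fin 6 → Fin n)
    (hf : Function.Injective f) (hg : Function.Injective g) :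
    ∃ τ : Equiv.Perm (Fin n), ∀ k, τ (f k) = g k := by
  classical
  let e : {x // x ∈ Set.range f} ≃ {x // x ∈ Set.range g} :=
    (Equiv.ofInjective f hf).symm.trans (Equiv.ofInjective g hg)
  refine ⟨e.extendSubtype, fun k => ?_⟩
  rw [Equiv.extendSubtype_apply_of_mem e (f k) ⟨k, rfl⟩]
  have h : (Equiv.ofInjective f hf).symm ⟨f k, ⟨k, rfl⟩⟩ = k := by
    rw [Equiv.symm_apply_eq]; rfl
  simp only [e, Equiv.trans_apply]
  rw [h]; rfl

lemma or_rot (a b c d : Prop) : (c ∨ a ∨ b ∨ d) ↔ (a ∨ b ∨ c ∨ d) := by tauto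

/-- The erased columns of row `i`. -/
def rowSet {n : ℕ} (E : Finset (Fin 3 × Fin n)) (i : Fin 3) : Finset (Fin n) :=
  Finset.univ.filter fun j => (i, j) ∈ E

lemma row_card {n : ℕ} (E : Finset (Fin 3 × Fin n)) (i : Fin 3) :
    (E.filter fun p => p.1 = i).card = (rowSet E i).card := by
  have : (E.filter fun p => p.1 = i) = (rowSet E i).image (fun j => (i, j)) := by
    ext ⟨a, b⟩
    simp only [rowSet, Finset.mem_filter, Finset.mem_image, Finset.mem_univ, true_and,
      Prod.mk.injEq]
    constructor
    · rintro ⟨h, rfl⟩; exact ⟨b, h, rfl, rfl⟩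
    · rintro ⟨c, h, rfl, rfl⟩; exact ⟨h, rfl⟩
  rw [this, Finset.card_image_of_injective]
  intro a b h; simpa using h

lemma col_card {n : ℕ} (E : Finset (Fin 3 × Fin n)) (j : Fin n) :
    (E.filter fun p => p.2 = j).card =
      (Finset.univ.filter fun i : Fin 3 => (i, j) ∈ E).card := by
  have : (E.filter fun p => p.2 = j) =
      (Finset.univ.filter fun i : Fin 3 => (i, j) ∈ E).image (fun i => (i, j)) := by
    ext ⟨a, b⟩
    simp only [Finset.mem_filter, Finset.mem_image, Finset.mem_univ, true_and,
      Prod.mk.injEq]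
    constructor
    · rintro ⟨h, rfl⟩; exact ⟨a, h, rfl, rfl⟩
    · rintro ⟨c, h, rfl, rfl⟩; exact ⟨h, rfl⟩
  rw [this, Finset.card_image_of_injective]
  intro a b h; simpa using h

lemma col_card' {n : ℕ} (E : Finset (Fin 3 × Fin n)) (j : Fin n) :
    (E.filter fun p => p.2 = j).card =
      (if (0, j) ∈ E then 1 else 0) + (if (1, j) ∈ E then 1 else 0) +
      (if (2, j) ∈ E then 1 else 0) := by
  rw [col_card, Finset.card_filter, Fin.sum_univ_three]

lemma card_rows {n : ℕ} (E : Finset (Fin 3 × Fin n)) :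
    E.card = (rowSet E 0).card + (rowSet E 1).card + (rowSet E 2).card := by
  rw [Finset.card_eq_sum_card_fiberwise (f := Prod.fst) (t := Finset.univ) (by simp),
    Fin.sum_univ_three, row_card, row_card, row_card]

/-- Regularity bounds the number of common columns of two rows. -/
lemma pair_le {n : ℕ} (E : Finset (Fin 3 × Fin n)) (hreg : RegularPattern 3 n 1 3 E)
    (i k : Fin 3) (hik : i ≠ k) : (rowSet E i ∩ rowSet E k).card ≤ 3 := by
  have h := hreg {i, k} (rowSet E i ∩ rowSet E k)
  have h2 : E ∩ ({i, k} : Finset (Fin 3)) ×ˢ (rowSet E i ∩ rowSet E k) =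
      ({i, k} : Finset (Fin 3)) ×ˢ (rowSet E i ∩ rowSet E k) := by
    apply Finset.inter_eq_right.mpr
    rintro ⟨a, b⟩ hab
    simp only [Finset.mem_product, Finset.mem_insert, Finset.mem_singleton, Finset.mem_inter,
      rowSet, Finset.mem_filter, Finset.mem_univ, true_and] at hab
    rcases hab with ⟨rfl | rfl, h1, h2⟩
    · exact h1
    · exact h2
  rw [h2, Finset.card_product, Finset.card_pair hik] at h
  omega

/-- a nonempty regular irreducible erasure pattern `E` for
`T_{3×n}(1,3,0)` (`n ≥ 6`) has `|U_E| = 3`, `|V_E| = 6`, `|E| = 12`, exactly `2`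
erasures in each column of `V_E` and exactly `4` erasures in each row, and up to row
and column permutations `E` equals the explicit pattern `E₀`. -/
theorem regular_irreducible_classification_T_3_n_1_3_0 (n : ℕ) (hn : 6 ≤ n)
    (E : Finset (Fin 3 × Fin n)) (hne : E.Nonempty)
    (hreg : RegularPattern 3 n 1 3 E) (hirr : IrreduciblePattern 3 n 1 3 E) :
    (E.image Prod.fst).card = 3 ∧ (E.image Prod.snd).card = 6 ∧ E.card = 12 ∧
    (∀ j ∈ E.image Prod.snd, (E.filter fun p => p.2 = j).card = 2) ∧
    (∀ i : Fin 3, (E.filter fun p => p.1 = i).card = 4) ∧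
    ∃ (σ : Equiv.Perm (Fin 3)) (τ : Equiv.Perm (Fin n)),
      E.image (fun p => (σ p.1, τ p.2)) =
        ({((0 : Fin 3), (⟨0, by omega⟩ : Fin n)), ((0 : Fin 3), (⟨1, by omega⟩ : Fin n)),
          ((0 : Fin 3), (⟨2, by omega⟩ : Fin n)), ((0 : Fin 3), (⟨3, by omega⟩ : Fin n)),
          ((1 : Fin 3), (⟨0, by omega⟩ : Fin n)), ((1 : Fin 3), (⟨1, by omega⟩ : Fin n)),
          ((1 : Fin 3), (⟨4, by omega⟩ : Fin n)), ((1 : Fin 3), (⟨5, by omega⟩ : Fin n)),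
          ((2 : Fin 3), (⟨2, by omega⟩ : Fin n)), ((2 : Fin 3), (⟨3, by omega⟩ : Fin n)),
          ((2 : Fin 3), (⟨4, by omega⟩ : Fin n)), ((2 : Fin 3), (⟨5, by omega⟩ : Fin n))} :
          Finset (Fin 3 × Fin n)) := by
  classical
  have h01 := pair_le E hreg 0 1 (by decide)
  have h02 := pair_le E hreg 0 2 (by decide)
  have h12 := pair_le E hreg 1 2 (by decide)
  have hcols : E.image Prod.snd = rowSet E 0 ∪ rowSet E 1 ∪ rowSet E 2 := by
    ext j
    simp only [Finset.mem_image, Prod.exists, exists_and_right, exists_eq_right, rowSet,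
      Finset.mem_union, Finset.mem_filter, Finset.mem_univ, true_and]
    rw [Fin.exists_fin_succ, Fin.exists_fin_two, or_assoc]
    rfl
  have htot : E.card ≤ (E.image Prod.snd).card + 6 := by
    have h := hreg Finset.univ (E.image Prod.snd)
    have h2 : E ∩ (Finset.univ : Finset (Fin 3)) ×ˢ (E.image Prod.snd) = E := by
      apply Finset.inter_eq_left.mpr
      rintro ⟨a, b⟩ hab
      simp only [Finset.mem_product, Finset.mem_univ, true_and]
      exact Finset.mem_image_of_mem Prod.snd hab
    rw [h2] at h
    simp only [Finset.card_univ, Fintype.card_fin] at h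
    omega
  -- columns with at least one erasure have at least two
  have hcol : ∀ i j, (i, j) ∈ E → 2 ≤ (if (0, j) ∈ E then 1 else 0) +
      (if (1, j) ∈ E then 1 else 0) + (if (2, j) ∈ E then 1 else 0) := by
    intro i j h
    have := (hirr _ h).1
    rw [col_card'] at this
    simpa using this
  have hrow : ∀ i, (rowSet E i).Nonempty → 4 ≤ (rowSet E i).card := by
    rintro i ⟨j, hj⟩
    have h : (i, j) ∈ E := by simpa [rowSet] using hj
    have := (hirr _ h).2
    rw [row_card] at this
    simpa using this
  have hE := card_rows E
  have mem : ∀ i j, j ∈ rowSet E i ↔ (i, j) ∈ E := by intro i j; simp [rowSet]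
  -- the four column classes
  obtain ⟨X, hX⟩ : ∃ X, X = (rowSet E 0 ∩ rowSet E 1) \ rowSet E 2 := ⟨_, rfl⟩
  obtain ⟨Y, hY⟩ : ∃ Y, Y = (rowSet E 0 ∩ rowSet E 2) \ rowSet E 1 := ⟨_, rfl⟩
  obtain ⟨Z, hZ⟩ : ∃ Z, Z = (rowSet E 1 ∩ rowSet E 2) \ rowSet E 0 := ⟨_, rfl⟩
  obtain ⟨T, hT⟩ : ∃ T, T = rowSet E 0 ∩ rowSet E 1 ∩ rowSet E 2 := ⟨_, rfl⟩
  have mX : ∀ j, j ∈ X ↔ ((0, j) ∈ E ∧ (1, j) ∈ E) ∧ (2, j) ∉ E := by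
    intro j; simp [hX, mem]
  have mY : ∀ j, j ∈ Y ↔ ((0, j) ∈ E ∧ (2, j) ∈ E) ∧ (1, j) ∉ E := by
    intro j; simp [hY, mem]
  have mZ : ∀ j, j ∈ Z ↔ ((1, j) ∈ E ∧ (2, j) ∈ E) ∧ (0, j) ∉ E := by
    intro j; simp [hZ, mem]
  have mT : ∀ j, j ∈ T ↔ ((0, j) ∈ E ∧ (1, j) ∈ E) ∧ (2, j) ∈ E := by
    intro j; simp [hT, mem, and_assoc]
  have dXY : Disjoint X Y := Finset.disjoint_left.mpr fun j => by rw [mX, mY]; tauto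
  have dXZ : Disjoint X Z := Finset.disjoint_left.mpr fun j => by rw [mX, mZ]; tauto
  have dYZ : Disjoint Y Z := Finset.disjoint_left.mpr fun j => by rw [mY, mZ]; tauto
  have dXT : Disjoint X T := Finset.disjoint_left.mpr fun j => by rw [mX, mT]; tauto
  have dYT : Disjoint Y T := Finset.disjoint_left.mpr fun j => by rw [mY, mT]; tauto
  have dZT : Disjoint Z T := Finset.disjoint_left.mpr fun j => by rw [mZ, mT]; tauto
  have r0 : rowSet E 0 = X ∪ Y ∪ T := by
    ext j
    simp only [Finset.mem_union, mem, mX, mY, mT]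
    have := hcol 0 j
    by_cases h0 : (0, j) ∈ E <;> by_cases h1 : (1, j) ∈ E <;> by_cases h2 : (2, j) ∈ E <;>
      simp [h0, h1, h2] at this ⊢
  have r1 : rowSet E 1 = X ∪ Z ∪ T := by
    ext j
    simp only [Finset.mem_union, mem, mX, mZ, mT]
    have := hcol 1 j
    by_cases h0 : (0, j) ∈ E <;> by_cases h1 : (1, j) ∈ E <;> by_cases h2 : (2, j) ∈ E <;>
      simp [h0, h1, h2] at this ⊢
  have r2 : rowSet E 2 = Y ∪ Z ∪ T := by
    ext j
    simp only [Finset.mem_union, mem, mY, mZ, mT]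
    have := hcol 2 j
    by_cases h0 : (0, j) ∈ E <;> by_cases h1 : (1, j) ∈ E <;> by_cases h2 : (2, j) ∈ E <;>
      simp [h0, h1, h2] at this ⊢
  have c0 : (rowSet E 0).card = X.card + Y.card + T.card := by
    rw [r0, Finset.card_union_of_disjoint (Finset.disjoint_union_left.mpr ⟨dXT, dYT⟩),
      Finset.card_union_of_disjoint dXY]
  have c1 : (rowSet E 1).card = X.card + Z.card + T.card := by
    rw [r1, Finset.card_union_of_disjoint (Finset.disjoint_union_left.mpr ⟨dXT, dZT⟩),
      Finset.card_union_of_disjoint dXZ]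
  have c2 : (rowSet E 2).card = Y.card + Z.card + T.card := by
    rw [r2, Finset.card_union_of_disjoint (Finset.disjoint_union_left.mpr ⟨dYT, dZT⟩),
      Finset.card_union_of_disjoint dYZ]
  have c01 : (rowSet E 0 ∩ rowSet E 1).card = X.card + T.card := by
    rw [← Finset.card_union_of_disjoint dXT]
    congr 1; ext j; simp only [Finset.mem_inter, Finset.mem_union, mem, mX, mT]; tauto
  have c02 : (rowSet E 0 ∩ rowSet E 2).card = Y.card + T.card := by
    rw [← Finset.card_union_of_disjoint dYT]
    congr 1; ext j; simp only [Finset.mem_inter, Finset.mem_union, mem, mY, mT]; tauto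
  have c12 : (rowSet E 1 ∩ rowSet E 2).card = Z.card + T.card := by
    rw [← Finset.card_union_of_disjoint dZT]
    congr 1; ext j; simp only [Finset.mem_inter, Finset.mem_union, mem, mZ, mT]; tauto
  have cc : (E.image Prod.snd).card = X.card + Y.card + Z.card + T.card := by
    have : E.image Prod.snd = X ∪ Y ∪ Z ∪ T := by
      rw [hcols, r0, r1, r2]; ext j; simp only [Finset.mem_union]; tauto
    rw [this, Finset.card_union_of_disjoint, Finset.card_union_of_disjoint,
      Finset.card_union_of_disjoint dXY]
    · exact Finset.disjoint_union_left.mpr ⟨dXZ, dYZ⟩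
    · exact Finset.disjoint_union_left.mpr ⟨Finset.disjoint_union_left.mpr ⟨dXT, dYT⟩, dZT⟩
  have hpos : 0 < E.card := hne.card_pos
  have hr : ∀ i, (rowSet E i).card = 0 ∨ 4 ≤ (rowSet E i).card := by
    intro i
    rcases Finset.eq_empty_or_nonempty (rowSet E i) with h | h
    · left; simp [h]
    · right; exact hrow i h
  have hr0 := hr 0
  have hr1 := hr 1
  have hr2 := hr 2
  have key : X.card = 2 ∧ Y.card = 2 ∧ Z.card = 2 ∧ T.card = 0 := by omega
  obtain ⟨kX, kY, kZ, kT⟩ := key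
  have hT0 : T = ∅ := Finset.card_eq_zero.mp kT
  have nT : ∀ j, ¬ (((0, j) ∈ E ∧ (1, j) ∈ E) ∧ (2, j) ∈ E) := by
    intro j; rw [← mT, hT0]; simp
  have rc : ∀ i : Fin 3, (rowSet E i).card = 4 := by
    intro i; fin_cases i <;> simp only [Fin.zero_eta, Fin.mk_one, Fin.reduceFinMk] <;> omega
  refine ⟨?_, by omega, by omega, ?_, fun i => by rw [row_card, rc], 1, ?_⟩
  · have : E.image Prod.fst = Finset.univ := by
      ext i
      simp only [Finset.mem_image, Finset.mem_univ, iff_true]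
      obtain ⟨j, hj⟩ : (rowSet E i).Nonempty := Finset.card_pos.mp (by rw [rc]; norm_num)
      exact ⟨(i, j), (mem i j).mp hj, rfl⟩
    rw [this]; simp
  · intro j hj
    obtain ⟨⟨i, j'⟩, h, rfl⟩ := Finset.mem_image.mp hj
    have h1 := hcol i j' h
    have h2 := nT j'
    rw [col_card']
    dsimp only
    by_cases a0 : (0, j') ∈ E <;> by_cases a1 : (1, j') ∈ E <;> by_cases a2 : (2, j') ∈ E <;>
      simp [a0, a1, a2] at h1 h2 ⊢
  · obtain ⟨x1, x2, hx, eX⟩ := Finset.card_eq_two.mp kX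
    obtain ⟨y1, y2, hy, eY⟩ := Finset.card_eq_two.mp kY
    obtain ⟨z1, z2, hz, eZ⟩ := Finset.card_eq_two.mp kZ
    have hEeq : E = {(0, x1), (0, x2), (0, y1), (0, y2), (1, x1), (1, x2), (1, z1), (1, z2),
        (2, y1), (2, y2), (2, z1), (2, z2)} := by
      ext ⟨i, j⟩
      rw [← mem]
      fin_cases i
      · simp [r0, eX, eY, hT0]; exact or_rot _ _ _ _
      · simp [r1, eX, eZ, hT0]; exact or_rot _ _ _ _
      · simp [r2, eY, eZ, hT0]; exact or_rot _ _ _ _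
    rw [eX, eY] at dXY
    rw [eX, eZ] at dXZ
    rw [eY, eZ] at dYZ
    simp only [Finset.disjoint_insert_left, Finset.disjoint_singleton_left, Finset.mem_insert,
      Finset.mem_singleton, not_or] at dXY dXZ dYZ
    obtain ⟨τ, hτ⟩ := exists_perm_of_families ![x1, x2, y1, y2, z1, z2]
      (fun k => ⟨k.1, by omega⟩)
      (by
        intro a b hab
        fin_cases a <;> fin_cases b <;> simp at hab ⊢ <;> grind)
      (by intro a b hab; simpa [Fin.ext_iff] using hab)
    have t0 := hτ 0
    have t1 := hτ 1
    have t2 := hτ 2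
    have t3 := hτ 3
    have t4 := hτ 4
    have t5 := hτ 5
    simp at t0 t1 t2 t3 t4 t5
    refine ⟨τ, ?_⟩
    rw [hEeq]
    simp only [Finset.image_insert, Finset.image_singleton, t0, t1, t2, t3, t4, t5,
      Equiv.Perm.coe_one, id]
end

section
/- Let C = C_col ⊗ C_row be a tensor product code over F_q instantiating the topology T_{m×n}(a,b,0), where C_col is an [m,m-a,a+1] MDS code and C_row is an [n,n-b,b+1] MDS code. Then C is maximally recoverable for the topology T_{m×n}(a,b,0) if and only if C corrects every erasure pattern that is both correctable for the topology and irreducible. -/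
open scoped Classical in
/-- `C` is an `[N, K, N-K+1]` MDS linear code over `F`: it has dimension `K` and every
nonzero codeword has Hamming weight at least `N - K + 1`. -/
def IsMDSCode (F : Type) [Field F] (N K : ℕ) (C : Submodule F (Fin N → F)) : Prop :=
  Module.finrank F C = K ∧
    ∀ v ∈ C, v ≠ 0 → N - K + 1 ≤ (Finset.univ.filter fun i => v i ≠ 0).card

/-- The tensor product code `C_col ⊗ C_row`: all `m × n` matrices whose columns lie in
`C_col` and whose rows lie in `C_row`. -/
def tensorCode {F : Type} [Field F] {m n : ℕ} (Ccol : Submodule F (Fin m → F))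
    (Crow : Submodule F (Fin n → F)) : Set (Matrix (Fin m) (Fin n) F) :=
  {c | (∀ j, (fun i => c i j) ∈ Ccol) ∧ ∀ i, c i ∈ Crow}

theorem CorrectableForTopology.mono_aux {m n a b : ℕ} {E E' : Finset (Fin m × Fin n)}
    (h : E' ⊆ E) (hE : CorrectableForTopology m n a b E) : CorrectableForTopology m n a b E' := by
  obtain ⟨F, fi, ft, C, hC, hc⟩ := hE
  exact ⟨F, fi, ft, C, hC, fun c₁ h₁ c₂ h₂ hh =>
    hc c₁ h₁ c₂ h₂ fun p hp => hh p fun hp' => hp (h hp')⟩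

/-- A pair of MDS codewords agreeing outside a set of at most `a` positions are equal. -/
theorem IsMDSCode.eq_aux {F : Type} [Field F] {N a : ℕ} (ha : a ≤ N)
    {C : Submodule F (Fin N → F)} (hC : IsMDSCode F N (N - a) C) {u v : Fin N → F}
    (hu : u ∈ C) (hv : v ∈ C) {α : Type} (S : Finset α) (hS : S.card ≤ a)
    (f : Fin N → α) (hf : Function.Injective f) (h : ∀ i, f i ∉ S → u i = v i) : u = v := by
  classical
  by_contra hne
  have h1 := hC.2 (u - v) (C.sub_mem hu hv) (sub_ne_zero.mpr hne)
  have h2 : (Finset.univ.filter fun i => (u - v) i ≠ 0).card ≤ S.card := by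
    apply Finset.card_le_card_of_injOn f _ hf.injOn
    intro i hi
    by_contra hn
    simp [h i hn] at hi
  have h3 : N - (N - a) + 1 ≤ a := by
    refine le_trans (le_trans h1 ?_) hS
    convert h2
  omega

/-- a tensor product code `C = C_col ⊗ C_row` over `F_q` with
`C_col` an `[m, m-a, a+1]` MDS code and `C_row` an `[n, n-b, b+1]` MDS code is
maximally recoverable for the topology `T_{m×n}(a,b,0)` if and only if it corrects
every erasure pattern that is both correctable for the topology and irreducible. -/
theorem MR_iff_corrects_correctable_irreducible (q : ℕ) (hq : IsPrimePow q)
    (F : Type) [Field F] [Fintype F] (hF : Fintype.card F = q)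
    (m n a b : ℕ) (ha : a ≤ m) (hb : b ≤ n)
    (Ccol : Submodule F (Fin m → F)) (Crow : Submodule F (Fin n → F))
    (hcol : IsMDSCode F m (m - a) Ccol) (hrow : IsMDSCode F n (n - b) Crow)
    (hinst : IsTensorTopologyCode F m n a b (tensorCode Ccol Crow)) :
    (∀ E : Finset (Fin m × Fin n), CorrectableForTopology m n a b E →
        CorrectsPattern (tensorCode Ccol Crow) E) ↔
      ∀ E : Finset (Fin m × Fin n), CorrectableForTopology m n a b E →
        IrreduciblePattern m n a b E → CorrectsPattern (tensorCode Ccol Crow) E := by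
  constructor
  · intro h E hE _
    exact h E hE
  · intro h E
    induction E using Finset.strongInduction with
    | H E ih =>
      intro hE
      by_cases hirr : IrreduciblePattern m n a b E
      · exact h E hE hirr
      · unfold IrreduciblePattern at hirr
        push Not at hirr
        obtain ⟨p, hp, hp'⟩ := hirr
        intro c₁ h₁ c₂ h₂ hagree
        by_cases hc : a + 1 ≤ (E.filter fun p' => p'.2 = p.2).card
        · have hr : (E.filter fun p' => p'.1 = p.1).card ≤ b := by
            have := hp' hc
            omega
          have hrow' : c₁ p.1 = c₂ p.1 := by
            refine hrow.eq_aux hb (h₁.2 p.1) (h₂.2 p.1) _ hr (fun j => (p.1, j)) ?_ ?_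
            · intro x y hxy
              simpa using hxy
            · intro j hj
              exact hagree (p.1, j) (by simpa using hj)
          have hss : (E.filter fun p' => p'.1 ≠ p.1) ⊂ E :=
            Finset.filter_ssubset.mpr ⟨p, hp, by simp⟩
          refine ih _ hss (hE.mono_aux hss.subset) c₁ h₁ c₂ h₂ ?_
          intro x hx
          by_cases hx1 : x.1 = p.1
          · rw [hx1, hrow']
          · exact hagree x fun hxE => hx (Finset.mem_filter.mpr ⟨hxE, hx1⟩)
        · have hr : (E.filter fun p' => p'.2 = p.2).card ≤ a := by omega
          have hcol' : (fun i => c₁ i p.2) = fun i => c₂ i p.2 := by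
            refine hcol.eq_aux ha (h₁.1 p.2) (h₂.1 p.2) _ hr (fun i => (i, p.2)) ?_ ?_
            · intro x y hxy
              simpa using hxy
            · intro i hi
              exact hagree (i, p.2) (by simpa using hi)
          have hss : (E.filter fun p' => p'.2 ≠ p.2) ⊂ E :=
            Finset.filter_ssubset.mpr ⟨p, hp, by simp⟩
          refine ih _ hss (hE.mono_aux hss.subset) c₁ h₁ c₂ h₂ ?_
          intro x hx
          by_cases hx1 : x.2 = p.2
          · rw [hx1]
            exact congrFun hcol' x.1
          · exact hagree x fun hxE => hx (Finset.mem_filter.mpr ⟨hxE, hx1⟩)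
end

section
/- Let m ≤ n and 1 ≤ b ≤ n-1. An erasure pattern E ⊆ [m]×[n] is correctable for the topology T_{m×n}(1,b,0) if and only if E is regular for T_{m×n}(1,b,0), i.e., for all U ⊆ [m] and V ⊆ [n], |E ∩ (U×V)| ≤ |V| + b|U| - b. -/
open Finset in
lemma exists_generic_matrix {ι : Type} [Fintype ι] [DecidableEq ι] (n b : ℕ)
    (hc : Fintype.card ι + b = n) (S : ι → Finset (Fin n))
    (hS : ∀ L : Finset ι, L.Nonempty → L.card + b ≤ (L.biUnion S).card) :
    ∃ (p : ℕ) (_ : Fact p.Prime) (W : Matrix ι (Fin n) (ZMod p)),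
      (∀ l j, j ∉ S l → W l j = 0) ∧
      ∀ f : ι → Fin n, Function.Injective f → (W.submatrix id f).det ≠ 0 := by
  classical
  let G : Matrix ι (Fin n) (MvPolynomial (ι × Fin n) ℤ) :=
    fun l j => if j ∈ S l then MvPolynomial.X (l, j) else 0
  have hGa : ∀ l j, G l j = if j ∈ S l then MvPolynomial.X (l, j) else 0 := fun _ _ => rfl
  have hG : ∀ f : ι ↪ Fin n, (G.submatrix id f).det ≠ 0 := by
    intro f h0
    have hall : ∀ L : Finset ι,
        L.card ≤ (L.biUnion (fun l => univ.filter (fun k => f k ∈ S l))).card := by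
      intro L
      rcases L.eq_empty_or_nonempty with rfl | hL
      · simp
      have h1 := hS L hL
      have h2 : (L.biUnion S) ⊆
          ((L.biUnion (fun l => univ.filter (fun k => f k ∈ S l))).map f) ∪
            (univ.map f)ᶜ := by
        intro j hj
        by_cases hjf : j ∈ (univ.map f)
        · obtain ⟨k, -, rfl⟩ := Finset.mem_map.1 hjf
          refine Finset.mem_union_left _ ?_
          simpa using hj
        · exact Finset.mem_union_right _ (Finset.mem_compl.2 hjf)
      have h3 := (Finset.card_le_card h2).trans (Finset.card_union_le _ _)
      rw [Finset.card_map, Finset.card_compl, Finset.card_map, Finset.card_univ,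
        Fintype.card_fin] at h3
      omega
    obtain ⟨g, hg, hgS⟩ := (Finset.all_card_le_biUnion_card_iff_exists_injective _).1 hall
    let e : Equiv.Perm ι := Equiv.ofBijective g (Finite.injective_iff_bijective.1 hg)
    let v : ι × Fin n → ℤ := fun q => if q.2 = f (g q.1) then 1 else 0
    have h4 := congrArg (MvPolynomial.eval v) h0
    rw [RingHom.map_det, map_zero] at h4
    have h5 : (MvPolynomial.eval v).mapMatrix (G.submatrix id f) = (e.toPEquiv).toMatrix := by
      ext l k
      have hgl : f (g l) ∈ S l := by simpa using hgS l
      simp only [RingHom.mapMatrix_apply, Matrix.map_apply, Matrix.submatrix_apply, id, hGa, v,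
        PEquiv.toMatrix_apply, Equiv.toPEquiv_apply, Option.mem_some_iff]
      have he : e l = g l := rfl
      rw [he]
      by_cases hk : g l = k
      · subst hk
        simp [hgl]
      · have : f k ≠ f (g l) := fun h => hk (f.injective h).symm
        by_cases hm : f k ∈ S l <;> simp [hm, hk, Ne.symm hk]
    rw [h5, Matrix.det_permutation] at h4
    simp at h4
  have hprod : (∏ f : ι ↪ Fin n, (G.submatrix id f).det) ≠ 0 :=
    Finset.prod_ne_zero_iff.2 fun f _ => hG f
  obtain ⟨v, hv⟩ : ∃ v : ι × Fin n → ℤ,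
      MvPolynomial.eval v (∏ f : ι ↪ Fin n, (G.submatrix id f).det) ≠ 0 := by
    by_contra! h
    exact hprod (MvPolynomial.funext fun x => by rw [h x, map_zero])
  obtain ⟨p, hp, hpp⟩ := Nat.exists_infinite_primes
    ((MvPolynomial.eval v (∏ f : ι ↪ Fin n, (G.submatrix id f).det)).natAbs + 1)
  have : Fact p.Prime := ⟨hpp⟩
  let φ : MvPolynomial (ι × Fin n) ℤ →+* ZMod p := (Int.castRingHom (ZMod p)).comp (MvPolynomial.eval v)
  refine ⟨p, ⟨hpp⟩, G.map φ, ?_, ?_⟩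
  · intro l j hj
    simp [hGa, hj]
  · intro f hf h0
    have h1 : φ (∏ f : ι ↪ Fin n, (G.submatrix id f).det) = 0 := by
      rw [map_prod]
      refine Finset.prod_eq_zero (Finset.mem_univ ⟨f, hf⟩) ?_
      rw [RingHom.map_det]
      exact h0
    have h2 : ((MvPolynomial.eval v (∏ f : ι ↪ Fin n, (G.submatrix id f).det) : ℤ) : ZMod p) = 0 := h1
    rw [ZMod.intCast_zmod_eq_zero_iff_dvd] at h2
    have h3 := Nat.le_of_dvd (Int.natAbs_pos.2 hv) (Int.natCast_dvd.1 h2)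
    omega

lemma mds_zero {F : Type} [Field F] {ι : Type} [Fintype ι] [DecidableEq ι] (n b : ℕ)
    (hc : Fintype.card ι + b = n) (W : Matrix ι (Fin n) F)
    (hW : ∀ f : ι → Fin n, Function.Injective f → (W.submatrix id f).det ≠ 0)
    (B : Finset (Fin n)) (hB : B.card ≤ b) (x : ι → F)
    (hx : ∀ j, j ∉ B → Matrix.vecMul x W j = 0) : x = 0 := by
  have h1 : Fintype.card ι ≤ Fintype.card {j // j ∈ Bᶜ} := by
    rw [Fintype.card_coe, Finset.card_compl, Fintype.card_fin]; omega
  obtain ⟨g⟩ := Function.Embedding.nonempty_of_card_le h1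
  refine Matrix.eq_zero_of_vecMul_eq_zero
    (hW (fun l => (g l).1) (Subtype.val_injective.comp g.injective)) ?_
  ext l
  exact hx (g l).1 (Finset.mem_compl.1 (g l).2)

lemma exists_parity {F : Type} [Field F] {ι : Type} [Fintype ι] [DecidableEq ι] (n b : ℕ)
    (hc : Fintype.card ι + b = n) (W : Matrix ι (Fin n) F)
    (hinj : ∀ x, Matrix.vecMul x W = 0 → x = 0) :
    ∃ H : Matrix (Fin b) (Fin n) F, ∀ c, H.mulVec c = 0 ↔ ∃ x, c = Matrix.vecMul x W := by
  classical
  let R : Submodule F (Fin n → F) := LinearMap.range W.vecMulLinear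
  have hR : Module.finrank F R = Fintype.card ι := by
    rw [LinearMap.finrank_range_of_inj]
    · simp
    · rw [← LinearMap.ker_eq_bot, LinearMap.ker_eq_bot']
      exact hinj
  have hq : Module.finrank F ((Fin n → F) ⧸ R) = Module.finrank F (Fin b → F) := by
    have := R.finrank_quotient_add_finrank
    simp at this ⊢
    omega
  let e := LinearEquiv.ofFinrankEq _ _ hq
  refine ⟨LinearMap.toMatrix' (e.toLinearMap ∘ₗ R.mkQ), fun c => ?_⟩
  rw [LinearMap.toMatrix'_mulVec]
  simp only [LinearMap.comp_apply, LinearEquiv.coe_coe, LinearEquiv.map_eq_zero_iff,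
    Submodule.mkQ_apply, Submodule.Quotient.mk_eq_zero, R, LinearMap.mem_range,
    Matrix.vecMulLinear_apply]
  exact exists_congr fun x => eq_comm

open Finset in
lemma regular_of_correctable (m n b : ℕ) (E : Finset (Fin m × Fin n))
    (h : CorrectableForTopology m n 1 b E) : RegularPattern m n 1 b E := by
  classical
  obtain ⟨F, fi, ft, C, ⟨Hcol, Hrow, rfl⟩, hC⟩ := h
  intro U V
  rcases U.eq_empty_or_nonempty with rfl | ⟨u, hu⟩
  · simp
  have hU : 1 ≤ U.card := Finset.card_pos.2 ⟨u, hu⟩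
  obtain ⟨t, ht⟩ : ∃ t, U.card = t + 1 := ⟨U.card - 1, by omega⟩
  have hgoal : 1 * V.card + b * U.card - 1 * b = V.card + b * t := by
    rw [ht, mul_add]; omega
  rw [hgoal]
  rcases lt_or_ge V.card b with hV | hV
  · calc _ ≤ (U ×ˢ V).card := card_le_card inter_subset_right
      _ = V.card * t + V.card := by rw [card_product, ht]; ring
      _ ≤ _ := by nlinarith
  -- the extension by zero of a vector indexed by the erased cells
  let K := E ∩ U ×ˢ V
  let ext : ({p // p ∈ K} → F) →ₗ[F] Matrix (Fin m) (Fin n) F :=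
    { toFun := fun x => Matrix.of fun i j => if hp : (i, j) ∈ K then x ⟨(i, j), hp⟩ else 0
      map_add' := by
        intro x y; ext i j; by_cases hp : (i, j) ∈ K <;> simp [hp]
      map_smul' := by
        intro x y; ext i j; by_cases hp : (i, j) ∈ K <;> simp [hp] }
  have hext0 : ∀ x i j, (i, j) ∉ K → ext x i j = 0 := by
    intro x i j hp; exact dif_neg hp
  have hext1 : ∀ x (p : {p // p ∈ K}), ext x p.1.1 p.1.2 = x p := by
    intro x p; exact dif_pos p.2
  have hker : ∀ x, (∀ j, Hcol.mulVec (fun i => ext x i j) = 0) →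
      (∀ i, Hrow.mulVec (ext x i) = 0) → x = 0 := by
    intro x h1 h2
    have h3 := hC (ext x) ⟨h1, h2⟩ 0 ⟨fun j => by
      have : (fun i => (0 : Matrix (Fin m) (Fin n) F) i j) = 0 := rfl
      rw [this, Matrix.mulVec_zero], fun i => by
      have : (0 : Matrix (Fin m) (Fin n) F) i = 0 := rfl
      rw [this, Matrix.mulVec_zero]⟩ (by
        intro p hp
        rw [hext0 x p.1 p.2 (fun hq => hp (mem_inter.1 hq).1)]; rfl)
    ext p
    rw [← hext1 x p, h3]; rfl
  have hrow0 : ∀ x i, i ∉ U → ext x i = 0 := by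
    intro x i hi
    ext j
    exact hext0 x i j (fun hq => hi (mem_product.1 (mem_inter.1 hq).2).1)
  have hcol0 : ∀ x j, j ∉ V → (fun i => ext x i j) = 0 := by
    intro x j hj
    ext i
    exact hext0 x i j (fun hq => hj (mem_product.1 (mem_inter.1 hq).2).2)
  by_cases hz : ∃ u ∈ U, Hcol 0 u ≠ 0
  · obtain ⟨u, hu, hne⟩ := hz
    let Φ : ({p // p ∈ K} → F) →ₗ[F] ({j // j ∈ V} → F) × ({i // i ∈ U.erase u} → Fin b → F) :=
      { toFun := fun x => (fun j => Hcol.mulVec (fun i => ext x i j) 0,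
          fun i => Hrow.mulVec (ext x i))
        map_add' := by
          intro x y
          rw [map_add]
          refine Prod.ext ?_ ?_
          · ext j
            exact congrFun (Matrix.mulVec_add Hcol (fun i => ext x i j) (fun i => ext y i j)) 0
          · ext i k
            exact congrFun (Matrix.mulVec_add Hrow (ext x i) (ext y i)) k
        map_smul' := by
          intro r x
          rw [map_smul]
          refine Prod.ext ?_ ?_
          · ext j
            exact congrFun (Matrix.mulVec_smul Hcol r (fun i => ext x i j)) 0
          · ext i k
            exact congrFun (Matrix.mulVec_smul Hrow r (ext x i)) k }
    have hΦ : Function.Injective Φ := by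
      rw [← LinearMap.ker_eq_bot, LinearMap.ker_eq_bot']
      intro x hx
      have hx1 : ∀ j ∈ V, Hcol.mulVec (fun i => ext x i j) 0 = 0 := fun j hj =>
        congrFun (congrArg Prod.fst hx) ⟨j, hj⟩
      have hx2 : ∀ i ∈ U.erase u, Hrow.mulVec (ext x i) = 0 := fun i hi =>
        congrFun (congrArg Prod.snd hx) ⟨i, hi⟩
      have hA : ∀ j, Hcol.mulVec (fun i => ext x i j) = 0 := by
        intro j
        by_cases hj : j ∈ V
        · ext k; rw [Subsingleton.elim k 0]; exact hx1 j hj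
        · rw [hcol0 x j hj, Matrix.mulVec_zero]
      have hB : ∀ i, i ≠ u → Hrow.mulVec (ext x i) = 0 := by
        intro i hi
        by_cases hiU : i ∈ U
        · exact hx2 i (mem_erase.2 ⟨hi, hiU⟩)
        · rw [hrow0 x i hiU, Matrix.mulVec_zero]
      refine hker x hA fun i => ?_
      by_cases hi : i = u
      · subst hi
        have hs : ∑ k, Hcol 0 k • ext x k = 0 := by
          ext j
          have := congrFun (hA j) 0
          simpa [Matrix.mulVec, dotProduct, Finset.sum_apply] using this
        have hs2 := congrArg Hrow.mulVecLin hs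
        rw [map_sum, map_zero, Finset.sum_eq_single i] at hs2
        · rw [map_smul, smul_eq_zero] at hs2
          exact hs2.resolve_left hne
        · intro k _ hk
          rw [map_smul, Matrix.mulVecLin_apply, hB k hk, smul_zero]
        · simp
      · exact hB i hi
    have := LinearMap.finrank_le_finrank_of_injective hΦ
    have h2 : Module.finrank F ({i // i ∈ U.erase u} → Fin b → F) = t * b := by
      rw [Module.finrank_pi_fintype]
      simp [card_erase_of_mem hu, ht]
    rw [Module.finrank_prod, h2] at this
    simp only [Module.finrank_fintype_fun_eq_card, Fintype.card_coe] at this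
    rw [mul_comm b t]
    exact this
  · push Not at hz
    let Φ : ({p // p ∈ K} → F) →ₗ[F] ({i // i ∈ U} → Fin b → F) :=
      { toFun := fun x i => Hrow.mulVec (ext x i)
        map_add' := by
          intro x y
          rw [map_add]
          ext i k
          exact congrFun (Matrix.mulVec_add Hrow (ext x i) (ext y i)) k
        map_smul' := by
          intro r x
          rw [map_smul]
          ext i k
          exact congrFun (Matrix.mulVec_smul Hrow r (ext x i)) k }
    have hΦ : Function.Injective Φ := by
      rw [← LinearMap.ker_eq_bot, LinearMap.ker_eq_bot']
      intro x hx
      refine hker x (fun j => ?_) (fun i => ?_)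
      · ext k
        rw [Subsingleton.elim k 0]
        change ∑ i, Hcol 0 i * ext x i j = 0
        refine Finset.sum_eq_zero fun i _ => ?_
        by_cases hi : i ∈ U
        · simp [hz i hi]
        · simp [hrow0 x i hi]
      · by_cases hi : i ∈ U
        · exact congrFun hx ⟨i, hi⟩
        · rw [hrow0 x i hi, Matrix.mulVec_zero]
    have := LinearMap.finrank_le_finrank_of_injective hΦ
    have h2 : Module.finrank F ({i // i ∈ U} → Fin b → F) = (t + 1) * b := by
      rw [Module.finrank_pi_fintype]
      simp [ht]
    rw [h2] at this
    simp only [Module.finrank_fintype_fun_eq_card, Fintype.card_coe] at this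
    change K.card ≤ _
    nlinarith

open Finset in
lemma correctable_of_regular (m n b : ℕ) (hbn : b ≤ n) (E : Finset (Fin m × Fin n))
    (h : RegularPattern m n 1 b E) : CorrectableForTopology m n 1 b E := by
  classical
  let R : Fin m → Finset (Fin n) := fun i => univ.filter (fun j => (i, j) ∈ E)
  have hBex : ∀ i, ∃ B ⊆ R i, B.card = min b (R i).card := fun i =>
    exists_subset_card_eq (min_le_right _ _)
  choose B hBR hBc using hBex
  have hBE : ∀ i j, j ∈ B i → (i, j) ∈ E := fun i j hj => by simpa [R] using hBR i hj
  have hBle : ∀ i, (B i).card ≤ b := fun i => (hBc i).trans_le (min_le_left _ _)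
  let P : Finset (Fin m × Fin n) := E.filter (fun p => p.2 ∉ B p.1)
  have hPE : ∀ p ∈ P, p ∈ E := fun p hp => (mem_filter.1 hp).1
  have hPB : ∀ p ∈ P, p.2 ∉ B p.1 := fun p hp => (mem_filter.1 hp).2
  have hBeq : ∀ p ∈ P, (B p.1).card = b := by
    intro p hp
    have hss : B p.1 ⊂ R p.1 := by
      refine (ssubset_iff_of_subset (hBR _)).2 ⟨p.2, ?_, hPB p hp⟩
      simpa [R] using hPE p hp
    have h1 := card_lt_card hss
    have h2 := hBc p.1
    omega
  have hall : ∀ L : Finset (Fin m × Fin n), L ⊆ P → L.Nonempty →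
      L.card + b ≤ (L.biUnion (fun p => insert p.2 (B p.1))).card := by
    intro L hL hne
    set V := L.biUnion (fun p => insert p.2 (B p.1)) with hVdef
    set U := L.image Prod.fst with hUdef
    have hreg := h U V
    have hU1 : 1 ≤ U.card := card_pos.2 (hne.image _)
    have hsub : L ∪ (U.sigma B).map (Equiv.sigmaEquivProd (Fin m) (Fin n)).toEmbedding ⊆
        E ∩ U ×ˢ V := by
      intro q hq
      rcases mem_union.1 hq with hq | hq
      · refine mem_inter.2 ⟨hPE q (hL hq), mem_product.2 ⟨mem_image_of_mem _ hq, ?_⟩⟩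
        exact mem_biUnion.2 ⟨q, hq, mem_insert_self _ _⟩
      · obtain ⟨⟨i, j⟩, hs, rfl⟩ := mem_map.1 hq
        obtain ⟨hi, hj⟩ := mem_sigma.1 hs
        obtain ⟨p, hp, hpi⟩ := mem_image.1 hi
        dsimp only at hj hpi
        subst hpi
        exact mem_inter.2 ⟨hBE _ _ hj, mem_product.2 ⟨hi,
          mem_biUnion.2 ⟨p, hp, mem_insert_of_mem hj⟩⟩⟩
    have hdisj : Disjoint L ((U.sigma B).map (Equiv.sigmaEquivProd (Fin m) (Fin n)).toEmbedding) := by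
      rw [disjoint_left]
      intro q hq hq2
      obtain ⟨⟨i, j⟩, hs, rfl⟩ := mem_map.1 hq2
      exact hPB _ (hL hq) (mem_sigma.1 hs).2
    have hcard := card_le_card hsub
    rw [card_union_of_disjoint hdisj, card_map, card_sigma] at hcard
    have hsum : ∑ i ∈ U, (B i).card = U.card * b := by
      refine sum_const_nat fun i hi => ?_
      obtain ⟨p, hp, rfl⟩ := mem_image.1 hi
      exact hBeq p (hL hp)
    rw [hsum] at hcard
    rw [mul_comm b U.card] at hreg
    have : b ≤ U.card * b := Nat.le_mul_of_pos_left b hU1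
    omega
  have hPn : P.card + b ≤ n := by
    rcases P.eq_empty_or_nonempty with hP | hP
    · simp [hP, hbn]
    · exact (hall P subset_rfl hP).trans ((card_le_univ _).trans (by simp))
  let ι := {p // p ∈ P} ⊕ Fin (n - b - P.card)
  have hc : Fintype.card ι + b = n := by
    simp only [ι, Fintype.card_sum, Fintype.card_coe, Fintype.card_fin]
    omega
  let S : ι → Finset (Fin n) := Sum.elim (fun p => insert p.1.2 (B p.1.1)) (fun _ => univ)
  have hS : ∀ L : Finset ι, L.Nonempty → L.card + b ≤ (L.biUnion S).card := by
    intro L hL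
    by_cases hr : ∃ k, Sum.inr k ∈ L
    · obtain ⟨k, hk⟩ := hr
      have : L.biUnion S = univ := eq_univ_of_forall fun j =>
        mem_biUnion.2 ⟨_, hk, mem_univ _⟩
      rw [this, card_univ, Fintype.card_fin]
      have := card_le_univ L
      omega
    · push Not at hr
      let L' : Finset (Fin m × Fin n) := P.filter (fun p => ∃ hp : p ∈ P, Sum.inl ⟨p, hp⟩ ∈ L)
      have hLL : L.card ≤ L'.card := by
        let f : ι → Option (Fin m × Fin n) := Sum.elim (fun p => some p.1) (fun _ => none)
        have : (L.image f) ⊆ L'.map Function.Embedding.some := by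
          intro o ho
          obtain ⟨l, hl, rfl⟩ := mem_image.1 ho
          rcases l with p | k
          · exact mem_map.2 ⟨p.1, mem_filter.2 ⟨p.2, p.2, hl⟩, rfl⟩
          · exact absurd hl (hr k)
        have h2 := card_le_card this
        rw [card_map, card_image_of_injOn] at h2
        · exact h2
        · intro x hx y hy hxy
          rcases x with x | x
          · rcases y with y | y
            · have := Option.some.inj hxy
              rw [Subtype.ext this]
            · exact absurd hy (hr y)
          · exact absurd hx (hr x)
      have hne : L'.Nonempty := card_pos.1 ((card_pos.2 hL).trans_le hLL)
      have h1 := hall L' (filter_subset _ _) hne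
      have h2 : L'.biUnion (fun p => insert p.2 (B p.1)) ⊆ L.biUnion S := by
        intro j hj
        obtain ⟨p, hp, hj⟩ := mem_biUnion.1 hj
        obtain ⟨-, hpP, hpL⟩ := mem_filter.1 hp
        exact mem_biUnion.2 ⟨_, hpL, hj⟩
      have h3 := card_le_card h2
      omega
  obtain ⟨p, hp, W, hWS, hW⟩ := exists_generic_matrix n b hc S hS
  obtain ⟨H, hH⟩ := exists_parity n b hc W (fun x hx =>
    mds_zero n b hc W hW ∅ (by simp) x (fun j _ => congrFun hx j))
  have hWne : ∀ q : {p // p ∈ P}, W (Sum.inl q) q.1.2 ≠ 0 := by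
    intro q hq
    have := mds_zero n b hc W hW (B q.1.1) (hBle _) (Pi.single (Sum.inl q) 1) (by
      intro j hj
      rw [Matrix.single_one_vecMul]
      by_cases hjq : j = q.1.2
      · subst hjq; exact hq
      · exact hWS _ _ (by simp [S, hjq, hj]))
    simpa using congrFun this (Sum.inl q)
  refine ⟨ZMod p, inferInstance, inferInstance, _, ⟨fun _ _ => 1, H, rfl⟩, ?_⟩
  rintro c₁ ⟨h11, h12⟩ c₂ ⟨h21, h22⟩ heq
  -- the difference
  have hd1 : ∀ j, ∑ i, (c₁ i j - c₂ i j) = 0 := by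
    intro j
    have e1 := congrFun (h11 j) 0
    have e2 := congrFun (h21 j) 0
    simp only [Matrix.mulVec, dotProduct, one_mul, Pi.zero_apply] at e1 e2
    rw [sum_sub_distrib, e1, e2, sub_zero]
  have hd2 : ∀ i, ∃ x, c₁ i - c₂ i = Matrix.vecMul x W := by
    intro i
    rw [← hH, Matrix.mulVec_sub, h12, h22, sub_zero]
  choose x hx using hd2
  have hd3 : ∀ i j, (i, j) ∉ E → Matrix.vecMul (x i) W j = 0 := by
    intro i j hij
    rw [← hx i, Pi.sub_apply, sub_eq_zero]
    exact heq (i, j) hij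
  let y : Fin m → ι → ZMod p := fun i =>
    Sum.elim (fun q => if q.1.1 = i then Matrix.vecMul (x i) W q.1.2 / W (Sum.inl q) q.1.2 else 0)
      (fun _ => 0)
  have hxy : ∀ i, x i = y i := by
    intro i
    rw [← sub_eq_zero]
    refine mds_zero n b hc W hW (B i) (hBle i) _ fun j hj => ?_
    rw [Matrix.sub_vecMul, Pi.sub_apply, sub_eq_zero]
    by_cases hij : (i, j) ∈ E
    · have hP : (i, j) ∈ P := mem_filter.2 ⟨hij, hj⟩
      symm
      change ∑ l, y i l * W l j = _
      rw [Finset.sum_eq_single (Sum.inl ⟨(i, j), hP⟩)]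
      · simp only [y, Sum.elim_inl, if_true]
        exact div_mul_cancel₀ _ (hWne ⟨(i, j), hP⟩)
      · rintro (q | k) - hq
        · by_cases hqi : q.1.1 = i
          · have hjq : j ≠ q.1.2 := by
              rintro rfl
              apply hq
              congr 1
              exact Subtype.ext (Prod.ext hqi rfl)
            rw [hWS, mul_zero]
            simp [S, hjq, hqi, hj]
          · simp [y, hqi]
        · simp [y]
      · simp
    · rw [hd3 i j hij]
      symm
      change ∑ l, y i l * W l j = _
      refine Finset.sum_eq_zero ?_
      rintro (q | k) -
      · by_cases hqi : q.1.1 = i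
        · have hjq : j ≠ q.1.2 := by
            rintro rfl
            apply hij
            rw [← hqi]
            exact hPE _ q.2
          rw [hWS, mul_zero]
          simp [S, hjq, hqi, hj]
        · simp [y, hqi]
      · simp [y]
  have hsum : ∑ i, x i = 0 := by
    refine mds_zero n b hc W hW ∅ (by simp) _ fun j _ => ?_
    rw [Matrix.sum_vecMul, Finset.sum_apply, ← hd1 j]
    exact sum_congr rfl fun i _ => (congrFun (hx i) j).symm
  have hx0 : ∀ i, x i = 0 := by
    intro i
    ext l
    rcases l with q | k
    · by_cases hqi : q.1.1 = i
      · have := congrFun hsum (Sum.inl q)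
        rw [Finset.sum_apply, Finset.sum_eq_single i] at this
        · exact this
        · intro i' _ hi'
          rw [hxy i']
          have : q.1.1 ≠ i' := fun h => hi' (h.symm.trans hqi)
          simp [y, this]
        · simp
      · rw [hxy i]; simp [y, hqi]
    · rw [hxy i]; simp [y]
  ext i j
  have := congrFun (hx i) j
  rw [hx0 i, Matrix.zero_vecMul, Pi.sub_apply, Pi.zero_apply, sub_eq_zero] at this
  exact this

/-- Gopalan et al.: for `m ≤ n` and `1 ≤ b ≤ n - 1`, an erasure
pattern `E ⊆ [m] × [n]` is correctable for the topology `T_{m×n}(1,b,0)` if and only if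
it is regular for `T_{m×n}(1,b,0)`. -/
theorem correctable_iff_regular_T_m_n_1_b_0 (m n b : ℕ) (hmn : m ≤ n)
    (hb1 : 1 ≤ b) (hb2 : b ≤ n - 1) (E : Finset (Fin m × Fin n)) :
    CorrectableForTopology m n 1 b E ↔ RegularPattern m n 1 b E := by
  exact ⟨regular_of_correctable m n b E, correctable_of_regular m n b (by omega) E⟩
end

section
/- Let p be a prime and let P be an (n-k)×n topology matrix whose entries p_{ij} = c_{ij0} + Σ_{l=1}^m c_{ijl} z_l are affine functions over F_p in variables z_1,...,z_m. If q is a power of p with q > (n-k) · Σ_{i=0}^{n-k} C(n,i), then there exists an assignment z_1 = α_1, ..., z_m = α_m with α_i ∈ F_q such that the instantiation P(α_1,...,α_m) is maximally recoverable: every set S ⊆ [n] of columns of P that is potentially independent is linearly independent in P(α_1,...,α_m). -/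
/-- The instantiation `P(α)` of the topology matrix `P` whose `(i,j)` entry is the
affine function `c0 i j + ∑ l, clin i j l * z l` over `F_p`, evaluated at `z = α` in a
ring `K` of characteristic `p`. -/
def topologyInstantiation {p : ℕ} (r n m : ℕ)
    (c0 : Matrix (Fin r) (Fin n) (ZMod p))
    (clin : Fin r → Fin n → Fin m → ZMod p)
    (K : Type) [Ring K] [CharP K p] (α : Fin m → K) :
    Matrix (Fin r) (Fin n) K :=
  Matrix.of fun i j =>
    ZMod.castHom dvd_rfl K (c0 i j) + ∑ l : Fin m, ZMod.castHom dvd_rfl K (clin i j l) * α l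

/-- A set `S` of columns of the topology `P` is potentially independent if for some
assignment of the variables in some field of characteristic `p`, the corresponding
columns of the instantiated matrix are linearly independent. -/
def PotentiallyIndependent {p : ℕ} (r n m : ℕ)
    (c0 : Matrix (Fin r) (Fin n) (ZMod p))
    (clin : Fin r → Fin n → Fin m → ZMod p) (S : Set (Fin n)) : Prop :=
  ∃ (K : Type) (_fi : Field K),
    haveI := _fi
    ∃ (_cp : CharP K p),
      haveI := _cp
      ∃ β : Fin m → K,
        LinearIndependent K
          (fun j : S => fun i => topologyInstantiation r n m c0 clin K β i j.1)

theorem aux_minor {K ι : Type} [Field K] [Fintype ι] [DecidableEq ι] {r : ℕ}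
    (v : ι → Fin r → K) (hv : LinearIndependent K v) :
    ∃ f : ι → Fin r, (Matrix.of fun a b => v b (f a)).det ≠ 0 := by
  classical
  have h1 : (Matrix.of v).rank = Fintype.card ι := LinearIndependent.rank_matrix hv
  rw [Matrix.rank_eq_finrank_span_cols] at h1
  obtain ⟨κ, a, ha, hsp, hli⟩ := exists_linearIndependent' K (Matrix.of v).col
  have : Fintype κ := Fintype.ofInjective a ha
  have h2 := linearIndependent_iff_card_eq_finrank_span.mp hli
  rw [Set.finrank, hsp, h1] at h2
  let e : ι ≃ κ := Fintype.equivOfCardEq h2.symm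
  refine ⟨a ∘ e, ?_⟩
  have h3 := hli.comp e e.injective
  have h4 : LinearIndependent K (Matrix.of fun x b => v b ((a ∘ e) x)).row := h3
  rw [Matrix.linearIndependent_rows_iff_isUnit, Matrix.isUnit_iff_isUnit_det] at h4
  exact h4.ne_zero

theorem aux_deg {R ι σ : Type} [CommRing R] [Fintype ι] [DecidableEq ι]
    (M : Matrix ι ι (MvPolynomial σ R)) (hM : ∀ i j, (M i j).totalDegree ≤ 1) :
    M.det.totalDegree ≤ Fintype.card ι := by
  rw [Matrix.det_apply]
  apply MvPolynomial.totalDegree_finsetSum_le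
  intro s _
  refine le_trans (MvPolynomial.totalDegree_smul_le _ _) ?_
  refine le_trans (MvPolynomial.totalDegree_finsetProd _ _) ?_
  refine le_trans (Finset.sum_le_sum (fun i _ => hM _ _)) ?_
  simp

/-- The entries of the topology as polynomials. -/
noncomputable def auxEntry {p : ℕ} (r n m : ℕ)
    (c0 : Matrix (Fin r) (Fin n) (ZMod p))
    (clin : Fin r → Fin n → Fin m → ZMod p) (i : Fin r) (j : Fin n) :
    MvPolynomial (Fin m) (ZMod p) :=
  MvPolynomial.C (c0 i j) + ∑ l, MvPolynomial.C (clin i j l) * MvPolynomial.X l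

theorem auxEntry_deg {p : ℕ} (r n m : ℕ)
    (c0 : Matrix (Fin r) (Fin n) (ZMod p))
    (clin : Fin r → Fin n → Fin m → ZMod p) (i : Fin r) (j : Fin n) :
    (auxEntry r n m c0 clin i j).totalDegree ≤ 1 := by
  unfold auxEntry
  refine le_trans (MvPolynomial.totalDegree_add _ _) (max_le (by simp) ?_)
  apply MvPolynomial.totalDegree_finsetSum_le
  intro l _
  rw [MvPolynomial.C_mul_X_eq_monomial]
  refine le_trans (MvPolynomial.totalDegree_monomial_le _ _) ?_
  simp

theorem auxEntry_eval {p : ℕ} (r n m : ℕ)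
    (c0 : Matrix (Fin r) (Fin n) (ZMod p))
    (clin : Fin r → Fin n → Fin m → ZMod p) (K : Type) [Field K] [CharP K p] (β : Fin m → K)
    (i : Fin r) (j : Fin n) :
    MvPolynomial.eval₂Hom (ZMod.castHom dvd_rfl K) β (auxEntry r n m c0 clin i j) =
      topologyInstantiation r n m c0 clin K β i j := by
  simp [auxEntry, topologyInstantiation]

theorem aux_poly {p : ℕ} (r n m : ℕ)
    (c0 : Matrix (Fin r) (Fin n) (ZMod p))
    (clin : Fin r → Fin n → Fin m → ZMod p) (S : Set (Fin n))
    (hS : PotentiallyIndependent r n m c0 clin S) :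
    S.ncard ≤ r ∧ ∃ g : MvPolynomial (Fin m) (ZMod p), g ≠ 0 ∧ g.totalDegree ≤ r ∧
      ∀ (F : Type) [Field F] [CharP F p] (α : Fin m → F),
        MvPolynomial.eval₂Hom (ZMod.castHom dvd_rfl F) α g ≠ 0 →
        LinearIndependent F
          (fun j : S => fun i => topologyInstantiation r n m c0 clin F α i j.1) := by
  classical
  obtain ⟨K, _, _, β, hβ⟩ := hS
  have hcard : Fintype.card S ≤ r := by
    simpa using hβ.fintype_card_le_finrank
  refine ⟨by rwa [← Nat.card_coe_set_eq, Nat.card_eq_fintype_card], ?_⟩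
  obtain ⟨f, hf⟩ := aux_minor _ hβ
  have key : ∀ (F : Type) [Field F] [CharP F p] (α : Fin m → F),
      MvPolynomial.eval₂Hom (ZMod.castHom dvd_rfl F) α
        (Matrix.of fun a b : S => auxEntry r n m c0 clin (f a) b.1).det =
      (Matrix.of fun a b : S => topologyInstantiation r n m c0 clin F α (f a) b.1).det := by
    intro F _ _ α
    rw [RingHom.map_det]
    congr 1
    ext a b
    exact auxEntry_eval ..
  refine ⟨(Matrix.of fun a b : S => auxEntry r n m c0 clin (f a) b.1).det, ?_, ?_, ?_⟩
  · intro h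
    apply hf
    rw [← key, h, map_zero]
  · exact (aux_deg _ (fun i j => auxEntry_deg ..)).trans hcard
  · intro F _ _ α h
    rw [key] at h
    have := Matrix.linearIndependent_cols_of_det_ne_zero h
    exact LinearIndependent.of_comp (LinearMap.funLeft F F f) this

theorem aux_sz {F : Type} [Field F] [Fintype F] {m : ℕ} (g : MvPolynomial (Fin m) F)
    (hg : g ≠ 0) (hd : g.totalDegree < Fintype.card F) :
    ∃ α : Fin m → F, MvPolynomial.eval α g ≠ 0 := by
  classical
  by_contra! h
  have := MvPolynomial.schwartz_zippel_totalDegree hg (Finset.univ : Finset F)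
  have hpos : (0 : ℚ≥0) < Fintype.card F := by exact_mod_cast Fintype.card_pos
  have h2 : (g.totalDegree : ℚ≥0) / Fintype.card F < 1 := by
    rw [div_lt_one hpos]; exact_mod_cast hd
  have h3 := this.trans_lt h2
  simp [h, hpos.ne'] at h3

/-- Gopalan et al.: for any topology `P` over `F_p` with entries
affine in `z₁, …, z_m`, if `q = p^e` satisfies `q > (n-k) · ∑_{i ≤ n-k} C(n,i)`, then
there is an assignment `α` over the field `F` with `q` elements whose instantiation is
maximally recoverable: every potentially independent set of columns of `P` is linearly
independent in `P(α)`. -/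
theorem exists_MR_instantiation_of_topology (p : ℕ) (hp : p.Prime) (n k m : ℕ) (hk : k ≤ n)
    (c0 : Matrix (Fin (n - k)) (Fin n) (ZMod p))
    (clin : Fin (n - k) → Fin n → Fin m → ZMod p)
    (q : ℕ) (hq : ∃ e : ℕ, 0 < e ∧ q = p ^ e)
    (hbig : (n - k) * ∑ i ∈ Finset.range (n - k + 1), Nat.choose n i < q)
    (F : Type) [Field F] [Fintype F] [CharP F p] (hF : Fintype.card F = q) :
    ∃ α : Fin m → F, ∀ S : Set (Fin n),
      PotentiallyIndependent (n - k) n m c0 clin S →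
      LinearIndependent F
        (fun j : S => fun i => topologyInstantiation (n - k) n m c0 clin F α i j.1) := by
  classical
  have : Fact p.Prime := ⟨hp⟩
  have H := aux_poly (n - k) n m c0 clin
  generalize hr : n - k = r at *
  choose! hc g hg0 hgd hgl using H
  let T : Finset (Finset (Fin n)) :=
    Finset.univ.filter fun S => PotentiallyIndependent r n m c0 clin (S : Set (Fin n))
  have hT : T.card ≤ ∑ i ∈ Finset.range (r + 1), Nat.choose n i := by
    have hsub : T ⊆ (Finset.range (r + 1)).biUnion
        fun i => Finset.powersetCard i (Finset.univ : Finset (Fin n)) := by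
      intro S hS
      have := hc _ (Finset.mem_filter.mp hS).2
      rw [Set.ncard_coe_finset] at this
      simp only [Finset.mem_biUnion, Finset.mem_range, Finset.mem_powersetCard]
      exact ⟨S.card, by omega, Finset.subset_univ _, rfl⟩
    refine (Finset.card_le_card hsub).trans (Finset.card_biUnion_le.trans ?_)
    simp
  let G : MvPolynomial (Fin m) (ZMod p) := ∏ S ∈ T, g (S : Set (Fin n))
  have hG0 : G ≠ 0 := Finset.prod_ne_zero_iff.mpr fun S hS => hg0 _ (Finset.mem_filter.mp hS).2
  have hGd : G.totalDegree ≤ r * ∑ i ∈ Finset.range (r + 1), Nat.choose n i := by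
    refine (MvPolynomial.totalDegree_finsetProd _ _).trans ?_
    refine (Finset.sum_le_card_nsmul _ _ r
      fun S hS => hgd _ (Finset.mem_filter.mp hS).2).trans ?_
    rw [smul_eq_mul, mul_comm]
    exact Nat.mul_le_mul_left _ hT
  let φ : ZMod p →+* F := ZMod.castHom dvd_rfl F
  have hφ : Function.Injective φ := φ.injective
  obtain ⟨α, hα⟩ := aux_sz (MvPolynomial.map φ G)
    (by
      rw [Ne, ← map_zero (MvPolynomial.map φ)]
      exact fun h => hG0 (MvPolynomial.map_injective φ hφ h))
    (by
      refine lt_of_le_of_lt ?_ (hF ▸ hbig)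
      refine le_trans (Finset.sup_mono (MvPolynomial.support_map_subset _ _)) ?_
      exact hGd)
  refine ⟨α, fun S hS => hgl S hS F α ?_⟩
  have hST : S.toFinset ∈ T := by simpa [T] using hS
  rw [MvPolynomial.eval_map, ← MvPolynomial.coe_eval₂Hom, map_prod] at hα
  have := Finset.prod_ne_zero_iff.mp hα _ hST
  simpa using this
end
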